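/- Let a and m be positive integers with m = 1 or m = 2, and let p be a prime with gcd(a, p) = 1 and a² + p^(2m) not a perfect square. Suppose the negative Pell equation x² − (a² + p^(2m))·y² = −1 has a solution in integers x, y. Then there are at most three pairs (X, Y) of positive integers (not necessarily coprime) satisfying X² − (a² + p^(2m))·Y⁴ = −p^(2m). -/

import Mathlib

/-- Coefficient extraction for products with individual degree bounds. -/
theorem Polynomial.coeff_prod_sum_of_natDegree_le {R ι : Type*} [CommSemiring R] (s : Finset ι)
    (f : ι → Polynomial R) (n : ι → ℕ) (h : ∀ i ∈ s, (f i).natDegree ≤ n i) :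
    (∏ i ∈ s, f i).coeff (∑ i ∈ s, n i) = ∏ i ∈ s, (f i).coeff (n i) := by
  classical
  induction s using Finset.induction_on with
  | empty => simp
  | insert a s ha ih =>
    rw [Finset.prod_insert ha, Finset.sum_insert ha, Finset.prod_insert ha,
      Polynomial.coeff_mul_add_eq_of_natDegree_le (h a (by simp)), ih]
    · intro i hi; exact h i (by simp [hi])
    · refine (Polynomial.natDegree_prod_le _ _).trans (Finset.sum_le_sum fun i hi => ?_)
      exact h i (by simp [hi])

/-- The top coefficient of a determinant of polynomials with column-wise degree bounds. -/
theorem Polynomial.coeff_det_sum_of_natDegree_le {R : Type*} [CommRing R] {m : ℕ}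
    (M : Matrix (Fin m) (Fin m) (Polynomial R)) (n : Fin m → ℕ)
    (h : ∀ i l, (M i l).natDegree ≤ n l) :
    M.det.coeff (∑ l, n l) = (Matrix.of fun i l => (M i l).coeff (n l)).det := by
  rw [Matrix.det_apply, Matrix.det_apply, Polynomial.finsetSum_coeff]
  refine Finset.sum_congr rfl fun σ _ => ?_
  rw [Polynomial.coeff_smul, Polynomial.coeff_prod_sum_of_natDegree_le _ _ _ (fun i _ => h _ i)]
  simp

theorem Polynomial.natDegree_det_le_sum {R : Type*} [CommRing R] {m : ℕ}
    (M : Matrix (Fin m) (Fin m) (Polynomial R)) (n : Fin m → ℕ)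
    (h : ∀ i l, (M i l).natDegree ≤ n l) :
    M.det.natDegree ≤ ∑ l, n l := by
  rw [Matrix.det_apply]
  refine Polynomial.natDegree_sum_le_of_forall_le _ _ fun σ _ => ?_
  refine (Polynomial.natDegree_smul_le _ _).trans ?_
  refine (Polynomial.natDegree_prod_le _ _).trans (Finset.sum_le_sum fun i _ => h _ i)

/-- Zero estimate: a polynomial `∑ Q_l(x) y^l` vanishing at many points
`(r u + s v, α^r β^s)` is zero. -/
theorem zero_estimate {F : Type*} [Field F] [CharZero F] {K L : ℕ} (Q : Fin L → Polynomial F)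
    (hdeg : ∀ l, (Q l).natDegree ≤ K) (α β : F) (hα : α ≠ 0) (hβ : β ≠ 0)
    (hinj : Function.Injective fun i : ℕ => α ^ i) (u v R S : ℕ) (huv : Nat.Coprime u v)
    (hRv : R ≤ v)
    (hvan : ∀ r < R + L, ∀ s < S,
      ∑ l, (Q l).eval (((r * u + s * v : ℕ)) : F) * (α ^ r * β ^ s) ^ (l : ℕ) = 0)
    (hbig : K * L < R * S) : Q = 0 := by
  classical
  by_contra hQ
  set Λ : Finset (Fin L) := Finset.univ.filter fun l => Q l ≠ 0 with hΛ
  set m := Λ.card with hm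
  have hmpos : 0 < m := by
    rw [hm, Finset.card_pos]
    obtain ⟨l, hl⟩ := Function.ne_iff.1 hQ
    exact ⟨l, by simpa [hΛ] using hl⟩
  have hmL : m ≤ L := (Finset.card_le_univ Λ).trans (by simp)
  let e : Fin m ≃ Λ := Λ.equivFin.symm
  have he : ∀ i, Q (e i) ≠ 0 := fun i => by
    exact (Finset.mem_filter.1 (e i).2).2
  let M : Matrix (Fin m) (Fin m) (Polynomial F) := Matrix.of fun i l =>
    Polynomial.C (α ^ ((i : ℕ) * ((e l : Fin L) : ℕ))) *
      (Q (e l)).comp (Polynomial.X + Polynomial.C ((((i : ℕ) * u : ℕ)) : F))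
  have hMdeg : ∀ i l, (M i l).natDegree ≤ (Q (e l)).natDegree := by
    intro i l
    have h1 : ((Q (e l)).comp (Polynomial.X + Polynomial.C ((((i : ℕ) * u : ℕ)) : F))).natDegree
        = (Q (e l)).natDegree := by
      rw [Polynomial.natDegree_comp, Polynomial.natDegree_X_add_C, mul_one]
    exact (Polynomial.natDegree_C_mul_le _ _).trans h1.le
  have hlead : ∀ i l, (M i l).coeff (Q (e l)).natDegree =
      (α ^ ((e l : Fin L) : ℕ)) ^ (i : ℕ) * (Q (e l)).leadingCoeff := by
    intro i l
    simp only [M, Matrix.of_apply, Polynomial.coeff_C_mul]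
    rw [← pow_mul, mul_comm (((e l : Fin L) : ℕ))]
    congr 1
    have h1 : ((Q (e l)).comp (Polynomial.X + Polynomial.C ((((i : ℕ) * u : ℕ)) : F))).natDegree
        = (Q (e l)).natDegree := by
      rw [Polynomial.natDegree_comp, Polynomial.natDegree_X_add_C, mul_one]
    conv_lhs => rw [← h1]
    rw [Polynomial.coeff_natDegree, Polynomial.leadingCoeff_comp
      (by rw [Polynomial.natDegree_X_add_C]; exact one_ne_zero), Polynomial.leadingCoeff_X_add_C,
      one_pow, mul_one]
  have hdet0 : M.det ≠ 0 := by
    intro h0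
    have h1 := Polynomial.coeff_det_sum_of_natDegree_le M _ hMdeg
    rw [h0, Polynomial.coeff_zero] at h1
    have h2 : (Matrix.of fun i l => (M i l).coeff (Q (e l)).natDegree) =
        (Matrix.vandermonde fun l => α ^ ((e l : Fin L) : ℕ)).transpose *
          Matrix.diagonal fun l => (Q (e l)).leadingCoeff := by
      ext i l
      rw [Matrix.mul_diagonal, Matrix.of_apply, hlead]
      simp [Matrix.vandermonde]
    rw [h2, Matrix.det_mul, Matrix.det_transpose, Matrix.det_diagonal] at h1
    refine (mul_ne_zero ?_ ?_) h1.symm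
    · rw [Matrix.det_vandermonde_ne_zero_iff]
      intro i j hij
      have := hinj hij
      exact e.injective (Subtype.ext (Fin.ext this))
    · exact Finset.prod_ne_zero_iff.2 fun l _ => by
        simpa using he l
  -- the determinant vanishes at all the points
  have hroot : ∀ r < R, ∀ s < S, M.det.eval (((r * u + s * v : ℕ)) : F) = 0 := by
    intro r hr s hs
    rw [← Polynomial.coe_evalRingHom, RingHom.map_det]
    rw [← Matrix.exists_mulVec_eq_zero_iff]
    refine ⟨fun l => (α ^ r * β ^ s) ^ ((e l : Fin L) : ℕ), ?_, ?_⟩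
    · intro h0
      have := congrFun h0 ⟨0, hmpos⟩
      exact pow_ne_zero _ (mul_ne_zero (pow_ne_zero _ hα) (pow_ne_zero _ hβ)) this
    · ext i
      have hv := hvan (r + i) (by have := i.2; omega) s hs
      simp only [Matrix.mulVec, dotProduct, Pi.zero_apply]
      rw [← hv]
      have hsum : ∀ g : Fin L → F, (∀ l, Q l = 0 → g l = 0) → ∑ l, g l = ∑ j : Fin m, g (e j) := by
        intro g hg
        rw [← Finset.sum_subset (Finset.subset_univ Λ)
          (fun l _ hl => hg l (by simpa [hΛ] using hl)),
          ← Finset.sum_coe_sort Λ, ← Equiv.sum_comp e]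
      rw [hsum _ (fun l hl => by simp [hl])]
      refine Finset.sum_congr rfl fun j _ => ?_
      simp only [M, RingHom.mapMatrix_apply, Matrix.map_apply, Matrix.of_apply,
        Polynomial.coe_evalRingHom, Polynomial.eval_mul, Polynomial.eval_C, Polynomial.eval_comp,
        Polynomial.eval_add, Polynomial.eval_X]
      have h1 : ((r * u + s * v : ℕ) : F) + ((i * u : ℕ) : F) = (((r + i) * u + s * v : ℕ) : F) := by
        push_cast; ring
      rw [h1]
      have h2 : (α ^ (r + (i : ℕ)) * β ^ s) ^ ((e j : Fin L) : ℕ) =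
          α ^ ((i : ℕ) * ((e j : Fin L) : ℕ)) * (α ^ r * β ^ s) ^ ((e j : Fin L) : ℕ) := by
        rw [pow_add, mul_comm (i : ℕ), pow_mul', mul_pow, mul_pow, mul_pow]; ring
      rw [h2]; ring
  -- too many roots
  have hvpos : 0 < v := by
    rcases Nat.eq_zero_or_pos R with h | h
    · simp [h] at hbig
    · omega
  let pts : Finset F := ((Finset.range R) ×ˢ (Finset.range S)).image
    fun z => (((z.1 * u + z.2 * v : ℕ)) : F)
  have hcard : pts.card = R * S := by
    rw [Finset.card_image_of_injOn, Finset.card_product, Finset.card_range, Finset.card_range]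
    rintro ⟨r, s⟩ h ⟨r', s'⟩ h' heq
    simp only [Finset.coe_product, Finset.coe_range, Set.mem_prod, Set.mem_Iio] at h h'
    have heq' : r * u + s * v = r' * u + s' * v := Nat.cast_injective heq
    have hmod : r * u ≡ r' * u [MOD v] := by
      have h3 : (r * u + s * v) % v = (r' * u + s' * v) % v := by rw [heq']
      simpa [Nat.ModEq] using h3
    have hr : r ≡ r' [MOD v] := Nat.ModEq.cancel_right_of_coprime
      (by rw [Nat.gcd_comm]; exact huv) hmod
    have hr' : r = r' := Nat.ModEq.eq_of_lt_of_lt hr (by omega) (by omega)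
    subst hr'
    have : s * v = s' * v := by omega
    have := Nat.eq_of_mul_eq_mul_right hvpos this
    simp [this]
  have hle : pts.card ≤ M.det.natDegree := by
    by_contra hlt
    push Not at hlt
    refine hdet0 (Polynomial.eq_zero_of_natDegree_lt_card_of_eval_eq_zero' M.det pts ?_ hlt)
    intro x hx
    simp only [pts, Finset.mem_image, Finset.mem_product, Finset.mem_range] at hx
    obtain ⟨z, hz, rfl⟩ := hx
    exact hroot _ hz.1 _ hz.2
  have h3 := Polynomial.natDegree_det_le_sum M _ hMdeg
  have h4 : ∑ l, (Q (e l)).natDegree ≤ m * K := by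
    refine (Finset.sum_le_sum fun l _ => hdeg (e l)).trans ?_
    simp
  have h5 : m * K ≤ K * L := by rw [mul_comm]; exact Nat.mul_le_mul_left _ hmL
  omega

/-- A matrix with linearly independent rows has a nonvanishing maximal minor. -/
theorem Matrix.exists_submatrix_det_ne_zero {F : Type*} [Field F] {N : ℕ} {ι : Type*} [Fintype ι]
    (M : Matrix (Fin N) ι F) (h : ∀ c : Fin N → F, Matrix.vecMul c M = 0 → c = 0) :
    ∃ e : Fin N → ι, (M.submatrix id e).det ≠ 0 := by
  classical
  have hli : LinearIndependent F M.row := by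
    rw [Fintype.linearIndependent_iff]
    intro g hg
    have : Matrix.vecMul g M = 0 := by
      rw [← hg]; ext j; simp [Matrix.vecMul, dotProduct, Matrix.row]
    exact fun i => congrFun (h g this) i
  have hrank : M.rank = N := by
    rw [Matrix.rank_eq_finrank_span_row, finrank_span_eq_card hli, Fintype.card_fin]
  rw [Matrix.rank_eq_finrank_span_cols] at hrank
  obtain ⟨f, hf1, -, hf3⟩ := Submodule.exists_fun_fin_finrank_span_eq F (Set.range M.col)
  choose g hg using hf1
  refine ⟨fun i => g (Fin.cast hrank.symm i), ?_⟩
  have hli2 : LinearIndependent F (M.submatrix id fun i => g (Fin.cast hrank.symm i)).col := by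
    have h1 := hf3.comp (Fin.cast hrank.symm) (Fin.cast_injective _)
    have h2 : (M.submatrix id fun i => g (Fin.cast hrank.symm i)).col =
        f ∘ Fin.cast hrank.symm := by
      ext i j
      exact congrFun (hg (Fin.cast hrank.symm i)) j
    rw [h2]
    exact h1
  rw [Matrix.linearIndependent_cols_iff_isUnit, Matrix.isUnit_iff_isUnit_det] at hli2
  exact hli2.ne_zero

theorem Matrix.norm_det_le_of_row_bound {F : Type*} [NormedField F] {N : ℕ}
    (M : Matrix (Fin N) (Fin N) F)
    (B : Fin N → ℝ) (h : ∀ i j, ‖M i j‖ ≤ B i) : ‖M.det‖ ≤ N.factorial * ∏ i, B i := by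
  rw [← Matrix.det_transpose, Matrix.det_apply']
  refine (norm_sum_le _ _).trans ?_
  have : ∀ σ ∈ (Finset.univ : Finset (Equiv.Perm (Fin N))),
      ‖((Equiv.Perm.sign σ : ℤ) : F) * ∏ i, M.transpose (σ i) i‖ ≤ ∏ i, B i := by
    intro σ _
    rw [norm_mul, norm_prod]
    have h1 : ‖((Equiv.Perm.sign σ : ℤ) : F)‖ = 1 := by
      rcases Int.units_eq_one_or (Equiv.Perm.sign σ) with h | h <;> simp [h]
    rw [h1, one_mul]
    exact Finset.prod_le_prod (fun i _ => norm_nonneg _) fun i _ => h i _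
  refine (Finset.sum_le_card_nsmul _ _ _ this).trans ?_
  rw [nsmul_eq_mul, Finset.card_univ, Fintype.card_perm, Fintype.card_fin]

/-- A determinant with too many rows given by low-degree polynomials vanishes. -/
theorem Matrix.det_eq_zero_of_polynomial_rows {F : Type*} [Field F] {N T : ℕ}
    (M : Matrix (Fin N) (Fin N) F)
    (x : Fin N → F) (p : Fin N → Polynomial F) (s : Finset (Fin N))
    (hM : ∀ i ∈ s, ∀ j, M i j = (p i).eval (x j)) (hp : ∀ i ∈ s, (p i).natDegree < T)
    (hs : T < s.card) : M.det = 0 := by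
  classical
  by_contra hdet
  have hli : LinearIndependent F M.row := by
    rw [Matrix.linearIndependent_rows_iff_isUnit, Matrix.isUnit_iff_isUnit_det]
    exact isUnit_iff_ne_zero.2 hdet
  have hli' : LinearIndependent F (fun i : s => M.row i) := hli.comp _ Subtype.val_injective
  let W : Submodule F (Fin N → F) :=
    Submodule.span F (Set.range fun (t : Fin T) (j : Fin N) => x j ^ (t : ℕ))
  have hmem : ∀ i : s, M.row i ∈ W := by
    intro i
    have : M.row i = ∑ t : Fin T, (p i).coeff t • fun j : Fin N => x j ^ (t : ℕ) := by
      ext j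
      simp only [Matrix.row, hM i i.2 j, Finset.sum_apply, Pi.smul_apply, smul_eq_mul]
      rw [Polynomial.eval_eq_sum_range' (hp i i.2), Finset.sum_range]
    rw [this]
    exact Submodule.sum_mem _ fun t _ => Submodule.smul_mem _ _ (Submodule.subset_span ⟨t, rfl⟩)
  have h1 : LinearIndependent F (fun i : s => (⟨M.row i, hmem i⟩ : W)) :=
    LinearIndependent.of_comp W.subtype hli'
  have h2 := h1.fintype_card_le_finrank
  have h3 : Module.finrank F W ≤ T := by
    have := finrank_range_le_card (R := F) (fun (t : Fin T) (j : Fin N) => x j ^ (t : ℕ))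
    simpa [Set.finrank] using this
  rw [Fintype.card_coe] at h2
  omega

/-- Interpolation determinants: a determinant whose rows are close to polynomials of degree
less than `T` is small. -/
theorem Matrix.abs_det_add_le {N T : ℕ} (P E : Matrix (Fin N) (Fin N) ℝ) (x : Fin N → ℝ)
    (p : Fin N → Polynomial ℝ) (B : Fin N → ℝ) (δ : ℝ) (hδ : 0 ≤ δ) (hδ1 : δ ≤ 1)
    (hB : ∀ i, 0 ≤ B i)
    (hP : ∀ i j, P i j = (p i).eval (x j)) (hp : ∀ i, (p i).natDegree < T)
    (hPB : ∀ i j, |P i j| ≤ B i) (hE : ∀ i j, |E i j| ≤ B i * δ) :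
    |(P + E).det| ≤ 2 ^ N * (N.factorial * (∏ i, B i) * δ ^ (N - T)) := by
  classical
  let G : Finset (Fin N) → Matrix (Fin N) (Fin N) ℝ :=
    fun s => Matrix.of fun i j => if i ∈ s then P i j else E i j
  have h0 : (P + E).det = ∑ s : Finset (Fin N), (G s).det := by
    have h1 := (Matrix.detRowAlternating (R := ℝ) (n := Fin N)).map_add_univ
      (fun i j => P i j) (fun i j => E i j)
    refine h1.trans (Finset.sum_congr rfl fun s _ => ?_)
    refine congrArg Matrix.det (Matrix.ext fun i j => ?_)
    by_cases hi : i ∈ s <;> simp [G, Finset.piecewise, hi]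
  rw [h0]
  refine (Finset.abs_sum_le_sum_abs _ _).trans ?_
  have hterm : ∀ s ∈ (Finset.univ : Finset (Finset (Fin N))),
      |(G s).det| ≤ N.factorial * (∏ i, B i) * δ ^ (N - T) := by
    intro s _
    by_cases hs : T < s.card
    · rw [Matrix.det_eq_zero_of_polynomial_rows (T := T) _ x p s ?_ (fun i _ => hp i) hs, abs_zero]
      · have : 0 ≤ ∏ i, B i := Finset.prod_nonneg fun i _ => hB i
        positivity
      · intro i hi j
        simp [G, hi, hP]
    · have hb := Matrix.norm_det_le_of_row_bound (G s)
        (fun i => B i * (if i ∈ s then 1 else δ)) (by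
          intro i j
          by_cases hi : i ∈ s
          · simpa [G, hi] using hPB i j
          · simpa [G, hi] using hE i j)
      rw [Real.norm_eq_abs] at hb
      refine hb.trans ?_
      rw [Finset.prod_mul_distrib, Finset.prod_ite, Finset.prod_const_one, one_mul,
        Finset.prod_const, mul_assoc]
      have hP0 : 0 ≤ ∏ i, B i := Finset.prod_nonneg fun i _ => hB i
      have hc : N - T ≤ (Finset.univ.filter fun i => i ∉ s).card := by
        have : (Finset.univ.filter fun i => i ∉ s) = sᶜ := by ext; simp
        rw [this, Finset.card_compl, Fintype.card_fin]
        omega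
      have := pow_le_pow_of_le_one hδ hδ1 hc
      gcongr
  refine (Finset.sum_le_card_nsmul _ _ _ hterm).trans ?_
  rw [nsmul_eq_mul, Finset.card_univ, Fintype.card_finset, Fintype.card_fin]
  push_cast
  exact le_rfl

theorem Real.exp_sub_sum_range_le {u : ℝ} (hu : 0 ≤ u) (m : ℕ) :
    Real.exp u - ∑ t ∈ Finset.range m, u ^ t / t.factorial ≤ u ^ m / m.factorial * Real.exp u := by
  have hs : HasSum (fun t : ℕ => u ^ t / t.factorial) (Real.exp u) := by
    rw [Real.exp_eq_exp_ℝ]; exact NormedSpace.expSeries_div_hasSum_exp u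
  have h1 := hs.summable.sum_add_tsum_nat_add m
  rw [hs.tsum_eq] at h1
  have h2 : ∑' t : ℕ, u ^ (t + m) / (t + m).factorial ≤ ∑' t : ℕ, u ^ m / m.factorial *
      (u ^ t / t.factorial) := by
    refine Summable.tsum_le_tsum (fun t => ?_) ((summable_nat_add_iff m).2 hs.summable)
      (hs.summable.mul_left _)
    rw [pow_add, div_mul_div_comm, mul_comm (u ^ t)]
    refine div_le_div_of_nonneg_left (by positivity) (by positivity) ?_
    have := Nat.le_of_dvd (Nat.factorial_pos _) (Nat.factorial_mul_factorial_dvd_factorial_add m t)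
    rw [add_comm m t] at this
    exact_mod_cast this
  rw [tsum_mul_left, hs.tsum_eq] at h2
  linarith

theorem Real.sum_range_le_exp {u : ℝ} (hu : 0 ≤ u) (m : ℕ) :
    ∑ t ∈ Finset.range m, u ^ t / t.factorial ≤ Real.exp u :=
  Real.sum_le_exp_of_nonneg hu m

/-- Upper bound for the interpolation determinant of two exponentials whose logarithms satisfy
a nearly vanishing integral relation `u * log a₂ ≈ v * log a₁`. -/
theorem abs_interpolation_det_le {T m K L R S u v : ℕ} (hT : K + m = T)
    (hm : 0 < m) (hu : 0 < u) (a₁ a₂ A X Λ Ξ : ℝ) (ha₁ : 1 ≤ a₁) (ha₂ : 1 ≤ a₂) (hA₁ : a₁ ≤ A)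
    (hA₂ : a₂ ≤ A)
    (hΛ : u * Real.log a₂ - v * Real.log a₁ = Λ) (hX1 : 1 ≤ X)
    (hX : (R * u + S * v : ℕ) ≤ X) (hΛs : (L * S : ℕ) * |Λ| ≤ 1)
    (hΞ : (L * (R + S) : ℕ) * Real.log A + 1 ≤ Ξ)
    {N : ℕ} (k l r s : Fin N → ℕ) (hk : ∀ i, k i < K) (hl : ∀ i, l i < L) (hr : ∀ j, r j < R)
    (hs : ∀ j, s j < S) (δ : ℝ) (hδ1 : δ ≤ 1)
    (hδ : 2 * ((L * S : ℕ) * |Λ|) + Ξ ^ m / m.factorial ≤ δ) :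
    |(Matrix.of fun i j => ((r j * u + s j * v : ℕ) : ℝ) ^ k i *
      (a₁ ^ r j * a₂ ^ s j) ^ l i).det| ≤
      2 ^ N * (N.factorial * (X ^ K * Real.exp Ξ) ^ N * δ ^ (N - T)) := by
  have hA1 : 1 ≤ A := ha₁.trans hA₁
  have hlA : 0 ≤ Real.log A := Real.log_nonneg hA1
  have hl₁ : 0 ≤ Real.log a₁ := Real.log_nonneg ha₁
  have hl₂ : 0 ≤ Real.log a₂ := Real.log_nonneg ha₂
  have hl₁A : Real.log a₁ ≤ Real.log A := Real.log_le_log (by linarith) hA₁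
  have hl₂A : Real.log a₂ ≤ Real.log A := Real.log_le_log (by linarith) hA₂
  have huR : (0 : ℝ) < u := by exact_mod_cast hu
  have hu1 : (1 : ℝ) ≤ u := by exact_mod_cast hu
  set κ : ℝ := Real.log a₁ / u with hκ
  have hκ0 : 0 ≤ κ := by positivity
  set x : Fin N → ℝ := fun j => ((r j * u + s j * v : ℕ) : ℝ) with hx
  have hx0 : ∀ j, 0 ≤ x j := fun j => Nat.cast_nonneg _
  have hxX : ∀ j, x j ≤ X := fun j => by
    refine le_trans ?_ hX
    have h1 := Nat.mul_le_mul_right u (hr j).le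
    have h2 := Nat.mul_le_mul_right v (hs j).le
    exact Nat.cast_le.2 (Nat.add_le_add h1 h2)
  have hΞ0 : 0 ≤ Ξ := le_trans (by positivity) hΞ
  have hδ0 : 0 ≤ δ := le_trans (by positivity) hδ
  have hsplit : ∀ j, r j * Real.log a₁ + s j * Real.log a₂ = x j * κ + s j * (Λ / u) := by
    intro j
    rw [← hΛ, hκ, hx]
    push_cast
    field_simp
    ring
  have hpert : ∀ i j, |(l i : ℝ) * (s j * (Λ / u))| ≤ (L * S : ℕ) * |Λ| := by
    intro i j
    rw [abs_mul, abs_mul, abs_div, Nat.abs_cast, Nat.abs_cast, Nat.abs_cast, ← mul_assoc]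
    have h1 : (l i : ℝ) ≤ L := by exact_mod_cast (hl i).le
    have h2 : (s j : ℝ) ≤ S := by exact_mod_cast (hs j).le
    have h3 : |Λ| / u ≤ |Λ| := div_le_self (abs_nonneg _) hu1
    push_cast
    gcongr
  have hw0 : ∀ i j, 0 ≤ (l i : ℝ) * κ * x j := fun i j => by
    have := hx0 j
    positivity
  have hmain : ∀ i j, (l i : ℝ) * (r j * Real.log a₁ + s j * Real.log a₂) ≤
      (L * (R + S) : ℕ) * Real.log A := by
    intro i j
    have h1 : (l i : ℝ) ≤ L := by exact_mod_cast (hl i).le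
    have h2 : (s j : ℝ) ≤ S := by exact_mod_cast (hs j).le
    have h3 : (r j : ℝ) ≤ R := by exact_mod_cast (hr j).le
    push_cast
    rw [mul_assoc]
    have h4 : r j * Real.log a₁ + s j * Real.log a₂ ≤ (R + S) * Real.log A := by
      rw [add_mul]; gcongr
    gcongr
  have hexpand : ∀ i j, (l i : ℝ) * (r j * Real.log a₁ + s j * Real.log a₂) =
      l i * κ * x j + l i * (s j * (Λ / u)) := by
    intro i j; rw [hsplit]; ring
  have hw : ∀ i j, (l i : ℝ) * κ * x j ≤ Ξ := by
    intro i j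
    have h1 := hmain i j
    have h2 := hexpand i j
    have h3 := (neg_le_abs _).trans ((hpert i j).trans hΛs)
    linarith
  have hentry : ∀ i j, (a₁ ^ r j * a₂ ^ s j) ^ l i =
      Real.exp (l i * κ * x j) * Real.exp (l i * (s j * (Λ / u))) := by
    intro i j
    rw [← Real.exp_add, ← hexpand, Real.exp_nat_mul, Real.exp_add, Real.exp_nat_mul,
      Real.exp_nat_mul, Real.exp_log (by linarith), Real.exp_log (by linarith)]
  set p : Fin N → Polynomial ℝ := fun i => Polynomial.X ^ k i *
    ∑ t ∈ Finset.range m, Polynomial.C ((l i * κ) ^ t / t.factorial) * Polynomial.X ^ t with hp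
  have hpeval : ∀ i j, (p i).eval (x j) =
      x j ^ k i * ∑ t ∈ Finset.range m, (l i * κ * x j) ^ t / t.factorial := by
    intro i j
    simp only [hp, Polynomial.eval_mul, Polynomial.eval_pow, Polynomial.eval_X,
      Polynomial.eval_finsetSum, Polynomial.eval_C]
    congr 1
    refine Finset.sum_congr rfl fun t _ => ?_
    rw [mul_pow (_ * _)]; ring
  have hpdeg : ∀ i, (p i).natDegree < T := by
    intro i
    have h1 : (∑ t ∈ Finset.range m, Polynomial.C ((l i * κ) ^ t / t.factorial) *
        Polynomial.X ^ t).natDegree ≤ m - 1 := by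
      refine Polynomial.natDegree_sum_le_of_forall_le _ _ fun t ht => ?_
      refine (Polynomial.natDegree_C_mul_X_pow_le _ _).trans ?_
      have := Finset.mem_range.1 ht
      omega
    have h2 := Polynomial.natDegree_mul_le (p := (Polynomial.X : Polynomial ℝ) ^ k i)
      (q := ∑ t ∈ Finset.range m, Polynomial.C ((l i * κ) ^ t / t.factorial) * Polynomial.X ^ t)
    rw [Polynomial.natDegree_X_pow] at h2
    have := hk i
    refine lt_of_le_of_lt h2 ?_
    omega
  have hxk : ∀ i j, x j ^ k i ≤ X ^ K := fun i j =>
    (pow_le_pow_left₀ (hx0 j) (hxX j) _).trans (pow_le_pow_right₀ hX1 (hk i).le)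
  set P : Matrix (Fin N) (Fin N) ℝ := Matrix.of fun i j => (p i).eval (x j) with hP
  set M : Matrix (Fin N) (Fin N) ℝ := Matrix.of fun i j => x j ^ k i *
      (a₁ ^ r j * a₂ ^ s j) ^ l i with hM
  have hfin := Matrix.abs_det_add_le (T := T) P (M - P) x p (fun _ => X ^ K * Real.exp Ξ) δ hδ0 hδ1
    (fun _ => by positivity) (fun i j => by simp [hP]) hpdeg ?_ ?_
  · rw [add_sub_cancel, Finset.prod_const, Finset.card_univ, Fintype.card_fin] at hfin
    exact hfin
  · intro i j
    simp only [hP, Matrix.of_apply]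
    rw [hpeval, abs_of_nonneg]
    · refine mul_le_mul (b := X ^ K) (hxk i j) ?_ (Finset.sum_nonneg fun t _ => ?_) (by positivity)
      · exact (Real.sum_range_le_exp (hw0 i j) m).trans (Real.exp_le_exp.2 (hw i j))
      · have := hw0 i j; positivity
    · refine mul_nonneg (pow_nonneg (hx0 j) _) (Finset.sum_nonneg fun t _ => ?_)
      have := hw0 i j; positivity
  · intro i j
    simp only [hP, hM, Matrix.sub_apply, Matrix.of_apply]
    rw [hpeval, hentry, ← mul_sub, abs_mul, abs_of_nonneg (pow_nonneg (hx0 j) _),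
      mul_assoc (X ^ K)]
    refine mul_le_mul (hxk i j) ?_ (abs_nonneg _) (by positivity)
    set w := (l i : ℝ) * κ * x j with hwdef
    set e := (l i : ℝ) * (s j * (Λ / u)) with he
    have h1 : Real.exp w * Real.exp e - ∑ t ∈ Finset.range m, w ^ t / t.factorial =
      Real.exp w * (Real.exp e - 1) +
        (Real.exp w - ∑ t ∈ Finset.range m, w ^ t / t.factorial) := by ring
    have h2 : |Real.exp e - 1| ≤ 2 * ((L * S : ℕ) * |Λ|) :=
      (Real.abs_exp_sub_one_le ((hpert i j).trans hΛs)).trans (by linarith [hpert i j])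
    have h3 := Real.exp_sub_sum_range_le (hw0 i j) m
    have h4 : 0 ≤ Real.exp w - ∑ t ∈ Finset.range m, w ^ t / t.factorial :=
      sub_nonneg.2 (Real.sum_range_le_exp (hw0 i j) m)
    have h5 : w ^ m / m.factorial ≤ Ξ ^ m / m.factorial := by
      have := hw0 i j
      have := hw i j
      gcongr
    have h6 : Real.exp w ≤ Real.exp Ξ := Real.exp_le_exp.2 (hw i j)
    rw [h1]
    calc _ ≤ |Real.exp w * (Real.exp e - 1)| + |Real.exp w -
            ∑ t ∈ Finset.range m, w ^ t / t.factorial| := abs_add_le _ _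
      _ ≤ Real.exp w * (2 * ((L * S : ℕ) * |Λ|)) + w ^ m / m.factorial * Real.exp w := by
          rw [abs_mul, Real.abs_exp, abs_of_nonneg h4]; gcongr
      _ ≤ Real.exp w * (2 * ((L * S : ℕ) * |Λ|)) + Ξ ^ m / m.factorial * Real.exp w := by gcongr
      _ = Real.exp w * (2 * ((L * S : ℕ) * |Λ|) + Ξ ^ m / m.factorial) := by ring
      _ ≤ Real.exp Ξ * δ := by gcongr

theorem NumberField.one_le_prod_norm_embeddings {F : Type*} [Field F] [NumberField F] (x : F)
    (hx : IsIntegral ℤ x) (hx0 : x ≠ 0) : 1 ≤ ∏ σ : F →ₐ[ℚ] ℂ, ‖σ x‖ := by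
  have h1 := Algebra.norm_eq_prod_embeddings ℚ ℂ x
  obtain ⟨z, hz⟩ := (IsIntegrallyClosed.isIntegral_iff (R := ℤ) (K := ℚ)).1
    (Algebra.isIntegral_norm (R := ℤ) (L := F) (K := ℚ) hx)
  have hz0 : z ≠ 0 := by
    rintro rfl
    rw [map_zero] at hz
    exact hx0 (Algebra.norm_eq_zero_iff.1 hz.symm)
  rw [← norm_prod, ← h1, ← hz]
  simp only [eq_intCast, map_intCast, Complex.norm_intCast]
  exact_mod_cast Int.one_le_abs hz0

/-- Liouville-type inequality in a field of degree at most four. -/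
theorem NumberField.one_le_mul_pow_of_norm_le {F : Type*} [Field F] [NumberField F]
    (hF : Module.finrank ℚ F ≤ 4) (x : F) (hx : IsIntegral ℤ x) (hx0 : x ≠ 0) (σ₀ : F →ₐ[ℚ] ℂ)
    (ε H : ℝ) (hε : ‖σ₀ x‖ ≤ ε) (hH1 : 1 ≤ H) (hH : ∀ σ : F →ₐ[ℚ] ℂ, ‖σ x‖ ≤ H) :
    1 ≤ ε * H ^ 3 := by
  classical
  refine (NumberField.one_le_prod_norm_embeddings x hx hx0).trans ?_
  rw [← Finset.mul_prod_erase _ _ (Finset.mem_univ σ₀)]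
  have h2 : ∏ σ ∈ Finset.univ.erase σ₀, ‖σ x‖ ≤ H ^ 3 := by
    refine (Finset.prod_le_prod (fun σ _ => norm_nonneg _) fun σ _ => hH σ).trans ?_
    rw [Finset.prod_const]
    refine pow_le_pow_right₀ hH1 ?_
    rw [Finset.card_erase_of_mem (Finset.mem_univ _), Finset.card_univ]
    have := AlgHom.card ℚ F ℂ
    omega
  have h3 : 0 ≤ ε := (norm_nonneg _).trans hε
  have h4 : 0 ≤ ∏ σ ∈ Finset.univ.erase σ₀, ‖σ x‖ := Finset.prod_nonneg fun _ _ => norm_nonneg _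
  exact mul_le_mul hε h2 h4 h3

/-- A lower bound for linear forms in two logarithms in parametric form, by interpolation
determinants. -/
theorem linear_form_two_logs_core {F : Type*} [Field F] [NumberField F]
    (hF : Module.finrank ℚ F ≤ 4) (σ₀ : F →ₐ[ℚ] ℂ) (α₁ α₂ : F) (hα₁ : IsIntegral ℤ α₁)
    (hα₂ : IsIntegral ℤ α₂) (a₁ a₂ A X Λ Ξ δ : ℝ) (h₁ : σ₀ α₁ = a₁) (h₂ : σ₀ α₂ = a₂)
    (ha₁ : 1 < a₁) (ha₂ : 1 ≤ a₂) (hA₁ : ∀ σ : F →ₐ[ℚ] ℂ, ‖σ α₁‖ ≤ A)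
    (hA₂ : ∀ σ : F →ₐ[ℚ] ℂ, ‖σ α₂‖ ≤ A) (u v K L R S T m : ℕ) (huv : Nat.Coprime u v)
    (hu : 0 < u) (hRv : R ≤ v) (hbig : K * L < R * S) (hKL : K * L = 2 * T) (hT : K + m = T)
    (hm : 0 < m)
    (hΛ : u * Real.log a₂ - v * Real.log a₁ = Λ) (hX1 : 1 ≤ X)
    (hX : ((R + L) * u + S * v : ℕ) ≤ X) (hΛs : (L * S : ℕ) * |Λ| ≤ 1)
    (hΞ : (L * (R + L + S) : ℕ) * Real.log A + 1 ≤ Ξ) (hδ1 : δ ≤ 1)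
    (hδ : 2 * ((L * S : ℕ) * |Λ|) + Ξ ^ m / m.factorial ≤ δ) :
    1 ≤ 4 * (2 * T : ℕ) ^ 8 * (X ^ K * Real.exp Ξ) ^ 8 * δ := by
  classical
  have hA1 : 1 ≤ A := by
    have := hA₁ σ₀
    rw [h₁, Complex.norm_real, Real.norm_eq_abs, abs_of_pos (by linarith)] at this
    linarith
  have ha₁A : a₁ ≤ A := by
    have := hA₁ σ₀
    rw [h₁, Complex.norm_real, Real.norm_eq_abs, abs_of_pos (by linarith)] at this
    linarith
  have ha₂A : a₂ ≤ A := by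
    have := hA₂ σ₀
    rw [h₂, Complex.norm_real, Real.norm_eq_abs, abs_of_pos (by linarith)] at this
    linarith
  have hα₁0 : α₁ ≠ 0 := by
    rintro rfl
    rw [map_zero] at h₁
    have : (0 : ℝ) = a₁ := by exact_mod_cast h₁
    linarith
  have hα₂0 : α₂ ≠ 0 := by
    rintro rfl
    rw [map_zero] at h₂
    have : (0 : ℝ) = a₂ := by exact_mod_cast h₂
    linarith
  have hinj : Function.Injective fun i : ℕ => α₁ ^ i := by
    intro i j hij
    have h3 := congrArg σ₀ hij
    simp only [map_pow, h₁] at h3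
    exact pow_right_injective₀ (by linarith) (by linarith : a₁ ≠ 1) (by exact_mod_cast h3)
  let e : Fin (2 * T) ≃ Fin K × Fin L := (finCongr hKL.symm).trans finProdFinEquiv.symm
  let M : Matrix (Fin (2 * T)) (Fin (R + L) × Fin S) F := Matrix.of fun i z =>
    (((z.1 : ℕ) * u + (z.2 : ℕ) * v : ℕ) : F) ^ ((e i).1 : ℕ) *
      (α₁ ^ (z.1 : ℕ) * α₂ ^ (z.2 : ℕ)) ^ ((e i).2 : ℕ)
  obtain ⟨f, hf⟩ := Matrix.exists_submatrix_det_ne_zero M (by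
    intro c hc
    let Q : Fin L → Polynomial F := fun l =>
      ∑ k : Fin K, Polynomial.C (c (e.symm (k, l))) * Polynomial.X ^ (k : ℕ)
    have hQ : Q = 0 := by
      refine zero_estimate (K := K) Q (fun l => ?_) α₁ α₂ hα₁0 hα₂0 hinj u v R S huv hRv ?_ hbig
      · refine Polynomial.natDegree_sum_le_of_forall_le _ _ fun k _ => ?_
        exact (Polynomial.natDegree_C_mul_X_pow_le _ _).trans k.2.le
      · intro r hr s hs
        have h3 := congrFun hc (⟨r, hr⟩, ⟨s, hs⟩)
        simp only [Matrix.vecMul, dotProduct, Pi.zero_apply] at h3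
        rw [← Equiv.sum_comp e.symm, Fintype.sum_prod_type_right] at h3
        rw [← h3]
        refine Finset.sum_congr rfl fun l _ => ?_
        simp only [Q, Polynomial.eval_finsetSum, Polynomial.eval_mul, Polynomial.eval_C,
          Polynomial.eval_pow, Polynomial.eval_X, M, Matrix.of_apply, Equiv.apply_symm_apply,
          Finset.sum_mul]
        exact Finset.sum_congr rfl fun k _ => by ring
    funext i
    have h4 := congrArg (fun P : Polynomial F => P.coeff ((e i).1 : ℕ)) (congrFun hQ (e i).2)
    simp only [Q, Polynomial.finsetSum_coeff, Polynomial.coeff_C_mul_X_pow, Pi.zero_apply,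
      Polynomial.coeff_zero] at h4
    rw [Finset.sum_eq_single (e i).1] at h4
    · simpa using h4
    · intro k _ hk
      rw [if_neg]
      intro h5
      exact hk (Fin.ext h5.symm)
    · simp)
  set Δ := (M.submatrix id f).det with hΔ
  have hint : IsIntegral ℤ Δ := by
    refine IsIntegral.det fun i j => ?_
    simp only [Matrix.submatrix_apply, M, Matrix.of_apply]
    refine IsIntegral.mul (IsIntegral.pow ?_ _) (IsIntegral.pow (IsIntegral.mul
      (hα₁.pow _) (hα₂.pow _)) _)
    exact_mod_cast isIntegral_algebraMap (R := ℤ) (A := F)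
      (x := (((f j).1 : ℕ) * u + ((f j).2 : ℕ) * v : ℕ))
  set C : ℝ := X ^ K * Real.exp Ξ with hC
  have hmap : ∀ σ : F →ₐ[ℚ] ℂ, σ Δ = (Matrix.of fun i j =>
      ((((f j).1 : ℕ) * u + ((f j).2 : ℕ) * v : ℕ) : ℂ) ^ ((e i).1 : ℕ) *
      (σ α₁ ^ ((f j).1 : ℕ) * σ α₂ ^ ((f j).2 : ℕ)) ^ ((e i).2 : ℕ)).det := by
    intro σ
    rw [hΔ]
    have h5 := AlgHom.map_det σ (M.submatrix id f)
    rw [h5]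
    congr 1
    ext i j
    simp [M]
  have hXpos : 0 < X := by linarith
  have hC1 : 1 ≤ C := one_le_mul_of_one_le_of_one_le (one_le_pow₀ hX1)
    (Real.one_le_exp (le_trans (by have := Real.log_nonneg hA1; positivity) hΞ))
  have hH : ∀ σ : F →ₐ[ℚ] ℂ, ‖σ Δ‖ ≤ (2 * T).factorial * C ^ (2 * T) := by
    intro σ
    rw [hmap σ]
    refine (Matrix.norm_det_le_of_row_bound _ (fun _ => C) fun i j => ?_).trans (by simp)
    simp only [Matrix.of_apply, norm_mul, norm_pow, Complex.norm_natCast]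
    have hr := (f j).1.2
    have hs := (f j).2.2
    have hk := (e i).1.2
    have hl := (e i).2.2
    refine mul_le_mul ?_ ?_ (by positivity) (by positivity)
    · refine (pow_le_pow_left₀ (Nat.cast_nonneg _) (le_trans ?_ hX) _).trans
        (pow_le_pow_right₀ hX1 hk.le)
      exact Nat.cast_le.2 (Nat.add_le_add (Nat.mul_le_mul_right u hr.le)
        (Nat.mul_le_mul_right v hs.le))
    · calc _ ≤ (A ^ ((f j).1 : ℕ) * A ^ ((f j).2 : ℕ)) ^ ((e i).2 : ℕ) := by
            have := hA₁ σ
            have := hA₂ σ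
            gcongr
        _ ≤ A ^ (L * (R + L + S)) := by
            rw [← pow_add, ← pow_mul, mul_comm]
            exact pow_le_pow_right₀ hA1 (Nat.mul_le_mul hl.le (Nat.add_le_add hr.le hs.le))
        _ = Real.exp ((L * (R + L + S) : ℕ) * Real.log A) := by
            rw [Real.exp_nat_mul, Real.exp_log (by linarith)]
        _ ≤ Real.exp Ξ := Real.exp_le_exp.2 (by linarith)
  have hδ0 : 0 ≤ δ := le_trans (by
    have : 0 ≤ Ξ := le_trans (by have := Real.log_nonneg hA1; positivity) hΞ
    positivity) hδ
  have hsmall : ‖σ₀ Δ‖ ≤ 2 ^ (2 * T) * ((2 * T).factorial * C ^ (2 * T) * δ ^ (2 * T - T)) := by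
    have h6 := abs_interpolation_det_le hT hm hu a₁ a₂ A X Λ Ξ ha₁.le ha₂ ha₁A ha₂A hΛ hX1 hX hΛs
      hΞ (N := 2 * T) (fun i => (e i).1) (fun i => (e i).2) (fun j => (f j).1) (fun j => (f j).2)
      (fun i => (e i).1.2) (fun i => (e i).2.2) (fun j => (f j).1.2) (fun j => (f j).2.2) δ hδ1 hδ
    refine le_trans (le_of_eq ?_) h6
    rw [hmap σ₀, h₁, h₂, ← Real.norm_eq_abs, ← Complex.norm_real]
    congr 1
    have h7 := RingHom.map_det Complex.ofRealHom (Matrix.of fun (i j : Fin (2 * T)) =>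
      ((((f j).1 : ℕ) * u + ((f j).2 : ℕ) * v : ℕ) : ℝ) ^ ((e i).1 : ℕ) *
      (a₁ ^ ((f j).1 : ℕ) * a₂ ^ ((f j).2 : ℕ)) ^ ((e i).2 : ℕ))
    rw [Complex.ofRealHom_eq_coe] at h7
    rw [h7]
    congr 1
    ext i j
    simp
  have hfac1 : (1 : ℝ) ≤ (2 * T).factorial := by exact_mod_cast Nat.factorial_pos _
  have hfinal := NumberField.one_le_mul_pow_of_norm_le hF Δ hint hf σ₀ _ _ hsmall
    (one_le_mul_of_one_le_of_one_le hfac1 (one_le_pow₀ hC1)) hH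
  have hfac : ((2 * T).factorial : ℝ) ≤ ((2 * T : ℕ) : ℝ) ^ (2 * T) := by
    exact_mod_cast Nat.factorial_le_pow (2 * T)
  have h2T : 2 * T - T = T := by omega
  have hTpos : T ≠ 0 := by omega
  have : 1 ≤ (4 * ((2 * T : ℕ) : ℝ) ^ 8 * C ^ 8 * δ) ^ T := by
    refine hfinal.trans ?_
    rw [h2T]
    calc _ = 2 ^ (2 * T) * (((2 * T).factorial : ℝ) ^ 4 * (C ^ (2 * T)) ^ 4) * δ ^ T := by ring
      _ ≤ 2 ^ (2 * T) * ((((2 * T : ℕ) : ℝ) ^ (2 * T)) ^ 4 * (C ^ (2 * T)) ^ 4) * δ ^ T := by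
          have : 0 < C := by linarith
          gcongr
      _ = _ := by
          have h4 : (2 : ℝ) ^ (2 * T) = 4 ^ T := by rw [pow_mul]; norm_num
          have hy : ∀ y : ℝ, (y ^ (2 * T)) ^ 4 = (y ^ 8) ^ T := by
            intro y
            rw [← pow_mul, ← pow_mul]
            congr 1
            ring
          rw [h4, hy, hy, mul_pow, mul_pow, mul_pow]
          ring
  by_contra hlt
  push Not at hlt
  have h8 : (4 * ((2 * T : ℕ) : ℝ) ^ 8 * C ^ 8 * δ) ^ T < 1 :=
    pow_lt_one₀ (by positivity) hlt hTpos
  linarith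

theorem Real.pow_div_factorial_le_exp_neg {Ξ : ℝ} (hΞ : 0 ≤ Ξ) {m : ℕ} (hm : 0 < m)
    (h : 23 * Ξ ≤ m) : Ξ ^ m / m.factorial ≤ Real.exp (-(2 * m)) := by
  have hmR : (0 : ℝ) < m := by exact_mod_cast hm
  have h1 : (m : ℝ) ^ m / m.factorial ≤ Real.exp m :=
    Real.pow_div_factorial_le_exp (m : ℝ) hmR.le m
  have h2 : Ξ / m ≤ Real.exp (-3) := by
    have h3 : Real.exp 3 < 23 := by
      have := Real.exp_one_lt_d9
      rw [show (3 : ℝ) = ((3 : ℕ) : ℝ) * 1 by norm_num, Real.exp_nat_mul]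
      have h0 := Real.exp_pos 1
      calc Real.exp 1 ^ 3 < 2.7182818286 ^ 3 := by gcongr
        _ < 23 := by norm_num
    rw [Real.exp_neg, div_le_iff₀ hmR]
    have h4 : (23 : ℝ)⁻¹ ≤ (Real.exp 3)⁻¹ := by gcongr
    nlinarith
  calc Ξ ^ m / m.factorial = (Ξ / m) ^ m * (m ^ m / m.factorial) := by
        rw [div_pow]; field_simp
    _ ≤ Real.exp (-3) ^ m * Real.exp m := by gcongr
    _ = Real.exp (-(2 * m)) := by
        rw [← Real.exp_nat_mul, ← Real.exp_add]; congr 1; ring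

/-- An explicit lower bound for linear forms in two logarithms of totally bounded algebraic
integers of degree at most four. -/
theorem linear_form_two_logs {F : Type*} [Field F] [NumberField F]
    (hF : Module.finrank ℚ F ≤ 4) (σ₀ : F →ₐ[ℚ] ℂ) (α₁ α₂ : F) (hα₁ : IsIntegral ℤ α₁)
    (hα₂ : IsIntegral ℤ α₂) (a₁ a₂ : ℝ) (h₁ : σ₀ α₁ = a₁) (h₂ : σ₀ α₂ = a₂)
    (ha₁ : 1 < a₁) (ha₂ : 1 ≤ a₂) (hA₁ : ∀ σ : F →ₐ[ℚ] ℂ, ‖σ α₁‖ ≤ Real.exp 5)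
    (hA₂ : ∀ σ : F →ₐ[ℚ] ℂ, ‖σ α₂‖ ≤ Real.exp 5) (u v : ℕ) (huv : Nat.Coprime u v)
    (hu : 0 < u) (huv' : u ≤ 1000 * v) (hv : 10 ^ 20 ≤ v) :
    Real.exp (-(v / 2000)) < |u * Real.log a₂ - v * Real.log a₁| := by
  by_contra hcon
  push Not at hcon
  set Λ := u * Real.log a₂ - v * Real.log a₁ with hΛ
  obtain ⟨L, hL1, hL2⟩ : ∃ L : ℕ, L ^ 4 ≤ v ∧ v < (L + 1) ^ 4 := by
    refine ⟨Nat.sqrt (Nat.sqrt v), ?_, ?_⟩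
    · have h1 := Nat.sqrt_le' (Nat.sqrt v)
      have h2 := Nat.sqrt_le' v
      calc _ = ((Nat.sqrt (Nat.sqrt v)) ^ 2) ^ 2 := by ring
        _ ≤ (Nat.sqrt v) ^ 2 := Nat.pow_le_pow_left h1 2
        _ ≤ v := h2
    · have h1 := Nat.succ_le_of_lt (Nat.lt_succ_sqrt' (Nat.sqrt v))
      have h2 := Nat.lt_succ_sqrt' v
      calc v < (Nat.sqrt v + 1) ^ 2 := h2
        _ ≤ ((Nat.sqrt (Nat.sqrt v) + 1) ^ 2) ^ 2 := Nat.pow_le_pow_left h1 2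
        _ = _ := by ring
  have hL : 99999 ≤ L := by
    by_contra h
    push Not at h
    have : (L + 1) ^ 4 ≤ 99999 ^ 4 := Nat.pow_le_pow_left (by omega) 4
    omega
  have hLR : (99999 : ℝ) ≤ L := by exact_mod_cast hL
  have hvR : ((L : ℝ)) ^ 4 ≤ v := by exact_mod_cast hL1
  have hvR2 : (v : ℝ) ≤ 2 * (L : ℝ) ^ 4 := by
    have h1 : (v : ℝ) ≤ ((L : ℝ) + 1) ^ 4 := by exact_mod_cast hL2.le
    refine h1.trans ?_
    have h2 : (L : ℝ) + 1 ≤ 1.1 * L := by linarith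
    calc ((L : ℝ) + 1) ^ 4 ≤ (1.1 * L) ^ 4 := by gcongr
      _ ≤ 2 * (L : ℝ) ^ 4 := by rw [mul_pow]; gcongr; norm_num
  have hL2R : (99999 : ℝ) * 99999 ≤ (L : ℝ) ^ 2 := by nlinarith
  have hL2pos : (0 : ℝ) < (L : ℝ) ^ 2 := by linarith
  set X : ℝ := Real.exp (L / 500) with hX
  have hXle : 4 * 10 ^ 6 * (L : ℝ) ^ 5 ≤ X := by
    have h1 := Real.pow_div_factorial_le_exp ((L : ℝ) / 500) (by positivity) 30
    refine le_trans ?_ h1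
    have h2 : ((199 : ℝ)) ^ 25 ≤ ((L : ℝ) / 500) ^ 25 := by
      gcongr
      rw [le_div_iff₀ (by norm_num)]
      linarith
    have h3 : ((L : ℝ) / 500) ^ 30 / (Nat.factorial 30) =
        (L : ℝ) ^ 5 * (((L : ℝ) / 500) ^ 25 / (500 ^ 5 * Nat.factorial 30)) := by
      rw [div_pow, div_pow]
      field_simp
    rw [h3, mul_comm]
    gcongr
    rw [le_div_iff₀ (by positivity)]
    refine le_trans ?_ h2
    norm_num [Nat.factorial]
  have hΛle : |Λ| ≤ Real.exp (-(490000 * (L : ℝ) ^ 2)) * Real.exp (-(L : ℝ) ^ 2) := by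
    refine hcon.trans ?_
    rw [← Real.exp_add]
    apply Real.exp_le_exp.2
    nlinarith
  have hexpL : 2000 * (L : ℝ) ^ 2 * Real.exp (-(L : ℝ) ^ 2) ≤ 1 := by
    rw [Real.exp_neg, ← div_eq_mul_inv, div_le_one (Real.exp_pos _)]
    have := Real.quadratic_le_exp_of_nonneg hL2pos.le
    nlinarith
  have hLS : 2 * ((L * (1000 * L) : ℕ) * |Λ|) ≤ Real.exp (-(480000 * (L : ℝ) ^ 2)) := by
    push_cast
    calc 2 * ((L : ℝ) * (1000 * L) * |Λ|) ≤ 2 * ((L : ℝ) * (1000 * L) *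
          (Real.exp (-(490000 * (L : ℝ) ^ 2)) * Real.exp (-(L : ℝ) ^ 2))) := by gcongr
      _ = Real.exp (-(490000 * (L : ℝ) ^ 2)) *
          (2000 * (L : ℝ) ^ 2 * Real.exp (-(L : ℝ) ^ 2)) := by ring
      _ ≤ Real.exp (-(490000 * (L : ℝ) ^ 2)) * 1 := by gcongr
      _ ≤ _ := by
        rw [mul_one]
        apply Real.exp_le_exp.2
        nlinarith
  have hdelta_small : 2 * Real.exp (-(480000 * (L : ℝ) ^ 2)) ≤ Real.exp (-(470000 * (L : ℝ) ^ 2)) := by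
    have h2 : (2 : ℝ) ≤ Real.exp (10000 * (L : ℝ) ^ 2) := by
      have := Real.add_one_le_exp (10000 * (L : ℝ) ^ 2)
      linarith
    calc 2 * Real.exp (-(480000 * (L : ℝ) ^ 2)) ≤
        Real.exp (10000 * (L : ℝ) ^ 2) * Real.exp (-(480000 * (L : ℝ) ^ 2)) := by gcongr
      _ = _ := by rw [← Real.exp_add]; congr 1; ring
  have hδ1 : Real.exp (-(470000 * (L : ℝ) ^ 2)) ≤ 1 := Real.exp_le_one_iff.2 (by linarith)
  obtain ⟨m, hm⟩ : ∃ m, 500000 * L + m = 250000 * L ^ 2 := by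
    refine ⟨250000 * L ^ 2 - 500000 * L, ?_⟩
    have : 500000 * L ≤ 250000 * L ^ 2 := by nlinarith
    omega
  have hmR : 500000 * (L : ℝ) + m = 250000 * (L : ℝ) ^ 2 := by exact_mod_cast hm
  have hmge : 240000 * (L : ℝ) ^ 2 ≤ m := by nlinarith
  have hm0 : 0 < m := by
    have : (0 : ℝ) < m := by linarith
    exact_mod_cast this
  have key := linear_form_two_logs_core hF σ₀ α₁ α₂ hα₁ hα₂ a₁ a₂ (Real.exp 5) X Λ
    (10010 * (L : ℝ) ^ 2) (Real.exp (-(470000 * (L : ℝ) ^ 2))) h₁ h₂ ha₁ ha₂ hA₁ hA₂ u v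
    (500000 * L) L (1000 * L) (1000 * L) (250000 * L ^ 2) m huv hu
    (by nlinarith [Nat.pow_le_pow_left hL 3]) (by nlinarith) (by ring) hm hm0 rfl
    (Real.one_le_exp (by positivity))
    (by
      refine le_trans ?_ hXle
      push_cast
      have h1 : (u : ℝ) ≤ 1000 * v := by exact_mod_cast huv'
      calc (1000 * (L : ℝ) + L) * u + 1000 * L * v ≤
          (1000 * (L : ℝ) + L) * (1000 * (2 * (L : ℝ) ^ 4)) + 1000 * L * (2 * (L : ℝ) ^ 4) := by
            gcongr
            linarith
        _ ≤ _ := by nlinarith [pow_pos (by linarith : (0 : ℝ) < L) 5])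
    (by
      have h1 : Real.exp (-(480000 * (L : ℝ) ^ 2)) ≤ 1 := Real.exp_le_one_iff.2 (by linarith)
      linarith)
    (by
      rw [Real.log_exp]
      push_cast
      nlinarith)
    hδ1
    (by
      refine le_trans ?_ hdelta_small
      have h1 := Real.pow_div_factorial_le_exp_neg (Ξ := 10010 * (L : ℝ) ^ 2) (by positivity) hm0
        (by linarith)
      have h2 : Real.exp (-(2 * (m : ℝ))) ≤ Real.exp (-(480000 * (L : ℝ) ^ 2)) :=
        Real.exp_le_exp.2 (by linarith)
      linarith)
  have hT8 : ((2 * (250000 * L ^ 2) : ℕ) : ℝ) ^ 8 ≤ Real.exp (8000 * (L : ℝ) ^ 2) := by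
    have h1 : ((2 * (250000 * L ^ 2) : ℕ) : ℝ) ≤ Real.exp (1000 * (L : ℝ) ^ 2) := by
      have := Real.quadratic_le_exp_of_nonneg (x := 1000 * (L : ℝ) ^ 2) (by positivity)
      push_cast
      nlinarith
    calc _ ≤ Real.exp (1000 * (L : ℝ) ^ 2) ^ 8 := by gcongr
      _ = _ := by rw [← Real.exp_nat_mul]; congr 1; push_cast; ring
  have hXK : (X ^ (500000 * L) * Real.exp (10010 * (L : ℝ) ^ 2)) ^ 8 =
      Real.exp (88080 * (L : ℝ) ^ 2) := by
    rw [hX, ← Real.exp_nat_mul, ← Real.exp_add, ← Real.exp_nat_mul]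
    congr 1
    push_cast
    ring
  have h4 : (4 : ℝ) ≤ Real.exp (1000 * (L : ℝ) ^ 2) := by
    have := Real.add_one_le_exp (1000 * (L : ℝ) ^ 2)
    linarith
  have : (1 : ℝ) ≤ Real.exp (1000 * (L : ℝ) ^ 2) * Real.exp (8000 * (L : ℝ) ^ 2) *
      Real.exp (88080 * (L : ℝ) ^ 2) * Real.exp (-(470000 * (L : ℝ) ^ 2)) := by
    refine key.trans ?_
    rw [hXK]
    gcongr
  rw [← Real.exp_add, ← Real.exp_add, ← Real.exp_add, Real.one_le_exp_iff] at this
  linarith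

/-- Simultaneous Dirichlet approximation in dimension two. -/
theorem exists_int_mul_sub_lt_pair (y z : ℝ) (q : ℕ) (hq : 0 < q) :
    ∃ (M : ℕ) (B A : ℤ), 1 ≤ M ∧ M ≤ q ^ 2 ∧ |M * y - B| ≤ 1 / q ∧ |M * z - A| ≤ 1 / q := by
  have hqR : (0 : ℝ) < q := by exact_mod_cast hq
  have hfl : ∀ w : ℝ, ⌊(q : ℝ) * Int.fract w⌋₊ < q := by
    intro w
    rw [Nat.floor_lt (by have := Int.fract_nonneg w; positivity)]
    have := Int.fract_lt_one w
    nlinarith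
  have hclose : ∀ w w' : ℝ, ⌊(q : ℝ) * Int.fract w⌋₊ = ⌊(q : ℝ) * Int.fract w'⌋₊ →
      |w' - w - ((⌊w'⌋ - ⌊w⌋ : ℤ) : ℝ)| ≤ 1 / q := by
    intro w w' h
    have h1 := Nat.floor_le (a := (q : ℝ) * Int.fract w)
      (by have := Int.fract_nonneg w; positivity)
    have h2 := Nat.lt_floor_add_one ((q : ℝ) * Int.fract w)
    have h3 := Nat.floor_le (a := (q : ℝ) * Int.fract w')
      (by have := Int.fract_nonneg w'; positivity)
    have h4 := Nat.lt_floor_add_one ((q : ℝ) * Int.fract w')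
    rw [← h] at h3 h4
    have h5 : w' - w - ((⌊w'⌋ - ⌊w⌋ : ℤ) : ℝ) = Int.fract w' - Int.fract w := by
      push_cast
      simp only [Int.fract]
      ring
    rw [h5, le_div_iff₀ hqR, ← abs_of_pos hqR, ← abs_mul, abs_le]
    constructor <;> nlinarith
  obtain ⟨i, hi, j, hj, hne, hij⟩ := Finset.exists_ne_map_eq_of_card_lt_of_maps_to
    (s := Finset.range (q ^ 2 + 1)) (t := Finset.range q ×ˢ Finset.range q)
    (f := fun i : ℕ => (⌊(q : ℝ) * Int.fract (i * y)⌋₊, ⌊(q : ℝ) * Int.fract (i * z)⌋₊))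
    (by rw [Finset.card_product, Finset.card_range, Finset.card_range]; nlinarith)
    (fun i _ => by simp [hfl])
  wlog hlt : i < j generalizing i j
  · exact this j hj i hi hne.symm hij.symm (by omega)
  rw [Prod.mk.injEq] at hij
  rw [Finset.mem_range] at hi hj
  refine ⟨j - i, ⌊j * y⌋ - ⌊i * y⌋, ⌊j * z⌋ - ⌊i * z⌋, by omega, by omega, ?_, ?_⟩
  · rw [Nat.cast_sub hlt.le, sub_mul]
    exact hclose _ _ hij.1
  · rw [Nat.cast_sub hlt.le, sub_mul]
    exact hclose _ _ hij.2

/-- The quartic forms `r⁴ - n r³ s - 6 r² s² + n r s³ + s⁴`. -/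
def simplestQuartic {R : Type*} [CommRing R] (n r s : R) : R :=
  r ^ 4 - n * r ^ 3 * s - 6 * r ^ 2 * s ^ 2 + n * r * s ^ 3 + s ^ 4

section Field

variable {K : Type*} [Field K]

theorem simplestQuartic_root_ne [CharZero K] {n θ : K} (h : simplestQuartic n θ 1 = 0) :
    θ ≠ 0 ∧ θ - 1 ≠ 0 ∧ θ + 1 ≠ 0 := by
  refine ⟨?_, ?_, ?_⟩
  · rintro rfl
    norm_num [simplestQuartic] at h
  · intro h1
    rw [sub_eq_zero.1 h1] at h
    simp only [simplestQuartic] at h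
    ring_nf at h
    norm_num at h
  · intro h1
    rw [eq_neg_of_add_eq_zero_left h1] at h
    simp only [simplestQuartic] at h
    ring_nf at h
    norm_num at h

theorem simplestQuartic_eq_prod [CharZero K] {n θ : K} (h : simplestQuartic n θ 1 = 0) (r s : K) :
    simplestQuartic n r s = (r - θ * s) * (r - (θ - 1) / (θ + 1) * s) * (r + θ⁻¹ * s) *
      (r + (θ + 1) / (θ - 1) * s) := by
  obtain ⟨h0, h1, h2⟩ := simplestQuartic_root_ne h
  have hn : n = (θ ^ 4 - 6 * θ ^ 2 + 1) / (θ * ((θ - 1) * (θ + 1))) := by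
    rw [eq_div_iff (by simp [h0, h1, h2])]
    simp only [simplestQuartic] at h
    linear_combination -h
  rw [hn, simplestQuartic]
  field_simp
  ring

theorem simplestQuartic_root_iff [CharZero K] {n θ w : K} (h : simplestQuartic n θ 1 = 0) :
    simplestQuartic n w 1 = 0 ↔
      w = θ ∨ w = (θ - 1) / (θ + 1) ∨ w = -θ⁻¹ ∨ w = -((θ + 1) / (θ - 1)) := by
  rw [simplestQuartic_eq_prod h]
  simp only [mul_one, mul_eq_zero, sub_eq_zero, add_eq_zero_iff_eq_neg, or_assoc]

end Field

theorem isIntegral_zpow {K : Type*} [Field K] {x : K} (hx : IsIntegral ℤ x) (hx' : IsIntegral ℤ x⁻¹) (k : ℤ) :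
    IsIntegral ℤ (x ^ k) := by
  obtain ⟨j, rfl | rfl⟩ := k.eq_nat_or_neg
  · rw [zpow_natCast]
    exact hx.pow j
  · rw [zpow_neg, zpow_natCast, ← inv_pow]
    exact hx'.pow j

theorem isIntegral_of_simplestQuartic {K : Type*} [Field K] {n : ℤ} {θ : K} (h : simplestQuartic (n : K) θ 1 = 0) :
    IsIntegral ℤ θ := by
  refine ⟨Polynomial.X ^ 4 - Polynomial.C n * Polynomial.X ^ 3 - Polynomial.C 6 *
    Polynomial.X ^ 2 + Polynomial.C n * Polynomial.X + 1, by monicity!, ?_⟩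
  simp only [simplestQuartic, Polynomial.eval₂_add, Polynomial.eval₂_sub, Polynomial.eval₂_mul,
    Polynomial.eval₂_X_pow, Polynomial.eval₂_X, Polynomial.eval₂_C, Polynomial.eval₂_one]
    at h ⊢
  simp only [eq_intCast, Int.cast_ofNat]
  linear_combination h

section Unit

variable {K : Type*} [Field K] [CharZero K]

/-- The quotient of two of the linear factors of the quartic form, normalized to be a unit. -/
def quarticUnit {L : Type*} [Field L] (r s w : L) : L :=
  (w * (r - s) + (r + s)) / (w * (r + s) - (r - s))

theorem isIntegral_quarticUnit {n r s : ℤ} {θ : K} (h : simplestQuartic (n : K) θ 1 = 0)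
    (hF : simplestQuartic n r s = 1 ∨ simplestQuartic n r s = -1) :
    IsIntegral ℤ (quarticUnit (r : K) s θ) := by
  obtain ⟨h0, h1, h2⟩ := simplestQuartic_root_ne h
  have hroots : ∀ w : K, w = θ ∨ w = (θ - 1) / (θ + 1) ∨ w = -θ⁻¹ ∨ w = -((θ + 1) / (θ - 1)) →
      IsIntegral ℤ w := fun w hw =>
    isIntegral_of_simplestQuartic ((simplestQuartic_root_iff h).2 hw)
  have i0 := hroots θ (Or.inl rfl)
  have i1 := hroots _ (Or.inr (Or.inl rfl))
  have i2 : IsIntegral ℤ θ⁻¹ := by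
    simpa using (hroots _ (Or.inr (Or.inr (Or.inl rfl)))).neg
  have i3 : IsIntegral ℤ ((θ + 1) / (θ - 1)) := by
    simpa using (hroots _ (Or.inr (Or.inr (Or.inr rfl)))).neg
  obtain ⟨ε, hε, hε2⟩ : ∃ ε : ℤ, simplestQuartic n r s = ε ∧ ε * ε = 1 := by
    rcases hF with hF | hF
    · exact ⟨1, hF, rfl⟩
    · exact ⟨-1, hF, rfl⟩
  have hprod : ((ε : ℤ) : K) = (r - θ * s) * (r - (θ - 1) / (θ + 1) * s) * (r + θ⁻¹ * s) *
      (r + (θ + 1) / (θ - 1) * s) := by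
    rw [← simplestQuartic_eq_prod h, ← hε]
    simp [simplestQuartic]
  have hε2' : (ε : K) * ε = 1 := by exact_mod_cast hε2
  set η0 : K := r - θ * s
  set η1 : K := r - (θ - 1) / (θ + 1) * s with hη1
  set η2 : K := r + θ⁻¹ * s
  set η3 : K := r + (θ + 1) / (θ - 1) * s with hη3
  have hη3ne : η3 ≠ 0 := by
    intro hz
    rw [hz, mul_zero] at hprod
    rw [hprod] at hε2'
    simp at hε2'
  have hE : quarticUnit (r : K) s θ = ε * ((θ + 1) / (θ - 1)) * η0 * η1 * η1 * η2 := by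
    have e1 : θ * ((r : K) - s) + (r + s) = (θ + 1) * η1 := by
      rw [hη1]; field_simp; ring
    have e3 : θ * ((r : K) + s) - (r - s) = (θ - 1) * η3 := by
      rw [hη3]; field_simp; ring
    rw [quarticUnit, e1, e3, div_eq_iff (mul_ne_zero h1 hη3ne)]
    have : (θ + 1) / (θ - 1) * (θ - 1) = θ + 1 := div_mul_cancel₀ _ h1
    calc (θ + 1) * η1 = (ε * ε) * ((θ + 1) / (θ - 1) * (θ - 1)) * η1 := by rw [hε2', this, one_mul]
      _ = ε * (η0 * η1 * η2 * η3) * ((θ + 1) / (θ - 1) * (θ - 1)) * η1 := by rw [← hprod]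
      _ = _ := by ring
  have hZ : ∀ k : ℤ, IsIntegral ℤ (k : K) := fun k => by
    simpa using isIntegral_algebraMap (R := ℤ) (A := K) (x := k)
  rw [hE]
  exact (((((hZ ε).mul i3).mul ((hZ r).sub (i0.mul (hZ s)))).mul
    ((hZ r).sub (i1.mul (hZ s)))).mul ((hZ r).sub (i1.mul (hZ s)))).mul
    ((hZ r).add (i2.mul (hZ s)))

theorem isIntegral_unit_combination {n r s : ℤ} {θ : K} (h : simplestQuartic (n : K) θ 1 = 0)
    (hF : simplestQuartic n r s = 1 ∨ simplestQuartic n r s = -1) (M : ℕ) (B A : ℤ) :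
    IsIntegral ℤ (quarticUnit (r : K) s θ ^ M * θ ^ B * ((θ - 1) / (θ + 1)) ^ A) := by
  have hroots : ∀ w : K, w = θ ∨ w = (θ - 1) / (θ + 1) ∨ w = -θ⁻¹ ∨ w = -((θ + 1) / (θ - 1)) →
      IsIntegral ℤ w := fun w hw =>
    isIntegral_of_simplestQuartic ((simplestQuartic_root_iff h).2 hw)
  refine (((isIntegral_quarticUnit h hF).pow M).mul (isIntegral_zpow (hroots _ (Or.inl rfl)) ?_ B)).mul
    (isIntegral_zpow (hroots _ (Or.inr (Or.inl rfl))) ?_ A)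
  · simpa using (hroots _ (Or.inr (Or.inr (Or.inl rfl)))).neg
  · rw [inv_div]
    simpa using (hroots _ (Or.inr (Or.inr (Or.inr rfl)))).neg

end Unit

theorem log_abs_quarticUnit_neg_inv (r s w : ℝ) (hw : w ≠ 0) :
    Real.log (quarticUnit r s (-w⁻¹)) = -Real.log (quarticUnit r s w) := by
  rw [← Real.log_inv, ← Real.log_neg_eq_log]
  simp only [quarticUnit]
  rw [inv_div, ← neg_div, ← mul_div_mul_left _ _ (neg_ne_zero.2 hw)]
  congr 2 <;> field_simp <;> ring

/-- Logarithms of the two unit values attached to a real root, in terms of the tangent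
coordinate `x = (r - θ s) / (θ r + s)`. -/
theorem quarticUnit_eq (r s θ x : ℝ) (hW : θ * r + s ≠ 0) (hx : x = (r - θ * s) / (θ * r + s)) :
    quarticUnit r s θ = (1 + x) / (1 - x) := by
  rw [quarticUnit, hx, one_add_div hW, one_sub_div hW, div_div_div_cancel_right₀ hW]
  congr 1 <;> ring

theorem quarticUnit_eq' (r s θ x : ℝ) (h1 : θ + 1 ≠ 0)
    (hx : x = (r - θ * s) / (θ * r + s)) :
    quarticUnit r s ((θ - 1) / (θ + 1)) = -x⁻¹ := by
  rw [quarticUnit, hx, inv_div, ← mul_div_mul_left _ _ h1, ← neg_div, ← mul_div_mul_left (-(θ * r + s)) _ (two_ne_zero (α := ℝ)),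
    ← neg_div_neg_eq]
  congr 1 <;> field_simp <;> ring

/-- Existence of a relation between the logarithms of the conjugates of a unit of a simplest
quartic field. -/
theorem exists_unit_relation {n r s : ℤ} {θ : ℝ} (h : simplestQuartic (n : ℝ) θ 1 = 0)
    (hF : simplestQuartic n r s = 1 ∨ simplestQuartic n r s = -1) (q : ℕ)
    (hq : 3 * (|Real.log θ| + |Real.log ((θ - 1) / (θ + 1))|) < q)
    (hℓ : Real.log θ ≠ 0) :
    ∃ (M : ℕ) (B A : ℤ), 1 ≤ M ∧ M ≤ q ^ 2 ∧
      M * Real.log (quarticUnit (r : ℝ) s θ) =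
        B * Real.log θ + A * Real.log ((θ - 1) / (θ + 1)) ∧
      |M * Real.log (quarticUnit (r : ℝ) s ((θ - 1) / (θ + 1))) -
        (B * Real.log ((θ - 1) / (θ + 1)) - A * Real.log θ)| < 1 / 3 := by
  obtain ⟨hθ0, hθ1, hθ2⟩ := simplestQuartic_root_ne h
  set τ := (θ - 1) / (θ + 1) with hτ
  set ℓ0 := Real.log θ with hℓ0
  set ℓ1 := Real.log τ with hℓ1
  set e0 := Real.log (quarticUnit (r : ℝ) s θ) with he0
  set e1 := Real.log (quarticUnit (r : ℝ) s τ) with he1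
  have hq0 : 0 < q := by
    have : (0 : ℝ) < q := lt_of_le_of_lt (by positivity) hq
    exact_mod_cast this
  have hqR : (0 : ℝ) < q := by exact_mod_cast hq0
  have hℓpos : 0 < ℓ0 ^ 2 + ℓ1 ^ 2 := by positivity
  obtain ⟨M, B, A, hM1, hMq, hB, hA⟩ := exists_int_mul_sub_lt_pair
    ((e0 * ℓ0 + e1 * ℓ1) / (ℓ0 ^ 2 + ℓ1 ^ 2)) ((e0 * ℓ1 - e1 * ℓ0) / (ℓ0 ^ 2 + ℓ1 ^ 2)) q hq0
  set y := (e0 * ℓ0 + e1 * ℓ1) / (ℓ0 ^ 2 + ℓ1 ^ 2) with hy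
  set z := (e0 * ℓ1 - e1 * ℓ0) / (ℓ0 ^ 2 + ℓ1 ^ 2) with hz
  have he0' : e0 = y * ℓ0 + z * ℓ1 := by rw [hy, hz]; field_simp; ring
  have he1' : e1 = y * ℓ1 - z * ℓ0 := by rw [hy, hz]; field_simp; ring
  have hd0 : |M * e0 - (B * ℓ0 + A * ℓ1)| < 1 / 3 := by
    have : M * e0 - (B * ℓ0 + A * ℓ1) = (M * y - B) * ℓ0 + (M * z - A) * ℓ1 := by
      rw [he0']; ring
    rw [this]
    calc _ ≤ |M * y - B| * |ℓ0| + |M * z - A| * |ℓ1| := by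
          rw [← abs_mul, ← abs_mul]; exact abs_add_le _ _
      _ ≤ 1 / q * |ℓ0| + 1 / q * |ℓ1| := by gcongr
      _ < 1 / 3 := by
          rw [← mul_add, one_div_mul_eq_div, div_lt_iff₀ hqR]
          linarith
  have hd1 : |M * e1 - (B * ℓ1 - A * ℓ0)| < 1 / 3 := by
    have : M * e1 - (B * ℓ1 - A * ℓ0) = (M * y - B) * ℓ1 - (M * z - A) * ℓ0 := by
      rw [he1']; ring
    rw [this]
    calc _ ≤ |M * y - B| * |ℓ1| + |M * z - A| * |ℓ0| := by
          rw [← abs_mul, ← abs_mul]; exact abs_sub _ _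
      _ ≤ 1 / q * |ℓ1| + 1 / q * |ℓ0| := by gcongr
      _ < 1 / 3 := by
          rw [← mul_add, one_div_mul_eq_div, div_lt_iff₀ hqR]
          linarith
  refine ⟨M, B, A, hM1, hMq, ?_, hd1⟩
  -- the function whose value at `θ` is a totally small unit
  let G : ℝ → ℝ := fun w => quarticUnit (r : ℝ) s w ^ M * w ^ (-B) * ((w - 1) / (w + 1)) ^ (-A)
  have hroot : ∀ w : ℝ, simplestQuartic (n : ℝ) w 1 = 0 → w = θ ∨ w = τ ∨ w = -θ⁻¹ ∨ w = -τ⁻¹ := by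
    intro w hw
    have := (simplestQuartic_root_iff h).1 hw
    rwa [hτ, inv_div]
  have hunit0 : ∀ w : ℝ, simplestQuartic (n : ℝ) w 1 = 0 → quarticUnit (r : ℝ) s w ≠ 0 := by
    intro w hw
    obtain ⟨hw0, hw1, hw2⟩ := simplestQuartic_root_ne hw
    have hne : simplestQuartic (n : ℝ) r s ≠ 0 := by
      have : simplestQuartic (n : ℝ) r s = ((simplestQuartic n r s : ℤ) : ℝ) := by
        simp [simplestQuartic]
      rw [this]
      rcases hF with h | h <;> rw [h] <;> norm_num
    rw [simplestQuartic_eq_prod hw] at hne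
    simp only [mul_ne_zero_iff] at hne
    obtain ⟨⟨⟨g0, g1⟩, g2⟩, g3⟩ := hne
    rw [quarticUnit]
    refine div_ne_zero ?_ ?_
    · intro hh
      apply g1
      field_simp
      linear_combination hh
    · intro hh
      apply g3
      field_simp
      linear_combination hh
  have hlogG : ∀ w : ℝ, simplestQuartic (n : ℝ) w 1 = 0 →
      G w ≠ 0 ∧ Real.log (G w) = M * Real.log (quarticUnit (r : ℝ) s w) - (B * Real.log w +
        A * Real.log ((w - 1) / (w + 1))) := by
    intro w hw
    obtain ⟨hw0, hw1, hw2⟩ := simplestQuartic_root_ne hw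
    have n1 := pow_ne_zero M (hunit0 w hw)
    have n2 := zpow_ne_zero (-B) hw0
    have n3 := zpow_ne_zero (-A) (div_ne_zero hw1 hw2)
    refine ⟨mul_ne_zero (mul_ne_zero n1 n2) n3, ?_⟩
    rw [Real.log_mul (mul_ne_zero n1 n2) n3, Real.log_mul n1 n2, Real.log_pow,
      Real.log_zpow, Real.log_zpow]
    push_cast
    ring
  have hττ : (τ - 1) / (τ + 1) = -θ⁻¹ := by
    rw [hτ, div_sub_one hθ2, div_add_one hθ2, div_div_div_cancel_right₀ hθ2,
      show θ - 1 - (θ + 1) = -2 by ring, show θ - 1 + (θ + 1) = 2 * θ by ring]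
    field_simp
  have hτ0 : τ ≠ 0 := div_ne_zero hθ1 hθ2
  have hneg : ∀ w : ℝ, w ≠ 0 → w + 1 ≠ 0 → (-w⁻¹ - 1) / (-w⁻¹ + 1) = -((w - 1) / (w + 1))⁻¹ := by
    intro w h0 h2
    rw [inv_div, ← mul_div_mul_left _ _ h0, ← neg_div]
    congr 1 <;> field_simp <;> ring
  have hsmall : ∀ w : ℝ, simplestQuartic (n : ℝ) w 1 = 0 → |Real.log (G w)| < 1 / 3 := by
    intro w hw
    obtain ⟨hw0, hw1, hw2⟩ := simplestQuartic_root_ne hw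
    have hτr : simplestQuartic (n : ℝ) τ 1 = 0 :=
      (simplestQuartic_root_iff h).2 (Or.inr (Or.inl rfl))
    obtain ⟨-, -, hτ2⟩ := simplestQuartic_root_ne hτr
    rw [(hlogG w hw).2]
    have b0 : |M * e0 - (B * ℓ0 + A * ℓ1)| < 1 / 3 := hd0
    have b1 : |M * e1 - (B * ℓ1 + A * -ℓ0)| < 1 / 3 := by
      convert hd1 using 3; ring
    have l2 : Real.log (-θ⁻¹) = -ℓ0 := by rw [Real.log_neg_eq_log, Real.log_inv]
    have l3 : Real.log (-τ⁻¹) = -ℓ1 := by rw [Real.log_neg_eq_log, Real.log_inv]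
    rcases hroot w hw with rfl | rfl | rfl | rfl
    · exact b0
    · rw [hττ, l2]
      exact b1
    · rw [log_abs_quarticUnit_neg_inv _ _ _ hθ0, hneg _ hθ0 hθ2, ← hτ, l2, l3, ← abs_neg]
      convert b0 using 2
      ring
    · rw [log_abs_quarticUnit_neg_inv _ _ _ hτ0, hneg _ hτ0 hτ2, hττ, l3, ← abs_neg]
      rw [inv_neg, inv_inv, neg_neg]
      convert b1 using 2
      ring
  have hGsq : ∀ w : ℝ, simplestQuartic (n : ℝ) w 1 = 0 → |G w ^ 2 - 1| < 1 := by
    intro w hw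
    have hG0 := (hlogG w hw).1
    have h1 : G w ^ 2 = Real.exp (2 * Real.log (G w)) := by
      rw [two_mul, Real.exp_add, Real.exp_log_eq_abs hG0, ← sq, sq_abs]
    have h2 := abs_lt.1 (hsmall w hw)
    have h3 : Real.exp (2 * Real.log (G w)) < 2 := by
      rw [← Real.lt_log_iff_exp_lt (by norm_num)]
      have := Real.log_two_gt_d9
      linarith
    rw [h1, abs_lt]
    exact ⟨by have := Real.exp_pos (2 * Real.log (G w)); linarith, by linarith⟩
  have hint : IsIntegral ℚ θ := (isIntegral_of_simplestQuartic h).tower_top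
  let K := IntermediateField.adjoin ℚ {θ}
  have : FiniteDimensional ℚ K := IntermediateField.adjoin.finiteDimensional hint
  have : NumberField K := ⟨⟩
  let t : K := IntermediateField.AdjoinSimple.gen ℚ θ
  have ht : (algebraMap K ℝ) t = θ := IntermediateField.AdjoinSimple.algebraMap_gen ℚ θ
  have htroot : simplestQuartic (n : K) t 1 = 0 := by
    apply (algebraMap K ℝ).injective
    rw [map_zero, ← h]
    simp only [simplestQuartic, map_add, map_sub, map_mul, map_pow, ht, map_intCast, map_one,
      map_ofNat]
  let U : K := quarticUnit (r : K) s t ^ M * t ^ (-B) * ((t - 1) / (t + 1)) ^ (-A)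
  have hUint : IsIntegral ℤ (U ^ 2 - 1) :=
    ((isIntegral_unit_combination htroot hF M (-B) (-A)).pow 2).sub isIntegral_one
  have hmapU : ∀ (L : Type) [Field L] (f : K →+* L), f U = quarticUnit (r : L) s (f t) ^ M *
      (f t) ^ (-B) * ((f t - 1) / (f t + 1)) ^ (-A) := by
    intro L _ f
    simp only [U, quarticUnit, map_mul, map_pow, map_zpow₀, map_div₀, map_add, map_sub, map_one,
      map_intCast]
  have hUone : U ^ 2 = 1 := by
    by_contra hne
    have h1 := NumberField.one_le_prod_norm_embeddings (U ^ 2 - 1) hUint (sub_ne_zero.2 hne)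
    have h2 : ∏ σ : K →ₐ[ℚ] ℂ, ‖σ (U ^ 2 - 1)‖ < ∏ σ : K →ₐ[ℚ] ℂ, (1 : ℝ) := by
      refine Finset.prod_lt_prod_of_nonempty (fun σ _ => ?_) (fun σ _ => ?_)
        ⟨(IsAlgClosed.lift : K →ₐ[ℚ] ℂ), Finset.mem_univ _⟩
      · exact norm_pos_iff.2 ((map_ne_zero σ).2 (sub_ne_zero.2 hne))
      · have hθC : simplestQuartic (n : ℂ) (θ : ℂ) 1 = 0 := by
          have := congrArg (fun x : ℝ => (x : ℂ)) h
          simpa [simplestQuartic] using this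
        have hσ : simplestQuartic (n : ℂ) (σ t) 1 = 0 := by
          have := congrArg σ htroot
          rw [map_zero] at this
          rw [← this]
          simp only [simplestQuartic, map_add, map_sub, map_mul, map_pow, map_intCast, map_one,
            map_ofNat]
        obtain ⟨w, hw, hσw⟩ : ∃ w : ℝ, simplestQuartic (n : ℝ) w 1 = 0 ∧ σ t = (w : ℂ) := by
          rcases (simplestQuartic_root_iff hθC).1 hσ with h' | h' | h' | h'
          · exact ⟨θ, h, h'⟩
          · exact ⟨_, (simplestQuartic_root_iff h).2 (Or.inr (Or.inl rfl)), by rw [h']; simp⟩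
          · exact ⟨_, (simplestQuartic_root_iff h).2 (Or.inr (Or.inr (Or.inl rfl))),
              by rw [h']; simp⟩
          · exact ⟨_, (simplestQuartic_root_iff h).2 (Or.inr (Or.inr (Or.inr rfl))),
              by rw [h']; simp⟩
        have h5 : σ U = ((G w : ℝ) : ℂ) := by
          have := hmapU ℂ (σ : K →+* ℂ)
          rw [RingHom.coe_coe, hσw] at this
          rw [this]
          simp [G, quarticUnit]
        rw [map_sub, map_pow, map_one, h5, ← Complex.ofReal_pow, ← Complex.ofReal_one,
          ← Complex.ofReal_sub, Complex.norm_real, Real.norm_eq_abs]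
        exact hGsq w hw
    rw [Finset.prod_const_one] at h2
    linarith
  have hGθ : G θ ^ 2 = 1 := by
    have h1 := congrArg (algebraMap K ℝ) hUone
    rw [map_pow, hmapU ℝ (algebraMap K ℝ), ht, map_one] at h1
    exact h1
  have h2 : Real.log (G θ) = 0 := by
    rcases (sq_eq_sq_iff_eq_or_eq_neg.1 (hGθ.trans (one_pow 2).symm)) with h | h <;> simp [h]
  rw [(hlogG θ h).2] at h2
  linarith

/-- The best approximation property of two consecutive convergents. -/
theorem le_abs_of_unimodular {p q p' q' : ℤ} {a b ε : ℝ} (hdet : (p * q' - p' * q) ^ 2 = 1)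
    (hq : 0 < q) (hq' : 0 < q') (hε : 0 ≤ ε) (h1 : ε ≤ p * a - q * b) (h2 : 0 ≤ q' * b - p' * a) {u v : ℤ}
    (hv : 0 < v) (hvq : v < q') : ε ≤ |u * a - v * b| := by
  obtain ⟨i, j, hu, hv'⟩ : ∃ i j : ℤ, u = i * p + j * p' ∧ v = i * q + j * q' := by
    refine ⟨(p * q' - p' * q) * (u * q' - v * p'), (p * q' - p' * q) * (p * v - q * u), ?_, ?_⟩
    · linear_combination -u * hdet
    · linear_combination -v * hdet
  have hexp : (u : ℝ) * a - v * b = i * (p * a - q * b) - j * (q' * b - p' * a) := by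
    rw [hu, hv']; push_cast; ring
  rw [hexp]
  rcases lt_trichotomy i 0 with hi | hi | hi
  · have hj : 0 ≤ j := by
      by_contra hj
      push Not at hj
      nlinarith
    have hi' : (i : ℝ) ≤ -1 := by exact_mod_cast (by omega : i ≤ -1)
    have hj' : (0 : ℝ) ≤ j := by exact_mod_cast hj
    rw [← abs_neg]
    refine le_trans ?_ (le_abs_self _)
    nlinarith [mul_nonneg hj' h2]
  · rw [hi] at hv'
    have : j < 1 := by nlinarith
    have : 0 < j := by nlinarith
    omega
  · have hj : j ≤ 0 := by
      by_contra hj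
      push Not at hj
      nlinarith
    have hi' : (1 : ℝ) ≤ i := by exact_mod_cast hi
    have hj' : (j : ℝ) ≤ 0 := by exact_mod_cast hj
    refine le_trans ?_ (le_abs_self _)
    nlinarith [mul_nonneg (neg_nonneg.2 hj') h2]

/-- Lower bound for linear forms in the logarithms of the two fundamental units `t` and
`(t + 1) / (t - 1)`. -/
theorem linear_form_simplestQuartic {n : ℤ} {t : ℝ} (ht : simplestQuartic (n : ℝ) t 1 = 0)
    (ht1 : 2 ≤ t) (ht2 : t ≤ 101) {u v : ℕ} (huv : Nat.Coprime u v) (hu : 0 < u)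
    (huv' : u ≤ 1000 * v) (hv : 10 ^ 20 ≤ v) :
    Real.exp (-(v / 2000)) < |u * Real.log ((t + 1) / (t - 1)) - v * Real.log t| := by
  have hint : IsIntegral ℚ t := (isIntegral_of_simplestQuartic ht).tower_top
  let K := IntermediateField.adjoin ℚ {t}
  have : FiniteDimensional ℚ K := IntermediateField.adjoin.finiteDimensional hint
  have : NumberField K := ⟨⟩
  let g : K := IntermediateField.AdjoinSimple.gen ℚ t
  have hg : (algebraMap K ℝ) g = t := IntermediateField.AdjoinSimple.algebraMap_gen ℚ t
  have hgroot : simplestQuartic (n : K) g 1 = 0 := by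
    apply (algebraMap K ℝ).injective
    rw [map_zero, ← ht]
    simp only [simplestQuartic, map_add, map_sub, map_mul, map_pow, hg, map_intCast, map_one,
      map_ofNat]
  have hfin : Module.finrank ℚ K ≤ 4 := by
    rw [IntermediateField.adjoin.finrank hint]
    have hne : (Polynomial.X ^ 4 - Polynomial.C (n : ℚ) * Polynomial.X ^ 3 - Polynomial.C 6 *
        Polynomial.X ^ 2 + Polynomial.C (n : ℚ) * Polynomial.X + 1 : Polynomial ℚ).Monic := by
      monicity!
    refine (Polynomial.natDegree_le_of_dvd (minpoly.dvd ℚ t ?_) hne.ne_zero).trans ?_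
    · simp only [simplestQuartic] at ht
      simp only [map_add, map_sub, map_mul, map_pow, Polynomial.aeval_X, Polynomial.aeval_C, map_one,
        eq_ratCast, Rat.cast_intCast, Rat.cast_ofNat]
      linear_combination ht
    · compute_degree
  have hroots : ∀ σ : K →ₐ[ℚ] ℂ, σ g = t ∨ σ g = (t - 1) / (t + 1) ∨ σ g = -(t : ℂ)⁻¹ ∨
      σ g = -((t + 1) / (t - 1)) := by
    intro σ
    have hθC : simplestQuartic (n : ℂ) (t : ℂ) 1 = 0 := by
      have := congrArg (fun x : ℝ => (x : ℂ)) ht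
      simpa [simplestQuartic] using this
    refine (simplestQuartic_root_iff hθC).1 ?_
    have := congrArg σ hgroot
    rw [map_zero] at this
    rw [← this]
    simp only [simplestQuartic, map_add, map_sub, map_mul, map_pow, map_intCast, map_one,
      map_ofNat]
  have hexp5 : (101 : ℝ) ≤ Real.exp 5 := by
    have := Real.exp_one_gt_d9
    rw [show (5 : ℝ) = ((5 : ℕ) : ℝ) * 1 by norm_num, Real.exp_nat_mul]
    calc (101 : ℝ) ≤ 2.7182818283 ^ 5 := by norm_num
      _ ≤ _ := by gcongr
  have hb : (t + 1) / (t - 1) ≤ 3 := by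
    rw [div_le_iff₀ (by linarith)]; linarith
  have hbnd : ∀ w : ℝ, w = t ∨ w = (t - 1) / (t + 1) ∨ w = -t⁻¹ ∨ w = -((t + 1) / (t - 1)) →
      |w| ≤ 101 := by
    have p1 : 0 < t - 1 := by linarith
    have p2 : 0 < t + 1 := by linarith
    rintro w (rfl | rfl | rfl | rfl)
    · rw [abs_of_pos (by linarith)]; exact ht2
    · rw [abs_of_pos (by positivity), div_le_iff₀ p2]; linarith
    · rw [abs_neg, abs_of_pos (by positivity)]
      exact (inv_le_one_of_one_le₀ (by linarith)).trans (by norm_num)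
    · rw [abs_neg, abs_of_pos (by positivity)]; linarith
  obtain ⟨ht0, htm, htp⟩ := simplestQuartic_root_ne ht
  have hroots' : ∀ σ : K →ₐ[ℚ] ℂ, ∃ w : ℝ, simplestQuartic (n : ℝ) w 1 = 0 ∧ σ g = w := by
    intro σ
    rcases hroots σ with h' | h' | h' | h'
    · exact ⟨t, ht, h'⟩
    · exact ⟨_, (simplestQuartic_root_iff ht).2 (Or.inr (Or.inl rfl)), by rw [h']; simp⟩
    · exact ⟨_, (simplestQuartic_root_iff ht).2 (Or.inr (Or.inr (Or.inl rfl))), by rw [h']; simp⟩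
    · exact ⟨_, (simplestQuartic_root_iff ht).2 (Or.inr (Or.inr (Or.inr rfl))), by rw [h']; simp⟩
  let σ₀ : K →ₐ[ℚ] ℂ := (Complex.ofRealAm.restrictScalars ℚ).comp K.val
  have hσ₀ : σ₀ g = t := by
    change ((algebraMap K ℝ g : ℝ) : ℂ) = t
    rw [hg]
  refine linear_form_two_logs hfin σ₀ g ((g + 1) / (g - 1))
    (isIntegral_of_simplestQuartic hgroot) ?_ t ((t + 1) / (t - 1)) hσ₀ (by simp [hσ₀])
    (by linarith) (by rw [le_div_iff₀ (by linarith)]; linarith) ?_ ?_ u v huv hu huv' hv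
  · have := isIntegral_of_simplestQuartic
      ((simplestQuartic_root_iff hgroot).2 (Or.inr (Or.inr (Or.inr rfl))))
    simpa using this.neg
  · intro σ
    obtain ⟨w, hw, hσ⟩ := hroots' σ
    rw [hσ, Complex.norm_real, Real.norm_eq_abs]
    exact (hbnd w ((simplestQuartic_root_iff ht).1 hw)).trans hexp5
  · intro σ
    obtain ⟨w, hw, hσ⟩ := hroots' σ
    have h1 : σ ((g + 1) / (g - 1)) = (((w + 1) / (w - 1) : ℝ) : ℂ) := by simp [hσ]
    rw [h1, Complex.norm_real, Real.norm_eq_abs, ← abs_neg]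
    refine (hbnd _ ((simplestQuartic_root_iff ht).1 ?_)).trans hexp5
    exact (simplestQuartic_root_iff hw).2 (Or.inr (Or.inr (Or.inr rfl)))

theorem tangent_size {n r s : ℤ} {θ : ℝ} (h : simplestQuartic (n : ℝ) θ 1 = 0)
    (hF : simplestQuartic n r s = 1 ∨ simplestQuartic n r s = -1) :
    θ * r + s ≠ 0 ∧ (r : ℝ) - θ * s ≠ 0 ∧ ∀ x : ℝ, x = (r - θ * s) / (θ * r + s) → |x| ≤ 1 / 2 →
      n * ((r : ℝ) ^ 2 + s ^ 2) ^ 2 * |x| ≤ 2.1 := by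
  obtain ⟨h0, h1, h2⟩ := simplestQuartic_root_ne h
  have hFR : |simplestQuartic (n : ℝ) r s| = 1 := by
    have : simplestQuartic (n : ℝ) r s = ((simplestQuartic n r s : ℤ) : ℝ) := by
      simp [simplestQuartic]
    rw [this]
    rcases hF with h | h <;> rw [h] <;> simp
  have hne : simplestQuartic (n : ℝ) r s ≠ 0 := by
    intro hz
    rw [hz] at hFR
    simp at hFR
  have hprod := simplestQuartic_eq_prod h (r : ℝ) s
  rw [hprod] at hne
  simp only [mul_ne_zero_iff] at hne
  obtain ⟨⟨⟨g0, g1⟩, g2⟩, g3⟩ := hne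
  have hW : θ * r + s ≠ 0 := by
    intro hh
    apply g2
    field_simp
    linear_combination hh
  refine ⟨hW, g0, fun x hx hx2 => ?_⟩
  have hη : (r : ℝ) - θ * s = x * (θ * r + s) := by rw [hx, div_mul_cancel₀ _ hW]
  set W := θ * r + s with hWdef
  have e1 : (r : ℝ) - (θ - 1) / (θ + 1) * s = W * (1 + x) / (θ + 1) := by
    field_simp
    linear_combination hη
  have e2 : (r : ℝ) + θ⁻¹ * s = W / θ := by field_simp; rw [hWdef]; ring
  have e3 : (r : ℝ) + (θ + 1) / (θ - 1) * s = W * (1 - x) / (θ - 1) := by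
    field_simp
    linear_combination -hη
  rw [hη, e1, e2, e3] at hprod
  have hN : W ^ 2 * (1 + x ^ 2) = (1 + θ ^ 2) * ((r : ℝ) ^ 2 + s ^ 2) := by
    rw [mul_add, ← mul_pow, mul_comm W x, ← hη, hWdef]; ring
  set d := θ * (θ - 1) * (θ + 1) with hd
  have hdne : d ≠ 0 := by simp [hd, h0, h1, h2]
  have hdpos : 0 < |d| := abs_pos.2 hdne
  have hF2 : W ^ 4 * (|x| * (1 - x ^ 2)) = |d| := by
    have h5 : W ^ 4 * x * (1 - x ^ 2) = simplestQuartic (n : ℝ) r s * d := by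
      rw [hprod, hd]; field_simp; ring
    have h6 := congrArg (fun z : ℝ => |z|) h5
    simp only [abs_mul, hFR, one_mul] at h6
    have : 0 ≤ 1 - x ^ 2 := by
      have := abs_le.1 hx2
      nlinarith
    rw [abs_of_nonneg this, abs_of_nonneg (by positivity : 0 ≤ W ^ 4)] at h6
    rw [← h6]; ring
  have hnd : (n : ℝ) * |d| ≤ (1 + θ ^ 2) ^ 2 := by
    have h7 : (n : ℝ) * d = θ ^ 4 - 6 * θ ^ 2 + 1 := by
      simp only [simplestQuartic] at h
      rw [hd]; linear_combination -h
    rcases abs_cases d with ⟨h8, -⟩ | ⟨h8, -⟩ <;> rw [h8]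
    · rw [h7]; nlinarith [sq_nonneg θ]
    · rw [mul_neg, h7]; nlinarith [sq_nonneg (θ ^ 2 - 1)]
  have hx3 : x ^ 2 ≤ 1 / 4 := by
    calc x ^ 2 = |x| ^ 2 := (sq_abs x).symm
      _ ≤ (1 / 2) ^ 2 := by gcongr
      _ = _ := by norm_num
  set N := (r : ℝ) ^ 2 + s ^ 2 with hNdef
  have hT : 0 < (1 + θ ^ 2) ^ 2 := by positivity
  have h8 : (1 + θ ^ 2) ^ 2 * (N ^ 2 * |x| * (1 - x ^ 2)) = |d| * (1 + x ^ 2) ^ 2 := by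
    calc _ = ((1 + θ ^ 2) * N) ^ 2 * (|x| * (1 - x ^ 2)) := by ring
      _ = (W ^ 2 * (1 + x ^ 2)) ^ 2 * (|x| * (1 - x ^ 2)) := by rw [hN]
      _ = W ^ 4 * (|x| * (1 - x ^ 2)) * (1 + x ^ 2) ^ 2 := by ring
      _ = _ := by rw [hF2]
  rcases le_or_gt (n : ℝ) 0 with hn | hn
  · have : (n : ℝ) * (N ^ 2 * |x|) ≤ 0 := mul_nonpos_of_nonpos_of_nonneg hn (by positivity)
    rw [mul_assoc]
    linarith
  · have h9 : (1 + θ ^ 2) ^ 2 * (n * (N ^ 2 * |x| * (1 - x ^ 2))) ≤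
        (1 + θ ^ 2) ^ 2 * (1 + x ^ 2) ^ 2 := by
      calc _ = n * |d| * (1 + x ^ 2) ^ 2 := by linear_combination (n : ℝ) * h8
        _ ≤ _ := by gcongr
    have h10 := le_of_mul_le_mul_left h9 hT
    have h11 : (1 + x ^ 2) ^ 2 ≤ (1 + 1 / 4) ^ 2 := by gcongr
    have h12 : 0 ≤ n * (N ^ 2 * |x|) := by positivity
    set Q := n * (N ^ 2 * |x|) with hQ
    have h13 : Q * (3 / 4) ≤ Q * (1 - x ^ 2) := mul_le_mul_of_nonneg_left (by linarith) h12
    have h14 : Q * (1 - x ^ 2) = n * (N ^ 2 * |x| * (1 - x ^ 2)) := by rw [hQ]; ring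
    have h15 : n * N ^ 2 * |x| = Q := by rw [hQ]; ring
    linarith

theorem simplestQuartic_rotate (n r s : ℤ) :
    simplestQuartic n (-s) r = simplestQuartic n r s := by
  simp only [simplestQuartic]; ring

/-- After a rotation of the solution, one of the two roots `t`, `(t - 1) / (t + 1)` is close. -/
theorem exists_close_root {n r s : ℤ} {t : ℝ} (h : simplestQuartic (n : ℝ) t 1 = 0)
    (hF : simplestQuartic n r s = 1 ∨ simplestQuartic n r s = -1) :
    ∃ r' s' : ℤ, (simplestQuartic n r' s' = 1 ∨ simplestQuartic n r' s' = -1) ∧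
      r' ^ 2 + s' ^ 2 = r ^ 2 + s ^ 2 ∧ ∃ θ : ℝ, (θ = t ∨ θ = (t - 1) / (t + 1)) ∧
      |(r' - θ * s') / (θ * r' + s')| ≤ 1 / 2 := by
  obtain ⟨h0, h1, h2⟩ := simplestQuartic_root_ne h
  have hF' : simplestQuartic n (-s) r = 1 ∨ simplestQuartic n (-s) r = -1 := by
    rwa [simplestQuartic_rotate]
  have hτ : simplestQuartic (n : ℝ) ((t - 1) / (t + 1)) 1 = 0 :=
    (simplestQuartic_root_iff h).2 (Or.inr (Or.inl rfl))
  obtain ⟨w0, -, -⟩ := tangent_size h hF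
  obtain ⟨w1, z1, -⟩ := tangent_size h hF'
  obtain ⟨w2, z2, -⟩ := tangent_size hτ hF
  obtain ⟨w3, z3, -⟩ := tangent_size hτ hF'
  push_cast at w1 z1 w3 z3
  have y2 : (t - 1) * r + (t + 1) * s ≠ 0 := by
    intro hz; apply w2; field_simp; linear_combination hz
  have y3 : (t + 1) * r - (t - 1) * s ≠ 0 := by
    intro hz; apply z2; field_simp; linear_combination hz
  have q0 : (t * r + s) ^ 2 > 0 := by positivity
  have sq_half : ∀ a b : ℝ, b ≠ 0 → 4 * a ^ 2 ≤ b ^ 2 → |a / b| ≤ 1 / 2 := by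
    intro a b hb hab
    rw [abs_div, div_le_iff₀ (abs_pos.2 hb)]
    have h3 : |2 * a| ≤ |b| := sq_le_sq.1 (by linarith)
    rw [abs_mul, abs_two] at h3
    linarith
  by_cases c0 : 4 * (r - t * s) ^ 2 ≤ (t * r + s) ^ 2
  · exact ⟨r, s, hF, rfl, t, Or.inl rfl, sq_half _ _ w0 c0⟩
  by_cases c1 : 4 * (t * r + s) ^ 2 ≤ (r - t * s) ^ 2
  · refine ⟨-s, r, hF', by ring, t, Or.inl rfl, sq_half _ _ ?_ ?_⟩
    · push_cast; exact w1
    · push_cast; linarith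
  push Not at c0 c1
  rcases lt_or_ge 0 ((r - t * s) * (t * r + s)) with c2 | c2
  · refine ⟨-s, r, hF', by ring, _, Or.inr rfl, ?_⟩
    have : ((-s : ℤ) - (t - 1) / (t + 1) * r : ℝ) / ((t - 1) / (t + 1) * (-s : ℤ) + r) =
      -((t - 1) * r + (t + 1) * s) / ((t + 1) * r - (t - 1) * s) := by
      push_cast
      rw [← mul_div_mul_left _ _ h2]
      congr 1 <;> field_simp <;> ring
    rw [this]
    refine sq_half _ _ y3 ?_
    nlinarith
  · refine ⟨r, s, hF, rfl, _, Or.inr rfl, ?_⟩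
    have : (r - (t - 1) / (t + 1) * s : ℝ) / ((t - 1) / (t + 1) * r + s) =
      ((t + 1) * r - (t - 1) * s) / ((t - 1) * r + (t + 1) * s) := by
      rw [← mul_div_mul_left _ _ h2]
      congr 1 <;> field_simp
    rw [this]
    refine sq_half _ _ y2 ?_
    nlinarith

theorem abs_log_div_le {x : ℝ} (hx : |x| ≤ 1 / 2) : |Real.log ((1 + x) / (1 - x))| ≤ 4 * |x| := by
  have key : ∀ y : ℝ, 0 ≤ y → y ≤ 1 / 2 → Real.log ((1 + y) / (1 - y)) ≤ 4 * y ∧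
      0 ≤ Real.log ((1 + y) / (1 - y)) := by
    intro y h0 h1
    have h2 : 0 < 1 - y := by linarith
    constructor
    · refine (Real.log_le_sub_one_of_pos (by positivity)).trans ?_
      rw [div_sub_one h2.ne', div_le_iff₀ h2]
      nlinarith
    · apply Real.log_nonneg
      rw [le_div_iff₀ h2]
      linarith
  rcases le_or_gt 0 x with h | h
  · rw [abs_of_nonneg h] at hx ⊢
    rw [abs_of_nonneg (key x h hx).2]
    exact (key x h hx).1
  · rw [abs_of_neg h] at hx ⊢
    have h3 := key (-x) (by linarith) hx
    have h4 : Real.log ((1 + x) / (1 - x)) = -Real.log ((1 + -x) / (1 - -x)) := by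
      rw [← Real.log_inv, inv_div, sub_neg_eq_add, ← sub_eq_add_neg]
    rw [h4, abs_neg, abs_of_nonneg h3.2]
    exact h3.1

theorem exists_coprime_linear_form {a b h y : ℝ} {U V : ℤ} {M : ℕ} (hb : 1 ≤ b) (hab : a ≤ b)
    (ha : 1 / 60 ≤ a) (hba : b ≤ 300 * a) (hM : 1 ≤ M) (hM2 : M ≤ 196) (hh : 1 ≤ h)
    (hy2 : y ≤ 1 / 100000) (h1 : |U * a - V * b| ≤ 784 * y)
    (h3 : M * h - 1 / 3 ≤ |U * b + V * a|) (h4 : |U * b + V * a| ≤ M * h + 1 / 3) :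
    ∃ u v : ℕ, Nat.Coprime u v ∧ 0 < u ∧ 0 < v ∧ u ≤ 1000 * v ∧ |u * a - v * b| ≤ 784 * y ∧
      v ≤ 196 * (h + 2) := by
  have hM' : (1 : ℝ) ≤ M := by exact_mod_cast hM
  have hM2' : (M : ℝ) ≤ 196 := by exact_mod_cast hM2
  have hMh : (M : ℝ) * h ≤ 196 * h := by gcongr
  have hMh' : 1 ≤ (M : ℝ) * h := by nlinarith
  -- the two coefficients have the same sign
  have hsign : 0 < U * V := by
    by_contra hneg
    push Not at hneg
    have hnegR : (U : ℝ) * V ≤ 0 := by exact_mod_cast hneg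
    have h5 : |U * a - V * b| = |(U : ℝ)| * a + |(V : ℝ)| * b := by
      rcases le_or_gt 0 U with hU | hU
      · rcases eq_or_lt_of_le hU with hU' | hU'
        · rw [← hU']
          simp [abs_mul, abs_of_pos (by linarith : (0:ℝ) < b)]
        · have hV : V ≤ 0 := by by_contra hV; push Not at hV; nlinarith
          have hU2 : (0 : ℝ) ≤ U := by exact_mod_cast hU
          have hV2 : (V : ℝ) ≤ 0 := by exact_mod_cast hV
          rw [abs_of_nonneg hU2, abs_of_nonpos hV2, abs_of_nonneg] <;> nlinarith
      · have hV : 0 ≤ V := by by_contra hV; push Not at hV; nlinarith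
        have hU2 : (U : ℝ) ≤ 0 := by exact_mod_cast hU.le
        have hV2 : (0 : ℝ) ≤ V := by exact_mod_cast hV
        rw [abs_of_nonpos hU2, abs_of_nonneg hV2, abs_of_nonpos] <;> nlinarith
    have h6 : |U * b + V * a| ≤ |(U : ℝ)| * b + |(V : ℝ)| * a := by
      refine (abs_add_le _ _).trans_eq ?_
      rw [abs_mul, abs_mul, abs_of_pos (by linarith : (0:ℝ) < b),
        abs_of_pos (by linarith : (0:ℝ) < a)]
    have h7 : |(U : ℝ)| * b + |(V : ℝ)| * a ≤ 300 * (|(U : ℝ)| * a + |(V : ℝ)| * b) := by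
      have := mul_le_mul_of_nonneg_left hba (abs_nonneg (U : ℝ))
      have := mul_le_mul_of_nonneg_left hab (abs_nonneg (V : ℝ))
      have := mul_nonneg (abs_nonneg (V : ℝ)) (by linarith : 0 ≤ b)
      linarith
    have h8 : (U, V) ≠ (0, 0) := by
      intro hz
      simp only [Prod.mk.injEq] at hz
      rw [hz.1, hz.2] at h3
      simp at h3
      linarith
    have h9 : 1 ≤ |(U : ℝ)| ∨ 1 ≤ |(V : ℝ)| := by
      by_cases hU : U = 0
      · right
        have : V ≠ 0 := fun hV => h8 (by rw [hU, hV])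
        exact_mod_cast Int.one_le_abs this
      · left; exact_mod_cast Int.one_le_abs hU
    have h10 : a ≤ |(U : ℝ)| * a + |(V : ℝ)| * b := by
      have u0 := abs_nonneg (U : ℝ)
      have v0 := abs_nonneg (V : ℝ)
      rcases h9 with h9 | h9 <;> nlinarith
    linarith
  have hU0 : U ≠ 0 := by rintro rfl; simp at hsign
  have hV0 : V ≠ 0 := by rintro rfl; simp at hsign
  obtain ⟨u, v, hcop, hu, hv⟩ := Nat.exists_coprime U.natAbs V.natAbs
  set g := Nat.gcd U.natAbs V.natAbs with hgdef
  have hg : 0 < g := Nat.gcd_pos_of_pos_left _ (Int.natAbs_pos.2 hU0)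
  have hgR : (1 : ℝ) ≤ g := by exact_mod_cast hg
  have hu0 : 0 < u := by
    rcases Nat.eq_zero_or_pos u with h | h
    · rw [h, zero_mul] at hu; exact absurd (Int.natAbs_eq_zero.1 hu) hU0
    · exact h
  have hv0 : 0 < v := by
    rcases Nat.eq_zero_or_pos v with h | h
    · rw [h, zero_mul] at hv; exact absurd (Int.natAbs_eq_zero.1 hv) hV0
    · exact h
  have huR : |(U : ℝ)| = u * g := by
    rw [← Int.cast_abs, Int.abs_eq_natAbs, hu]; push_cast; rfl
  have hvR : |(V : ℝ)| = v * g := by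
    rw [← Int.cast_abs, Int.abs_eq_natAbs, hv]; push_cast; rfl
  have hboth : |U * a - V * b| = |(u * a - v * b) * g| ∧ |U * b + V * a| = (u * b + v * a) * g := by
    rcases lt_or_gt_of_ne hU0 with hU | hU
    · have hV : V < 0 := by by_contra hV; push Not at hV; nlinarith
      have hU2 : (U : ℝ) < 0 := by exact_mod_cast hU
      have hV2 : (V : ℝ) < 0 := by exact_mod_cast hV
      rw [abs_of_neg hU2] at huR
      rw [abs_of_neg hV2] at hvR
      constructor
      · rw [← abs_neg]; congr 1; linear_combination a * huR - b * hvR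
      · rw [abs_of_neg]
        · linear_combination b * huR + a * hvR
        · have := mul_pos (neg_pos.2 hU2) (by linarith : 0 < b)
          have := mul_pos (neg_pos.2 hV2) (by linarith : 0 < a)
          linarith
    · have hV : 0 < V := by by_contra hV; push Not at hV; nlinarith
      have hU2 : (0 : ℝ) < U := by exact_mod_cast hU
      have hV2 : (0 : ℝ) < V := by exact_mod_cast hV
      rw [abs_of_pos hU2] at huR
      rw [abs_of_pos hV2] at hvR
      constructor
      · congr 1; linear_combination a * huR - b * hvR
      · rw [abs_of_pos]
        · linear_combination b * huR + a * hvR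
        · have := mul_pos hU2 (by linarith : 0 < b)
          have := mul_pos hV2 (by linarith : 0 < a)
          linarith
  rw [hboth.1, abs_mul, abs_of_pos (by linarith : (0:ℝ) < g)] at h1
  rw [hboth.2] at h4
  have h5 : |u * a - v * b| ≤ 784 * y := by
    have := mul_le_mul_of_nonneg_left hgR (abs_nonneg (u * a - v * b))
    linarith
  have h6 := abs_le.1 h5
  have huR0 : (1 : ℝ) ≤ u := by exact_mod_cast hu0
  have hvR0 : (1 : ℝ) ≤ v := by exact_mod_cast hv0
  refine ⟨u, v, hcop, hu0, hv0, ?_, h5, ?_⟩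
  · have h7 : (u : ℝ) * a ≤ 1000 * v * a := by
      have := mul_le_mul_of_nonneg_left hba (by linarith : (0:ℝ) ≤ v)
      have := mul_le_mul_of_nonneg_right hvR0 (by linarith : (0:ℝ) ≤ a)
      linarith
    have := le_of_mul_le_mul_right h7 (by linarith)
    exact_mod_cast this
  · have h7 : (u : ℝ) * b + v * a ≤ (u * b + v * a) * g :=
      le_mul_of_one_le_right (by nlinarith) hgR
    have h8 : (v : ℝ) * b ≤ u * a + 784 * y := by linarith
    have h9 : (u : ℝ) * a ≤ u * b := by gcongr
    have h10 : (v : ℝ) ≤ v * b := le_mul_of_one_le_right (by linarith) hb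
    have h11 : (0 : ℝ) ≤ v * a := by nlinarith
    linarith

theorem log_root_bounds {t : ℝ} (h1 : 2.8 ≤ t) (h2 : t ≤ 101) :
    1 ≤ Real.log t ∧ Real.log ((t + 1) / (t - 1)) ≤ Real.log t ∧
      1 / 60 ≤ Real.log ((t + 1) / (t - 1)) ∧ Real.log t ≤ 300 * Real.log ((t + 1) / (t - 1)) ∧
      3 * (Real.log t + Real.log ((t + 1) / (t - 1))) < 14 := by
  have ht : 0 < t - 1 := by linarith
  have hβ : 0 < (t + 1) / (t - 1) := div_pos (by linarith) ht
  have e1 := Real.exp_one_lt_d9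
  have e2 := Real.exp_one_gt_d9
  have h3 : 1 ≤ Real.log t := by
    rw [Real.le_log_iff_exp_le (by linarith)]
    linarith
  have h4 : Real.log ((t + 1) / (t - 1)) ≤ Real.log t := by
    apply Real.log_le_log hβ
    rw [div_le_iff₀ ht]
    nlinarith
  have h5 : 1 / 60 ≤ Real.log ((t + 1) / (t - 1)) := by
    refine le_trans ?_ (Real.one_sub_inv_le_log_of_pos hβ)
    rw [inv_div, one_sub_div (by linarith), div_le_div_iff₀ (by norm_num) (by linarith)]
    linarith
  have h6 : 3 * (Real.log t + Real.log ((t + 1) / (t - 1))) < 14 := by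
    rw [← Real.log_mul (by linarith) hβ.ne', show (3 : ℝ) = (3 : ℕ) by norm_num, ← Real.log_pow,
      Real.log_lt_iff_lt_exp (by positivity)]
    have h7 : t * ((t + 1) / (t - 1)) ≤ 104.2 := by
      rw [mul_div_assoc', div_le_iff₀ ht]
      nlinarith
    calc (t * ((t + 1) / (t - 1))) ^ 3 ≤ (104.2 : ℝ) ^ 3 := by gcongr
      _ < (2.7182818283 : ℝ) ^ 14 := by norm_num
      _ < (Real.exp 1) ^ 14 := by gcongr
      _ = Real.exp 14 := by rw [← Real.exp_nat_mul]; norm_num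
  refine ⟨h3, h4, h5, ?_, h6⟩
  linarith

theorem exists_linear_form_of_thue {n r s : ℤ} {t : ℝ} (h : simplestQuartic (n : ℝ) t 1 = 0)
    (ht1 : 2.8 ≤ t) (ht2 : t ≤ 101)
    (hF : simplestQuartic n r s = 1 ∨ simplestQuartic n r s = -1) :
    ∃ y : ℝ, 0 < y ∧ n * ((r : ℝ) ^ 2 + s ^ 2) ^ 2 * y ≤ 2.1 ∧ (1 / 100000 < y ∨
      ∃ u v : ℕ, 0 < v ∧ v < 10 ^ 20 ∧
        |u * Real.log ((t + 1) / (t - 1)) - v * Real.log t| ≤ 784 * y ∧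
        v ≤ 196 * (2 - Real.log y)) := by
  obtain ⟨hb, hab, ha, hba, hq⟩ := log_root_bounds ht1 ht2
  obtain ⟨r', s', hF', hN, θ, hθ, hclose⟩ := exists_close_root h hF
  have hθr : simplestQuartic (n : ℝ) θ 1 = 0 := by
    rcases hθ with rfl | rfl
    · exact h
    · exact (simplestQuartic_root_iff h).2 (Or.inr (Or.inl rfl))
  obtain ⟨hW, hZ, hsize⟩ := tangent_size hθr hF'
  obtain ⟨hθ0, hθ1, hθ2⟩ := simplestQuartic_root_ne hθr
  set x := ((r' : ℝ) - θ * s') / (θ * r' + s') with hx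
  have hx0 : x ≠ 0 := div_ne_zero hZ hW
  have hNR : (r' : ℝ) ^ 2 + s' ^ 2 = r ^ 2 + s ^ 2 := by exact_mod_cast hN
  have hs := hsize x rfl hclose
  rw [hNR] at hs
  refine ⟨|x|, abs_pos.2 hx0, hs, ?_⟩
  by_cases hy : 1 / 100000 < |x|
  · exact Or.inl hy
  right
  push Not at hy
  set a := Real.log ((t + 1) / (t - 1)) with hadef
  set b := Real.log t with hbdef
  have ht0 : t - 1 ≠ 0 := by linarith
  have ht0' : t + 1 ≠ 0 := by linarith
  have ht0'' : t ≠ 0 := by linarith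
  have haneg : Real.log ((t - 1) / (t + 1)) = -a := by
    rw [hadef, ← Real.log_inv, inv_div]
  have hlogs : (Real.log θ = b ∧ Real.log ((θ - 1) / (θ + 1)) = -a) ∨
      (Real.log θ = -a ∧ Real.log ((θ - 1) / (θ + 1)) = -b) := by
    rcases hθ with rfl | rfl
    · left; exact ⟨rfl, haneg⟩
    · right
      refine ⟨haneg, ?_⟩
      have : ((t - 1) / (t + 1) - 1) / ((t - 1) / (t + 1) + 1) = -t⁻¹ := by
        rw [div_sub_one ht0', div_add_one ht0', div_div_div_cancel_right₀ ht0',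
          show t - 1 - (t + 1) = -2 by ring, show t - 1 + (t + 1) = 2 * t by ring]
        field_simp
      rw [this, Real.log_neg_eq_log, Real.log_inv]
  have hq' : 3 * (|Real.log θ| + |Real.log ((θ - 1) / (θ + 1))|) < (14 : ℕ) := by
    rcases hlogs with ⟨h1, h2⟩ | ⟨h1, h2⟩ <;> rw [h1, h2] <;> simp only [abs_neg] <;>
      rw [abs_of_nonneg (by linarith : 0 ≤ a), abs_of_nonneg (by linarith : 0 ≤ b)] <;>
      push_cast <;> linarith
  have hne : Real.log θ ≠ 0 := by
    rcases hlogs with ⟨h1, -⟩ | ⟨h1, -⟩ <;> rw [h1]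
    · linarith
    · intro; linarith
  obtain ⟨M, B, A, hM, hM2, e1, e2⟩ := exists_unit_relation hθr hF' 14 hq' hne
  rw [quarticUnit_eq _ _ _ x hW hx] at e1
  rw [quarticUnit_eq' _ _ _ x hθ2 hx, Real.log_neg_eq_log, Real.log_inv] at e2
  have hMR : (M : ℝ) ≤ 196 := by exact_mod_cast hM2
  have hL : |M * Real.log ((1 + x) / (1 - x))| ≤ 784 * |x| := by
    rw [abs_mul, Nat.abs_cast]
    have := abs_log_div_le hclose
    calc (M : ℝ) * |Real.log ((1 + x) / (1 - x))| ≤ 196 * (4 * |x|) := by gcongr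
      _ = _ := by ring
  have hlogx : Real.log |x| = Real.log x := Real.log_abs x
  have hh : 11 ≤ -Real.log |x| := by
    have h7 : Real.log |x| ≤ Real.log (1 / 100000) :=
      Real.log_le_log (abs_pos.2 hx0) hy
    have h8 : Real.log (1 / 100000) ≤ -11 := by
      rw [Real.log_le_iff_le_exp (by norm_num), Real.exp_neg, one_div]
      apply inv_anti₀ (Real.exp_pos _)
      have e1 := Real.exp_one_lt_d9
      calc Real.exp 11 = (Real.exp 1) ^ 11 := by rw [← Real.exp_nat_mul]; norm_num
        _ ≤ (2.7182818286 : ℝ) ^ 11 := by gcongr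
        _ ≤ _ := by norm_num
    linarith
  have hMpos : (1 : ℝ) ≤ M := by exact_mod_cast hM
  have hMh : 11 ≤ (M : ℝ) * -Real.log |x| := by nlinarith
  have hUV : ∃ U V : ℤ, |U * a - V * b| ≤ 784 * |x| ∧
      M * -Real.log |x| - 1 / 3 ≤ |U * b + V * a| ∧ |U * b + V * a| ≤ M * -Real.log |x| + 1 / 3 := by
    have e3 := abs_lt.1 e2
    rw [← hlogx] at e3
    rcases hlogs with ⟨h1, h2⟩ | ⟨h1, h2⟩ <;> rw [h1, h2] at e1 e3
    · refine ⟨A, B, ?_, ?_⟩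
      · rw [show (A : ℝ) * a - B * b = -(M * Real.log ((1 + x) / (1 - x))) by rw [e1]; ring, abs_neg]
        exact hL
      · rw [abs_of_neg (show (A : ℝ) * b + B * a < 0 by linarith)]
        constructor <;> linarith
    · refine ⟨-B, A, ?_, ?_⟩
      · rw [show ((-B : ℤ) : ℝ) * a - A * b = M * Real.log ((1 + x) / (1 - x)) by
          rw [e1]; push_cast; ring]
        exact hL
      · push_cast
        rw [abs_of_pos (show (0 : ℝ) < -B * b + A * a by linarith)]
        constructor <;> linarith
  obtain ⟨U, V, f1, f2, f3⟩ := hUV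
  obtain ⟨u, v, hcop, hu, hv, huv, g1, g2⟩ :=
    exists_coprime_linear_form hb hab ha hba hM hM2 (by linarith) hy f1 f2 f3
  refine ⟨u, v, hv, ?_, g1, by linarith⟩
  by_contra hbig
  push Not at hbig
  have g3 := linear_form_simplestQuartic h (by linarith) ht2 hcop hu huv hbig
  have hbigR : (10 : ℝ) ^ 20 ≤ v := by exact_mod_cast hbig
  have g4 : Real.exp (-(v / 2000)) < 784 * |x| := g3.trans_le g1
  have g5 : |x| = Real.exp (Real.log |x|) := (Real.exp_log (abs_pos.2 hx0)).symm
  have g6 : (784 : ℝ) ≤ Real.exp 784 := by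
    have := Real.add_one_le_exp (784 : ℝ)
    linarith
  have g7 : Real.exp (-(v / 2000)) < Real.exp (784 + Real.log |x|) := by
    rw [Real.exp_add, ← g5]
    refine g4.trans_le ?_
    gcongr
  have g8 := Real.exp_lt_exp.1 g7
  rw [show (10 : ℝ) ^ 20 = 100000000000000000000 by norm_num] at hbigR
  linarith

/-- Lower approximations to `S * (Z / S) ^ (2 * i + 1)`. -/
def artanhPowLower (Z S : ℕ) : ℕ → ℕ
  | 0 => Z
  | i + 1 => artanhPowLower Z S i * Z ^ 2 / S ^ 2

/-- Upper approximations to `S * (Z / S) ^ (2 * i + 1)`. -/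
def artanhPowUpper (Z S : ℕ) : ℕ → ℕ
  | 0 => Z
  | i + 1 => artanhPowUpper Z S i * Z ^ 2 / S ^ 2 + 1

def artanhLower (Z S : ℕ) : ℕ → ℕ
  | 0 => 0
  | i + 1 => artanhLower Z S i + artanhPowLower Z S i / (2 * i + 1)

def artanhUpper (Z S : ℕ) : ℕ → ℕ
  | 0 => 0
  | i + 1 => artanhUpper Z S i + (artanhPowUpper Z S i / (2 * i + 1) + 1)

theorem artanhPowLower_le {Z S : ℕ} (hS : 0 < S) {z : ℝ} (hz : Z ≤ S * z) (i : ℕ) :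
    (artanhPowLower Z S i : ℝ) ≤ S * z ^ (2 * i + 1) := by
  have hS' : (0 : ℝ) < S := by exact_mod_cast hS
  have hz0 : 0 ≤ z := by
    have : (0 : ℝ) ≤ S * z := le_trans (Nat.cast_nonneg _) hz
    exact nonneg_of_mul_nonneg_right this hS'
  induction i with
  | zero => simpa [artanhPowLower] using hz
  | succ i ih =>
    refine Nat.cast_div_le.trans ?_
    push_cast
    rw [div_le_iff₀ (by positivity)]
    calc (artanhPowLower Z S i : ℝ) * Z ^ 2 ≤ (S * z ^ (2 * i + 1)) * (S * z) ^ 2 := by gcongr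
      _ = _ := by ring

theorem le_artanhPowUpper {Z S : ℕ} (hS : 0 < S) {z : ℝ} (hz0 : 0 ≤ z) (hz : S * z ≤ Z) (i : ℕ) :
    S * z ^ (2 * i + 1) ≤ (artanhPowUpper Z S i : ℝ) := by
  have hS' : (0 : ℝ) < S := by exact_mod_cast hS
  induction i with
  | zero => simpa [artanhPowUpper] using hz
  | succ i ih =>
    have h := (Nat.lt_div_mul_add (a := artanhPowUpper Z S i * Z ^ 2) (b := S ^ 2)
      (by positivity)).le
    have h' : ((artanhPowUpper Z S i : ℝ) * Z ^ 2) ≤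
        (artanhPowUpper Z S (i + 1) : ℝ) * S ^ 2 := by
      have : artanhPowUpper Z S i * Z ^ 2 ≤ artanhPowUpper Z S (i + 1) * S ^ 2 := by
        rw [artanhPowUpper]; linarith
      exact_mod_cast this
    have h2 : (S * z ^ (2 * i + 1)) * (S * z) ^ 2 ≤ (artanhPowUpper Z S i : ℝ) * Z ^ 2 := by gcongr
    have h3 : S * z ^ (2 * (i + 1) + 1) * (S : ℝ) ^ 2 ≤
        (artanhPowUpper Z S (i + 1) : ℝ) * S ^ 2 := by
      refine le_trans (le_of_eq ?_) (h2.trans h')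
      ring
    exact le_of_mul_le_mul_right h3 (by positivity)

theorem artanhLower_le_log {Z S : ℕ} (hS : 0 < S) {z : ℝ} (hz : Z ≤ S * z) (hz1 : z < 1)
    (N : ℕ) : 2 * (artanhLower Z S N : ℝ) ≤ S * Real.log ((1 + z) / (1 - z)) := by
  have hS' : (0 : ℝ) < S := by exact_mod_cast hS
  have hz0 : 0 ≤ z := by
    have : (0 : ℝ) ≤ S * z := le_trans (Nat.cast_nonneg _) hz
    exact nonneg_of_mul_nonneg_right this hS'
  have h1 : (artanhLower Z S N : ℝ) ≤ S * ∑ i ∈ Finset.range N, z ^ (2 * i + 1) / (2 * i + 1) := by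
    induction N with
    | zero => simp [artanhLower]
    | succ N ih =>
      rw [Finset.sum_range_succ, mul_add, artanhLower]
      push_cast
      refine add_le_add ih (Nat.cast_div_le.trans ?_)
      push_cast
      rw [mul_div_assoc']
      gcongr
      exact artanhPowLower_le hS hz N
  have h2 := mul_le_mul_of_nonneg_left (Real.sum_range_le_log_div hz0 hz1 N) hS'.le
  linarith

theorem log_le_artanhUpper {Z S : ℕ} (hS : 0 < S) {z : ℝ} (hz0 : 0 ≤ z) (hz : S * z ≤ Z)
    (hZ : 2 * Z ≤ S) (N : ℕ) :
    S * Real.log ((1 + z) / (1 - z)) ≤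
      2 * ((artanhUpper Z S N : ℝ) + 2 * artanhPowUpper Z S N) := by
  have hS' : (0 : ℝ) < S := by exact_mod_cast hS
  have hz1 : z ≤ 1 / 2 := by
    have : (2 : ℝ) * Z ≤ S := by exact_mod_cast hZ
    have h : S * z ≤ S * (1 / 2) := by linarith
    exact le_of_mul_le_mul_left h hS'
  have h1 : S * ∑ i ∈ Finset.range N, z ^ (2 * i + 1) / (2 * i + 1) ≤ (artanhUpper Z S N : ℝ) := by
    clear hZ
    induction N with
    | zero => simp [artanhUpper]
    | succ N ih =>
      rw [Finset.sum_range_succ, mul_add, artanhUpper]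
      push_cast
      refine add_le_add ih ?_
      rw [mul_div_assoc', div_le_iff₀ (by positivity)]
      have h := (Nat.lt_div_mul_add (a := artanhPowUpper Z S N) (b := 2 * N + 1) (by positivity)).le
      have h' : (artanhPowUpper Z S N : ℝ) ≤
          ((artanhPowUpper Z S N / (2 * N + 1) : ℕ) + 1) * (2 * N + 1) := by
        have : artanhPowUpper Z S N ≤ (artanhPowUpper Z S N / (2 * N + 1) + 1) * (2 * N + 1) := by
          linarith
        exact_mod_cast this
      exact (le_artanhPowUpper hS hz0 hz N).trans h'
  have h2 := mul_le_mul_of_nonneg_left (Real.log_div_le_sum_range_add hz0 (by linarith) N) hS'.le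
  have h3 : z ^ (2 * N + 1) / (1 - z ^ 2) ≤ 2 * z ^ (2 * N + 1) := by
    have : 0 ≤ z ^ (2 * N + 1) := by positivity
    have hz2 : z ^ 2 ≤ 1 / 4 := by nlinarith
    rw [div_le_iff₀ (by linarith)]
    nlinarith [mul_nonneg this (sub_nonneg.2 hz2)]
  have h4 := mul_le_mul_of_nonneg_left h3 hS'.le
  have h5 := le_artanhPowUpper hS hz0 hz N
  linarith

/-- Bounds for `S * log ((t + 1) / (t - 1))`, where `T / S ≤ t ≤ (T + 1) / S`. -/
def logRatioLower (T S N : ℕ) : ℕ := 2 * artanhLower (S ^ 2 / (T + 1)) S N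

def logRatioUpper (T S N : ℕ) : ℕ :=
  2 * (artanhUpper (S ^ 2 / T + 1) S N + 2 * artanhPowUpper (S ^ 2 / T + 1) S N)

/-- Bounds for `S * log t`, where `T / S ≤ t ≤ (T + 1) / S` and `2 ^ k ≤ t`. -/
def logLower (T S k N : ℕ) : ℕ :=
  2 * k * artanhLower (S / 3) S N +
    2 * artanhLower (S * (T - 2 ^ k * S) / (T + 2 ^ k * S)) S N

def logUpper (T S k N : ℕ) : ℕ :=
  2 * k * (artanhUpper (S / 3 + 1) S N + 2 * artanhPowUpper (S / 3 + 1) S N) +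
    2 * (artanhUpper (S * (T + 1 - 2 ^ k * S) / (T + 1 + 2 ^ k * S) + 1) S N +
      2 * artanhPowUpper (S * (T + 1 - 2 ^ k * S) / (T + 1 + 2 ^ k * S) + 1) S N)

theorem le_cast_div_add_one {A B : ℕ} (hB : 0 < B) {x : ℝ} (hx : x * B ≤ A) :
    x ≤ ((A / B + 1 : ℕ) : ℝ) := by
  have h := (Nat.lt_div_mul_add (a := A) hB).le
  have h' : (A : ℝ) ≤ ((A / B + 1 : ℕ) : ℝ) * B := by
    have : A ≤ (A / B + 1) * B := by linarith
    exact_mod_cast this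
  exact le_of_mul_le_mul_right (hx.trans h') (by exact_mod_cast hB)

theorem cast_div_le_of_le_mul {A B : ℕ} (hB : 0 < B) {x : ℝ} (hx : A ≤ x * B) :
    ((A / B : ℕ) : ℝ) ≤ x := by
  refine Nat.cast_div_le.trans ?_
  rwa [div_le_iff₀ (by exact_mod_cast hB)]

theorem logRatio_bounds {T S N : ℕ} {t : ℝ} (hS : 0 < S) (hT : T ≤ S * t) (hT' : S * t ≤ T + 1)
    (h2 : 2 * (S ^ 2 / T + 1) ≤ S) (ht : 2 ≤ t) (hT0 : 0 < T) :
    (logRatioLower T S N : ℝ) ≤ S * Real.log ((t + 1) / (t - 1)) ∧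
      S * Real.log ((t + 1) / (t - 1)) ≤ logRatioUpper T S N := by
  have hS' : (0 : ℝ) < S := by exact_mod_cast hS
  have ht0 : 0 < t := by linarith
  have e : (t + 1) / (t - 1) = (1 + t⁻¹) / (1 - t⁻¹) := by
    rw [← mul_div_mul_left (1 + t⁻¹) _ ht0.ne']
    congr 1 <;> field_simp
  rw [e]
  constructor
  · rw [logRatioLower]
    push_cast
    apply artanhLower_le_log hS _ (inv_lt_one_of_one_lt₀ (by linarith))
    apply cast_div_le_of_le_mul (by positivity)
    push_cast
    rw [mul_assoc, inv_mul_eq_div, mul_div_assoc', le_div_iff₀ ht0]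
    nlinarith
  · rw [logRatioUpper]
    push_cast
    apply log_le_artanhUpper hS (by positivity) _ h2
    apply le_cast_div_add_one hT0
    push_cast
    rw [mul_assoc, inv_mul_eq_div, mul_div_assoc', div_le_iff₀ ht0]
    nlinarith

theorem log_bounds {T S k N : ℕ} {t : ℝ} (hS : 0 < S) (hT : T ≤ S * t) (hT' : S * t ≤ T + 1)
    (h1 : 2 * (S * (T + 1 - 2 ^ k * S) / (T + 1 + 2 ^ k * S) + 1) ≤ S) (h2 : 2 ^ k * S ≤ T)
    (hS6 : 6 ≤ S) :
    (logLower T S k N : ℝ) ≤ S * Real.log t ∧ S * Real.log t ≤ logUpper T S k N := by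
  have hS' : (0 : ℝ) < S := by exact_mod_cast hS
  have h2' : (2 : ℝ) ^ k * S ≤ T := by exact_mod_cast h2
  have h2k : (0 : ℝ) < 2 ^ k := by positivity
  have ht : (2 : ℝ) ^ k ≤ t := by
    have : (S : ℝ) * 2 ^ k ≤ S * t := by linarith
    exact le_of_mul_le_mul_left this hS'
  have ht0 : 0 < t := by linarith
  set z := (t - 2 ^ k) / (t + 2 ^ k) with hz
  have hden : 0 < t + 2 ^ k := by linarith
  have e : Real.log t = k * Real.log ((1 + 1 / 3) / (1 - 1 / 3)) + Real.log ((1 + z) / (1 - z)) := by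
    have : (1 + z) / (1 - z) = t / 2 ^ k := by
      rw [hz, one_add_div hden.ne', one_sub_div hden.ne', div_div_div_cancel_right₀ hden.ne',
        show t + 2 ^ k + (t - 2 ^ k) = 2 * t by ring, show t + 2 ^ k - (t - 2 ^ k) = 2 * 2 ^ k by ring,
        mul_div_mul_left _ _ two_ne_zero]
    rw [this, Real.log_div ht0.ne' h2k.ne', Real.log_pow]
    norm_num
  have hz0 : 0 ≤ z := div_nonneg (by linarith) hden.le
  have hz1 : z < 1 := by rw [hz, div_lt_one hden]; linarith
  rw [e]
  constructor
  · have f1 := artanhLower_le_log hS (Z := S / 3) (z := 1 / 3)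
      (cast_div_le_of_le_mul (by norm_num) (by push_cast; linarith)) (by norm_num) N
    have f2 := artanhLower_le_log hS (Z := S * (T - 2 ^ k * S) / (T + 2 ^ k * S)) (z := z)
      (cast_div_le_of_le_mul (by positivity) (by
        push_cast [h2]
        rw [hz, mul_div_assoc', div_mul_eq_mul_div, le_div_iff₀ hden]
        nlinarith [mul_nonneg h2k.le hS'.le, mul_nonneg (mul_nonneg h2k.le hS'.le) (sub_nonneg.2 hT)])) hz1 N
    have f3 := mul_le_mul_of_nonneg_left f1 (Nat.cast_nonneg k)
    rw [logLower]
    push_cast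
    linarith
  · have f1 := log_le_artanhUpper hS (Z := S / 3 + 1) (z := 1 / 3) (by norm_num)
      (le_cast_div_add_one (by norm_num) (by push_cast; linarith)) (by omega) N
    have f2 := log_le_artanhUpper hS (Z := S * (T + 1 - 2 ^ k * S) / (T + 1 + 2 ^ k * S) + 1) (z := z)
      hz0 (le_cast_div_add_one (by positivity) (by
        push_cast [h2.trans (Nat.le_succ T)]
        rw [hz, mul_div_assoc', div_mul_eq_mul_div, div_le_iff₀ hden]
        nlinarith [mul_nonneg h2k.le hS'.le, mul_nonneg (mul_nonneg h2k.le hS'.le) (sub_nonneg.2 hT')])) h1 N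
    have f3 := mul_le_mul_of_nonneg_left f1 (Nat.cast_nonneg k)
    rw [logUpper]
    push_cast
    linarith

/-- A numerical certificate that `p / q` and `p' / q'` enclose `log t / log ((t + 1) / (t - 1))`
from above and below, the former with linear form at least `E / S`. -/
def IsEnclosure (T S k N p q p' q' E : ℕ) : Prop :=
  ((p : ℤ) * q' - p' * q) ^ 2 = 1 ∧ 0 < q ∧ 0 < q' ∧
    q * logUpper T S k N + E ≤ p * logRatioLower T S N ∧
    p' * logRatioUpper T S N ≤ q' * logLower T S k N

instance (T S k N p q p' q' E : ℕ) : Decidable (IsEnclosure T S k N p q p' q' E) := by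
  unfold IsEnclosure; infer_instance

def IsRootEnclosure (n T S k : ℕ) : Prop :=
  28 * S ≤ 10 * T ∧ T + 1 ≤ 101 * S ∧ 2 ^ k * S ≤ T ∧ 6 ≤ S ∧
    2 * (S * (T + 1 - 2 ^ k * S) / (T + 1 + 2 ^ k * S) + 1) ≤ S ∧ 2 * (S ^ 2 / T + 1) ≤ S ∧
    simplestQuartic (n : ℤ) T S ≤ 0 ∧ 0 ≤ simplestQuartic (n : ℤ) (T + 1) S

instance (n T S k : ℕ) : Decidable (IsRootEnclosure n T S k) := by
  unfold IsRootEnclosure; infer_instance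

theorem IsRootEnclosure.exists_root {n T S k : ℕ} (h : IsRootEnclosure n T S k) :
    ∃ t : ℝ, simplestQuartic (n : ℝ) t 1 = 0 ∧ T ≤ S * t ∧ S * t ≤ T + 1 := by
  obtain ⟨-, -, -, hS, -, -, h1, h2⟩ := h
  have hS' : (0 : ℝ) < S := by exact_mod_cast (by omega : 0 < S)
  have hc : Continuous fun t : ℝ => simplestQuartic (n : ℝ) t S := by
    unfold simplestQuartic; fun_prop
  have h1' : simplestQuartic (n : ℝ) T S ≤ 0 := by
    unfold simplestQuartic at h1 ⊢; exact_mod_cast h1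
  have h2' : 0 ≤ simplestQuartic (n : ℝ) (T + 1) S := by
    unfold simplestQuartic at h2 ⊢; exact_mod_cast h2
  obtain ⟨x, hx, hx0⟩ := intermediate_value_Icc (by linarith : (T : ℝ) ≤ T + 1) hc.continuousOn
    (Set.mem_Icc.2 ⟨h1', h2'⟩)
  refine ⟨x / S, ?_, ?_, ?_⟩
  · have : simplestQuartic (n : ℝ) (x / S) 1 = simplestQuartic (n : ℝ) x S / S ^ 4 := by
      unfold simplestQuartic; field_simp
    have hx0' : simplestQuartic (n : ℝ) x S = 0 := hx0
    rw [this, hx0', zero_div]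
  · rw [mul_div_cancel₀ _ hS'.ne']; exact hx.1
  · rw [mul_div_cancel₀ _ hS'.ne']; exact hx.2

theorem IsEnclosure.le_abs {n T S k N p q p' q' E : ℕ} (h0 : IsRootEnclosure n T S k)
    (h : IsEnclosure T S k N p q p' q' E) {t : ℝ} (hT : T ≤ S * t) (hT' : S * t ≤ T + 1)
    (ht2 : 2 ≤ t) {u v : ℕ} (hv : 0 < v) (hvq : v < q') :
    (E : ℝ) / S ≤ |u * Real.log ((t + 1) / (t - 1)) - v * Real.log t| := by
  obtain ⟨hdet, hq, hq', e1, e2⟩ := h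
  obtain ⟨g1, -, g3, hS, g5, g6, -, -⟩ := h0
  have hS0 : 0 < S := by omega
  have hS' : (0 : ℝ) < S := by exact_mod_cast hS0
  have hT0 : 0 < T := by omega
  obtain ⟨a1, a2⟩ := logRatio_bounds (N := N) hS0 hT hT' g6 ht2 hT0
  obtain ⟨b1, b2⟩ := log_bounds (N := N) hS0 hT hT' g5 g3 hS
  have e1' : (q : ℝ) * logUpper T S k N + E ≤ p * logRatioLower T S N := by exact_mod_cast e1
  have e2' : (p' : ℝ) * logRatioUpper T S N ≤ q' * logLower T S k N := by exact_mod_cast e2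
  have := le_abs_of_unimodular (a := Real.log ((t + 1) / (t - 1))) (b := Real.log t)
    (ε := (E : ℝ) / S) hdet (by exact_mod_cast hq) (by exact_mod_cast hq') (by positivity) ?_ ?_
    (u := u) (v := v) (by exact_mod_cast hv) (by exact_mod_cast hvq)
  · exact_mod_cast this
  · rw [div_le_iff₀ hS']
    have h1 := mul_le_mul_of_nonneg_left a1 (Nat.cast_nonneg (α := ℝ) p)
    have h2 := mul_le_mul_of_nonneg_left b2 (Nat.cast_nonneg (α := ℝ) q)
    push_cast
    linarith
  · have h1 := mul_le_mul_of_nonneg_left a2 (Nat.cast_nonneg (α := ℝ) p')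
    have h2 := mul_le_mul_of_nonneg_left b1 (Nat.cast_nonneg (α := ℝ) q')
    have h3 : 0 ≤ S * ((q' : ℝ) * Real.log t - p' * Real.log ((t + 1) / (t - 1))) := by linarith
    have := nonneg_of_mul_nonneg_right h3 hS'
    push_cast
    linarith

theorem thue_size_bound {n T S k N p q p' q' E P Q P' Q' E' : ℕ} (h0 : IsRootEnclosure n T S k)
    (h1 : IsEnclosure T S k N p q p' q' E) (hq' : 10 ^ 20 ≤ q') {K : ℕ} (hK : 784 * S ≤ E * 2 ^ K)
    (h2 : IsEnclosure T S k N P Q P' Q' E') (hQ' : 196 * (2 + K) < Q') {C : ℕ}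
    (hC : 210000 ≤ C) (hC' : 1647 * S ≤ C * E') {r s : ℤ}
    (hF : simplestQuartic (n : ℤ) r s = 1 ∨ simplestQuartic (n : ℤ) r s = -1) :
    n * (r ^ 2 + s ^ 2) ^ 2 ≤ C := by
  obtain ⟨t, ht, hT, hT'⟩ := h0.exists_root
  have hS : 0 < S := by have := h0.2.2.2.1; omega
  have hS' : (0 : ℝ) < S := by exact_mod_cast hS
  have ht1 : 2.8 ≤ t := by
    have h3 : (28 : ℝ) * S ≤ 10 * T := by exact_mod_cast h0.1
    have h4 : (S : ℝ) * 2.8 ≤ S * t := by linarith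
    exact le_of_mul_le_mul_left h4 hS'
  have ht2 : t ≤ 101 := by
    have h3 : (T : ℝ) + 1 ≤ 101 * S := by exact_mod_cast h0.2.1
    have h4 : (S : ℝ) * t ≤ S * 101 := by linarith
    exact le_of_mul_le_mul_left h4 hS'
  obtain ⟨y, hy, hsize, hcase⟩ := exists_linear_form_of_thue (n := n) (by exact_mod_cast ht) ht1 ht2 hF
  have hCR : (210000 : ℝ) ≤ C := by exact_mod_cast hC
  have key : 2.1 ≤ C * y := by
    rcases hcase with hy1 | ⟨u, v, hv, hv20, hL, hvlog⟩
    · nlinarith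
    · have hb1 := (h1.le_abs h0 hT hT' (by linarith) hv (by omega)).trans hL
      have hy2 : (1 : ℝ) ≤ 2 ^ K * y := by
        have hKR : (784 : ℝ) * S ≤ E * 2 ^ K := by exact_mod_cast hK
        rw [div_le_iff₀ hS'] at hb1
        have h5 := mul_le_mul_of_nonneg_right hb1 (by positivity : (0 : ℝ) ≤ 2 ^ K)
        have h6 : S * (784 : ℝ) * 1 ≤ S * 784 * (2 ^ K * y) := by linarith
        exact le_of_mul_le_mul_left h6 (by positivity)
      have hlog : -Real.log y ≤ K := by
        have h5 := Real.log_le_log one_pos hy2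
        rw [Real.log_one, Real.log_mul (by positivity) hy.ne', Real.log_pow] at h5
        have h6 : Real.log 2 ≤ 1 := by
          have := Real.log_two_lt_d9; linarith
        have h7 := mul_le_mul_of_nonneg_left h6 (Nat.cast_nonneg (α := ℝ) K)
        linarith
      have hvQ : v < Q' := by
        have h5 : (v : ℝ) ≤ 196 * (2 + K) := by linarith
        have h6 : v ≤ 196 * (2 + K) := by exact_mod_cast h5
        omega
      have hb2 := (h2.le_abs h0 hT hT' (by linarith) hv hvQ).trans hL
      rw [div_le_iff₀ hS'] at hb2
      have hCR' : (1647 : ℝ) * S ≤ C * E' := by exact_mod_cast hC'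
      have h5 := mul_le_mul_of_nonneg_left hb2 (Nat.cast_nonneg (α := ℝ) C)
      have h6 : S * 2.1 ≤ S * (C * y) := by nlinarith
      exact le_of_mul_le_mul_left h6 hS'
  have hfin : (n : ℝ) * ((r : ℝ) ^ 2 + s ^ 2) ^ 2 ≤ C := by
    have h7 : (n : ℝ) * ((r : ℝ) ^ 2 + s ^ 2) ^ 2 * y ≤ C * y := by
      have := hsize
      push_cast at this
      linarith
    exact le_of_mul_le_mul_right h7 hy
  exact_mod_cast hfin

theorem simplestQuartic_natAbs (n r s : ℤ) :
    simplestQuartic n r s = simplestQuartic n r.natAbs s.natAbs ∨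
      simplestQuartic n r s = simplestQuartic n s.natAbs r.natAbs := by
  rcases abs_cases r with ⟨h1, -⟩ | ⟨h1, -⟩ <;> rcases abs_cases s with ⟨h2, -⟩ | ⟨h2, -⟩ <;>
    rw [Int.natCast_natAbs, Int.natCast_natAbs, h1, h2] <;> unfold simplestQuartic <;>
    [left; right; right; left] <;> ring

/-- Whether all `k < B` satisfy `f (k + 1)`. -/
def allPositive (f : ℕ → Bool) (B : ℕ) : Bool :=
  Nat.rec true (fun k ih => cond (f (k + 1)) ih false) B

theorem of_allPositive {f : ℕ → Bool} {B : ℕ} (h : allPositive f B = true) {k : ℕ} (hk0 : k ≠ 0)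
    (hk : k ≤ B) : f k = true := by
  induction B with
  | zero => omega
  | succ B ih =>
    have h' : cond (f (B + 1)) (allPositive f B) false = true := h
    cases hf : f (B + 1) <;> rw [hf] at h'
    · simp at h'
    · rcases hk.eq_or_lt with rfl | hlt
      · exact hf
      · exact ih h' (by omega)

/-- Whether `|simplestQuartic n r s| ≤ 1` forces `r ^ 2 + s ^ 2 = d`, in a form that the kernel
evaluates quickly. -/
def quarticCheck (n d r s : ℕ) : Bool :=
  cond (Nat.ble ((r.pow 4).add ((s.pow 4).add ((n.mul r).mul (s.pow 3))))
      (Nat.add (((r.mul r).mul s).mul ((n.mul r).add (s.mul 6))) 1))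
    (cond (Nat.ble (((r.mul r).mul s).mul ((n.mul r).add (s.mul 6)))
        (Nat.add ((r.pow 4).add ((s.pow 4).add ((n.mul r).mul (s.pow 3)))) 1))
      (Nat.beq ((r.mul r).add (s.mul s)) d) true) true

theorem sq_add_sq_eq_of_quarticCheck {n d r s : ℕ} (h : quarticCheck n d r s = true)
    (hF : simplestQuartic (n : ℤ) r s = 1 ∨ simplestQuartic (n : ℤ) r s = -1) :
    r ^ 2 + s ^ 2 = d := by
  have h1 : r ^ 4 + (s ^ 4 + n * r * s ^ 3) ≤ r * r * s * (n * r + s * 6) + 1 := by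
    unfold simplestQuartic at hF
    zify
    rcases hF with h | h <;> linarith
  have h2 : r * r * s * (n * r + s * 6) ≤ r ^ 4 + (s ^ 4 + n * r * s ^ 3) + 1 := by
    unfold simplestQuartic at hF
    zify
    rcases hF with h | h <;> linarith
  replace h : cond (Nat.ble (r ^ 4 + (s ^ 4 + n * r * s ^ 3)) (r * r * s * (n * r + s * 6) + 1))
      (cond (Nat.ble (r * r * s * (n * r + s * 6)) (r ^ 4 + (s ^ 4 + n * r * s ^ 3) + 1))
        (Nat.beq (r * r + s * s) d) true) true = true := h
  rw [Nat.ble_eq_true_of_le h1, Nat.ble_eq_true_of_le h2] at h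
  have h3 : r * r + s * s = d := Nat.eq_of_beq_eq_true h
  rw [← h3]
  ring

theorem thue_finite_check {n d B : ℕ}
    (hcheck : allPositive (fun r => allPositive (quarticCheck n d r) B) B = true)
    {C : ℕ} (hC : C < n * (B + 1) ^ 4) {r s : ℤ} (hN : n * (r ^ 2 + s ^ 2) ^ 2 ≤ C)
    (hF : simplestQuartic (n : ℤ) r s = 1 ∨ simplestQuartic (n : ℤ) r s = -1) :
    r = 0 ∨ s = 0 ∨ r ^ 2 + s ^ 2 = d := by
  have hn : 0 < n := Nat.pos_of_ne_zero (by rintro rfl; simp at hC)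
  have hlt : (r ^ 2 + s ^ 2) ^ 2 < ((B : ℤ) + 1) ^ 4 := by
    have h1 : (n : ℤ) * (r ^ 2 + s ^ 2) ^ 2 < n * ((B : ℤ) + 1) ^ 4 :=
      hN.trans_lt (by exact_mod_cast hC)
    exact lt_of_mul_lt_mul_left h1 (by positivity)
  have hlt2 : r ^ 2 + s ^ 2 < ((B : ℤ) + 1) ^ 2 := by
    refine lt_of_pow_lt_pow_left₀ 2 (by positivity) ?_
    linarith [show (((B : ℤ) + 1) ^ 2) ^ 2 = ((B : ℤ) + 1) ^ 4 by ring]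
  have hbound {x : ℤ} (hx : x ^ 2 < ((B : ℤ) + 1) ^ 2) : x.natAbs ≤ B := by
    rw [← Int.natAbs_sq] at hx
    have := lt_of_pow_lt_pow_left₀ 2 (by positivity) hx
    omega
  have hr := hbound (x := r) (by linarith [sq_nonneg s])
  have hs := hbound (x := s) (by linarith [sq_nonneg r])
  by_cases hr0 : r = 0
  · exact .inl hr0
  by_cases hs0 : s = 0
  · exact .inr (.inl hs0)
  refine .inr (.inr ?_)
  replace hr0 := Int.natAbs_ne_zero.mpr hr0
  replace hs0 := Int.natAbs_ne_zero.mpr hs0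
  rw [← Int.natAbs_sq r, ← Int.natAbs_sq s]
  rcases simplestQuartic_natAbs n r s with h | h <;> rw [h] at hF
  · exact_mod_cast sq_add_sq_eq_of_quarticCheck
      (of_allPositive (of_allPositive hcheck hr0 hr) hs0 hs) hF
  · rw [add_comm]
    exact_mod_cast sq_add_sq_eq_of_quarticCheck
      (of_allPositive (of_allPositive hcheck hs0 hs) hr0 hr) hF

theorem simplestQuartic_one_eq_one {r s : ℤ}
    (hF : simplestQuartic 1 r s = 1 ∨ simplestQuartic 1 r s = -1) :
    r = 0 ∨ s = 0 ∨ r ^ 2 + s ^ 2 = 5 := by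
  have h := thue_size_bound (n := 1) (S := 10 ^ 50)
    (T := 290570354421774108262546415587238536017924982101265) (k := 1) (N := 60)
    (p := 27027075723987041934) (q := 18181976284445644747)
    (p' := 1058581646583177700523) (q' := 712141653425072037323)
    (E := 98529305840536808611418747954)
    (K := 80) (P := 572387) (Q := 385063) (P' := 1156535) (Q' := 778038)
    (E' := 76435321731487606989292794256321034440240704) (C := 2154762959)
    (by decide +kernel) (by decide +kernel) (by norm_num) (by norm_num) (by decide +kernel)
    (by norm_num) (by norm_num) (by norm_num) (r := r) (s := s) (by exact_mod_cast hF)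
  have h2 := thue_finite_check (n := 1) (d := 5) (B := 215)
    (by decide +kernel) (by norm_num) h (by exact_mod_cast hF)
  exact_mod_cast h2

theorem simplestQuartic_sixteen_eq_one {r s : ℤ}
    (hF : simplestQuartic 16 r s = 1 ∨ simplestQuartic 16 r s = -1) :
    r = 0 ∨ s = 0 := by
  have h := thue_size_bound (n := 16) (S := 10 ^ 50)
    (T := 1630753260647229362505234564193388589709094499879299) (k := 4) (N := 60)
    (p := 2214028388746854782543) (q := 97389641106907032315)
    (p' := 6040805402887713951392) (q' := 265720111437633954767)
    (E := 41515206171221397691125473022)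
    (K := 81) (P := 43626) (Q := 1919) (P' := 424393) (Q' := 18668)
    (E' := 620947738895934893988078071315619770825046410) (C := 265239713)
    (by decide +kernel) (by decide +kernel) (by norm_num) (by norm_num) (by decide +kernel)
    (by norm_num) (by norm_num) (by norm_num) (r := r) (s := s) (by exact_mod_cast hF)
  have h2 := thue_finite_check (n := 16) (d := 0) (B := 63)
    (by decide +kernel) (by norm_num) h (by exact_mod_cast hF)
  exact h2.imp_right fun h3 => h3.elim id fun h4 => by
    rw [Nat.cast_zero] at h4
    nlinarith only [sq_nonneg r, sq_nonneg s, h4]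

theorem simplestQuartic_thirtyTwo_eq_one {r s : ℤ}
    (hF : simplestQuartic 32 r s = 1 ∨ simplestQuartic 32 r s = -1) :
    r = 0 ∨ s = 0 := by
  have h := thue_size_bound (n := 32) (S := 10 ^ 50)
    (T := 3215561426497265191810092804886552135128903079284212) (k := 5) (N := 60)
    (p := 33619994610279744230660) (q := 602709375120412024067)
    (p' := 168560046936579222230597) (q' := 3021794671208832013300)
    (E := 2034772335846273788664922576)
    (K := 85) (P := 1001221) (Q := 17949) (P' := 4201402) (Q' := 75319)
    (E' := 77658970565587884316076905823947557654462246) (C := 2120811013)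
    (by decide +kernel) (by decide +kernel) (by norm_num) (by norm_num) (by decide +kernel)
    (by norm_num) (by norm_num) (by norm_num) (r := r) (s := s) (by exact_mod_cast hF)
  have h2 := thue_finite_check (n := 32) (d := 0) (B := 90)
    (by decide +kernel) (by norm_num) h (by exact_mod_cast hF)
  exact h2.imp_right fun h3 => h3.elim id fun h4 => by
    rw [Nat.cast_zero] at h4
    nlinarith only [sq_nonneg r, sq_nonneg s, h4]

theorem simplestQuartic_thirtySix_eq_one {r s : ℤ}
    (hF : simplestQuartic 36 r s = 1 ∨ simplestQuartic 36 r s = -1) :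
    r = 0 ∨ s = 0 := by
  have h := thue_size_bound (n := 36) (S := 10 ^ 50)
    (T := 3613844164102081328216725197257704619060332352270743) (k := 5) (N := 60)
    (p := 62568947196326602300797) (q := 965507580617040585326)
    (p' := 65104235339550551911687) (q' := 1004629861413143486079)
    (E := 4572190530849850301601098398)
    (K := 84) (P := 11091563) (Q := 171155) (P' := 11359982) (Q' := 175297)
    (E' := 24108620600485636509399418853454817719545720) (C := 6831581232)
    (by decide +kernel) (by decide +kernel) (by norm_num) (by norm_num) (by decide +kernel)
    (by norm_num) (by norm_num) (by norm_num) (r := r) (s := s) (by exact_mod_cast hF)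
  have h2 := thue_finite_check (n := 36) (d := 0) (B := 117)
    (by decide +kernel) (by norm_num) h (by exact_mod_cast hF)
  exact h2.imp_right fun h3 => h3.elim id fun h4 => by
    rw [Nat.cast_zero] at h4
    nlinarith only [sq_nonneg r, sq_nonneg s, h4]

theorem simplestQuartic_fortyEight_eq_one {r s : ℤ}
    (hF : simplestQuartic 48 r s = 1 ∨ simplestQuartic 48 r s = -1) :
    r = 0 ∨ s = 0 := by
  have h := thue_size_bound (n := 48) (S := 10 ^ 50)
    (T := 4810397745935952935008393409816886011127416456745546) (k := 5) (N := 60)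
    (p := 9325956578085551278736) (q := 100119013309251498323)
    (p' := 191784747920037384302005) (q' := 2058909407174115641331)
    (E := 2000290225643478202079681950)
    (K := 86) (P := 1699405) (Q := 18244) (P' := 3812856) (Q' := 40933)
    (E' := 92026900161724538783421775298730307947800594) (C := 1789694098)
    (by decide +kernel) (by decide +kernel) (by norm_num) (by norm_num) (by decide +kernel)
    (by norm_num) (by norm_num) (by norm_num) (r := r) (s := s) (by exact_mod_cast hF)
  have h2 := thue_finite_check (n := 48) (d := 0) (B := 78)
    (by decide +kernel) (by norm_num) h (by exact_mod_cast hF)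
  exact h2.imp_right fun h3 => h3.elim id fun h4 => by
    rw [Nat.cast_zero] at h4
    nlinarith only [sq_nonneg r, sq_nonneg s, h4]

theorem simplestQuartic_eightyFour_eq_one {r s : ℤ}
    (hF : simplestQuartic 84 r s = 1 ∨ simplestQuartic 84 r s = -1) :
    r = 0 ∨ s = 0 := by
  have h := thue_size_bound (n := 84) (S := 10 ^ 50)
    (T := 8405948842022997860624618314676630148742515898006420) (k := 6) (N := 60)
    (p := 94354934549704033152373) (q := 506611659851051040359)
    (p' := 108437394837695324287781) (q' := 582223376560234607060)
    (E := 2359411123142788521923268488)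
    (K := 85) (P := 15497432) (Q := 83209) (P' := 33263167) (Q' := 178597)
    (E' := 11604172773421628100931484253154876238555380) (C := 14193170269)
    (by decide +kernel) (by decide +kernel) (by norm_num) (by norm_num) (by decide +kernel)
    (by norm_num) (by norm_num) (by norm_num) (r := r) (s := s) (by exact_mod_cast hF)
  have h2 := thue_finite_check (n := 84) (d := 0) (B := 114)
    (by decide +kernel) (by norm_num) h (by exact_mod_cast hF)
  exact h2.imp_right fun h3 => h3.elim id fun h4 => by
    rw [Nat.cast_zero] at h4
    nlinarith only [sq_nonneg r, sq_nonneg s, h4]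

theorem simplestQuartic_hundred_eq_one {r s : ℤ}
    (hF : simplestQuartic 100 r s = 1 ∨ simplestQuartic 100 r s = -1) :
    r = 0 ∨ s = 0 := by
  have h := thue_size_bound (n := 100) (S := 10 ^ 50)
    (T := 10004997901738213048092947408445430329413325698213884) (k := 6) (N := 60)
    (p := 6402945955265795067222) (q := 27791660086896465095)
    (p' := 177836128170656238360037) (q' := 771888636858479756678)
    (E := 2533767218648664586888550216)
    (K := 85) (P := 948289) (Q := 4116) (P' := 23245752) (Q' := 100897)
    (E' := 19345666424499985777276503597404469510031912) (C := 8513534576)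
    (by decide +kernel) (by decide +kernel) (by norm_num) (by norm_num) (by decide +kernel)
    (by norm_num) (by norm_num) (by norm_num) (r := r) (s := s) (by exact_mod_cast hF)
  have h2 := thue_finite_check (n := 100) (d := 0) (B := 96)
    (by decide +kernel) (by norm_num) h (by exact_mod_cast hF)
  exact h2.imp_right fun h3 => h3.elim id fun h4 => by
    rw [Nat.cast_zero] at h4
    nlinarith only [sq_nonneg r, sq_nonneg s, h4]

/-- If the negative Pell equation is solvable, every solution of the Pell equation is, up to
sign, the square of an element of norm `1` or `-1`. -/
theorem Pell.exists_sq_of_neg_solvable {d : ℤ} (hd : 1 < d) (hsq : ¬ IsSquare d)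
    {x₀ y₀ : ℤ} (h₀ : x₀ ^ 2 - d * y₀ ^ 2 = -1) {x y : ℤ} (h : x ^ 2 - d * y ^ 2 = 1) :
    ∃ t u e : ℤ, (e = 1 ∨ e = -1) ∧ (t ^ 2 - d * u ^ 2 = 1 ∨ t ^ 2 - d * u ^ 2 = -1) ∧
      x = e * (t ^ 2 + d * u ^ 2) ∧ y = e * (2 * t * u) := by
  obtain ⟨ε, hε⟩ := Pell.IsFundamental.exists_of_not_isSquare (by linarith) hsq
  have hmul : ∀ v w : Pell.Solution₁ d, ((v * w : Pell.Solution₁ d) : ℤ√d) = v * w :=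
    fun v w => rfl
  set τ : ℤ√d := ⟨x₀, y₀⟩ with hτ
  have key : ∃ σ : ℤ√d, σ.re ^ 2 - d * σ.im ^ 2 = -1 ∧ σ * σ = (ε : ℤ√d) := by
    let S : Pell.Solution₁ d := Pell.Solution₁.mk (x₀ ^ 2 + d * y₀ ^ 2) (2 * x₀ * y₀)
      (by linear_combination (x₀ ^ 2 - d * y₀ ^ 2 - 1) * h₀)
    have hS : (S : ℤ√d) = τ * τ := by
      ext
      · change S.x = _
        simp [S, hτ]
        ring
      · change S.y = _
        simp [S, hτ]
        ring
    have hSx : 0 < S.x := by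
      have : S.x = 2 * x₀ ^ 2 + 1 := by
        simp only [S, Pell.Solution₁.x_mk]
        linear_combination -h₀
      nlinarith [sq_nonneg x₀]
    have norm : ∀ v : Pell.Solution₁ d, (τ * (v : ℤ√d)).re ^ 2 - d * (τ * (v : ℤ√d)).im ^ 2 = -1 := by
      intro v
      have hv := v.prop
      change (x₀ * v.x + d * y₀ * v.y) ^ 2 - d * (x₀ * v.y + y₀ * v.x) ^ 2 = -1
      linear_combination (v.x ^ 2 - d * v.y ^ 2) * h₀ - hv
    obtain ⟨n, hn⟩ := hε.eq_zpow_or_neg_zpow S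
    have hn : S = ε ^ n := by
      rcases hn with hn | hn
      · exact hn
      · exfalso
        have := Pell.Solution₁.x_zpow_pos hε.x_pos n
        rw [hn, Pell.Solution₁.x_neg] at hSx
        linarith
    rcases Int.even_or_odd' n with ⟨k, hk | hk⟩
    · exfalso
      have h1 : S * (ε ^ (-k) * ε ^ (-k)) = 1 := by
        rw [hn, ← zpow_add, ← zpow_add]
        simp [hk]
        ring_nf
        simp
      have h2 : (τ * ((ε ^ (-k) : Pell.Solution₁ d) : ℤ√d)) * (τ * ((ε ^ (-k) : Pell.Solution₁ d) : ℤ√d)) = 1 := by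
        have := congrArg (fun s : Pell.Solution₁ d => (s : ℤ√d)) h1
        simp only [hmul, hS] at this
        rw [← mul_assoc] at this
        exact (by ring : _ = _).trans this
      have h3 := norm (ε ^ (-k))
      set v := τ * ((ε ^ (-k) : Pell.Solution₁ d) : ℤ√d)
      have h4 := congrArg Zsqrtd.re h2
      have h5 := congrArg Zsqrtd.im h2
      simp at h4 h5
      have h6 : v.re = 0 := by nlinarith
      rw [h6] at h3
      have h7 : d * (v.im ^ 2) = 1 := by linarith
      have := Int.eq_one_or_neg_one_of_mul_eq_one h7
      omega
    · refine ⟨τ * ((ε ^ (-k) : Pell.Solution₁ d) : ℤ√d), norm _, ?_⟩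
      have h1 : S * (ε ^ (-k) * ε ^ (-k)) = ε := by
        rw [hn, ← zpow_add, ← zpow_add]
        rw [hk, show 2 * k + 1 + (-k + -k) = 1 by ring, zpow_one]
      have := congrArg (fun s : Pell.Solution₁ d => (s : ℤ√d)) h1
      simp only [hmul, hS] at this
      rw [← this]
      ring
  obtain ⟨σ, hσ, hσε⟩ := key
  let P : Pell.Solution₁ d := Pell.Solution₁.mk x y h
  have hP : ∃ (v : ℤ√d) (e : ℤ), (e = 1 ∨ e = -1) ∧
      (v.re ^ 2 - d * v.im ^ 2 = 1 ∨ v.re ^ 2 - d * v.im ^ 2 = -1) ∧ (P : ℤ√d) = e * (v * v) := by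
    have hz : ∀ n : ℤ, ∃ v : ℤ√d,
        (v.re ^ 2 - d * v.im ^ 2 = 1 ∨ v.re ^ 2 - d * v.im ^ 2 = -1) ∧
        ((ε ^ n : Pell.Solution₁ d) : ℤ√d) = v * v := by
      intro n
      rcases Int.even_or_odd' n with ⟨k, hk | hk⟩
      · refine ⟨((ε ^ k : Pell.Solution₁ d) : ℤ√d), Or.inl (ε ^ k).prop, ?_⟩
        rw [hk, two_mul, zpow_add, hmul]
      · refine ⟨σ * ((ε ^ k : Pell.Solution₁ d) : ℤ√d), Or.inr ?_, ?_⟩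
        · have hv := (ε ^ k).prop
          change (σ.re * (ε ^ k).x + d * σ.im * (ε ^ k).y) ^ 2
            - d * (σ.re * (ε ^ k).y + σ.im * (ε ^ k).x) ^ 2 = -1
          linear_combination ((ε ^ k).x ^ 2 - d * (ε ^ k).y ^ 2) * hσ - hv
        · rw [hk, two_mul, zpow_add, zpow_add, hmul, hmul, zpow_one, ← hσε]
          ring
    obtain ⟨n, hn⟩ := hε.eq_zpow_or_neg_zpow P
    obtain ⟨v, hv, hv'⟩ := hz n
    rcases hn with hn | hn
    · exact ⟨v, 1, Or.inl rfl, hv, by rw [hn, hv']; simp⟩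
    · refine ⟨v, -1, Or.inr rfl, hv, ?_⟩
      rw [hn]
      change -((ε ^ n : Pell.Solution₁ d) : ℤ√d) = _
      rw [hv']
      simp
  obtain ⟨v, e, he, hv, hPe⟩ := hP
  refine ⟨v.re, v.im, e, he, hv, ?_, ?_⟩
  · have := congrArg Zsqrtd.re hPe
    change x = _ at this
    rw [this]
    simp
    exact Or.inl (by ring)
  · have := congrArg Zsqrtd.im hPe
    change y = _ at this
    rw [this]
    simp
    exact Or.inl (by ring)

namespace GaussianInt

theorem norm_mk (x y : ℤ) : Zsqrtd.norm (⟨x, y⟩ : GaussianInt) = x ^ 2 + y ^ 2 := by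
  simp [Zsqrtd.norm]
  ring

theorem isCoprime_of_dvd_of_dvd_conj {X c Y : ℤ} (hXc : IsCoprime X c) (hY : Odd Y)
    {d e : GaussianInt} (hd : d ∣ ⟨X, c⟩) (he : e ∣ ⟨X, -c⟩) (hdY : d ∣ (Y : GaussianInt) ^ 4) :
    IsCoprime d e := by
  obtain ⟨d', hd'⟩ := hd
  obtain ⟨e', he'⟩ := he
  obtain ⟨f, hf⟩ := hdY
  obtain ⟨m, n, hmn⟩ := hXc
  obtain ⟨j, hj⟩ : ∃ j, Y ^ 4 = 2 * j + 1 := hY.pow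
  have h2 : (2 : GaussianInt) = (⟨m, -n⟩ * d') * d + (⟨m, n⟩ * e') * e := by
    have : (2 : GaussianInt) = ⟨m, -n⟩ * ⟨X, c⟩ + ⟨m, n⟩ * ⟨X, -c⟩ := by
      ext
      · simp
        linarith
      · simp
        ring
    rw [this, hd', he']
    ring
  have h1 : (1 : GaussianInt) = d * f - j * 2 := by
    rw [← hf]
    have : (Y : GaussianInt) ^ 4 = 2 * j + 1 := by exact_mod_cast congrArg (Int.cast (R := GaussianInt)) hj
    rw [this]
    ring
  refine ⟨f - j * (⟨m, -n⟩ * d'), -j * (⟨m, n⟩ * e'), ?_⟩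
  linear_combination -h1 + (j : GaussianInt) * h2

theorem sq_eq_of_isUnit {v : GaussianInt} (hv : IsUnit v) : v ^ 2 = 1 ∨ v ^ 2 = -1 := by
  have h := (Zsqrtd.norm_eq_one_iff' (by norm_num) v).mpr hv
  obtain ⟨x, y⟩ := v
  rw [norm_mk] at h
  have hx : x = 0 ∨ x = 1 ∨ x = -1 := by
    have : x ^ 2 ≤ 1 := by nlinarith
    have h1 := abs_le_of_sq_le_sq' (by linarith : x ^ 2 ≤ 1 ^ 2) (by norm_num)
    omega
  rcases hx with rfl | rfl | rfl
  · right
    ext <;> simp [sq] at *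
    linarith
  all_goals
    left
    have hy : y = 0 := by
      have : y ^ 2 = 0 := by linarith
      exact pow_eq_zero_iff (by norm_num) |>.mp this
    subst hy
    rfl

/-- The part of `X + c i` coprime to `N`, where `X ^ 2 + c ^ 2 = N Y ^ 4`, is a fourth power. -/
theorem exists_eq_mul_pow_four {X c N Y : ℤ} (hXc : IsCoprime X c) (hY : Odd Y) (hYpos : 0 < Y)
    (h : X ^ 2 + c ^ 2 = N * Y ^ 4) :
    ∃ δ w : GaussianInt, (⟨X, c⟩ : GaussianInt) = δ * w ^ 4 ∧ w.norm = Y ∧ δ.norm = N ∧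
      ∀ d : GaussianInt, d ∣ ⟨X, c⟩ → d ∣ (N : GaussianInt) → d ∣ δ := by
  classical
  let _ : GCDMonoid GaussianInt := UniqueFactorizationMonoid.toGCDMonoid _
  set A : GaussianInt := ⟨X, c⟩ with hA
  have hAs : star A = ⟨X, -c⟩ := rfl
  have hAA : A * star A = (N : GaussianInt) * (Y : GaussianInt) ^ 4 := by
    have := Zsqrtd.norm_eq_mul_conj A
    rw [hA, norm_mk, h] at this
    rw [← this]
    push_cast
    rfl
  set g := gcd ((Y : GaussianInt) ^ 4) A with hg
  have hgA : g ∣ A := gcd_dvd_right _ _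
  have hgY : g ∣ (Y : GaussianInt) ^ 4 := gcd_dvd_left _ _
  have hstarY : star ((Y : GaussianInt) ^ 4) = (Y : GaussianInt) ^ 4 := by
    rw [star_pow]
    congr 1
  have hstar : ∀ {u v : GaussianInt}, u ∣ v → star u ∣ star v := by
    rintro u v ⟨k, rfl⟩
    exact ⟨star k, by rw [star_mul']⟩
  have hcop : IsCoprime g (star g) :=
    isCoprime_of_dvd_of_dvd_conj hXc hY hgA (hAs ▸ hstar hgA) hgY
  have hgsY : star g ∣ (Y : GaussianInt) ^ 4 := hstarY ▸ hstar hgY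
  have h1 : g * star g ∣ (Y : GaussianInt) ^ 4 := hcop.mul_dvd hgY hgsY
  have h2 : (Y : GaussianInt) ^ 4 ∣ g * star g := by
    have h3 : (Y : GaussianInt) ^ 4 ∣ gcd ((Y : GaussianInt) ^ 4) (A * star A) :=
      dvd_gcd dvd_rfl (hAA ▸ dvd_mul_left _ _)
    refine (h3.trans (gcd_mul_dvd_mul_gcd _ A (star A))).trans (mul_dvd_mul dvd_rfl ?_)
    have h5 : star (gcd ((Y : GaussianInt) ^ 4) (star A)) ∣ g := by
      refine dvd_gcd ?_ ?_
      · have := hstar (gcd_dvd_left ((Y : GaussianInt) ^ 4) (star A))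
        rwa [hstarY] at this
      · simpa using hstar (gcd_dvd_right ((Y : GaussianInt) ^ 4) (star A))
    simpa using hstar h5
  obtain ⟨v, hv⟩ := associated_of_dvd_dvd h1 h2
  have hcop' : IsUnit (gcd g (star g * v)) :=
    IsCoprime.isUnit_of_dvd' ((isCoprime_mul_unit_right_right v.isUnit g (star g)).mpr hcop)
      (gcd_dvd_left _ _) (gcd_dvd_right _ _)
  obtain ⟨w, hw⟩ := exists_associated_pow_of_mul_eq_pow hcop' (by rw [← mul_assoc, hv])
  have hgnorm : g.norm = Y ^ 4 := by
    have h3 := congrArg Zsqrtd.norm hv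
    have hvn : Zsqrtd.norm (v : GaussianInt) = 1 :=
      (Zsqrtd.norm_eq_one_iff' (by norm_num) _).mpr v.isUnit
    have hYn : Zsqrtd.norm ((Y : GaussianInt) ^ 4) = (Y ^ 4) ^ 2 := by
      rw [show ((Y : GaussianInt) ^ 4) = ((Y ^ 4 : ℤ) : GaussianInt) by push_cast; rfl,
        Zsqrtd.norm_intCast]
      ring
    rw [Zsqrtd.norm_mul, Zsqrtd.norm_mul, Zsqrtd.norm_conj, hvn, hYn, mul_one, ← sq] at h3
    exact (pow_left_inj₀ (GaussianInt.norm_nonneg g) (by positivity) (by norm_num)).mp h3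
  have hwnorm : w.norm = Y := by
    have h3 : Zsqrtd.norm (w ^ 4) = Zsqrtd.norm g := by
      obtain ⟨u, hu⟩ := hw
      rw [← hu, Zsqrtd.norm_mul, (Zsqrtd.norm_eq_one_iff' (by norm_num) _).mpr u.isUnit, mul_one]
    have h4 : Zsqrtd.norm (w ^ 4) = w.norm ^ 4 := map_pow (Zsqrtd.normMonoidHom) w 4
    rw [h4, hgnorm] at h3
    exact (pow_left_inj₀ (GaussianInt.norm_nonneg w) hYpos.le (by norm_num)).mp h3
  obtain ⟨δ, hδ⟩ := hw.dvd.trans hgA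
  have hwY : w ^ 4 ∣ (Y : GaussianInt) ^ 4 := hw.dvd.trans hgY
  have hδ' : A = δ * w ^ 4 := by rw [hδ, mul_comm]
  have hδn : δ.norm = N := by
    have h3 := congrArg Zsqrtd.norm hδ'
    have h4 : Zsqrtd.norm (w ^ 4) = w.norm ^ 4 := map_pow (Zsqrtd.normMonoidHom) w 4
    rw [Zsqrtd.norm_mul, h4, hwnorm, hA, norm_mk, h] at h3
    exact (mul_right_cancel₀ (pow_ne_zero 4 hYpos.ne') h3).symm
  refine ⟨δ, w, hδ', hwnorm, hδn, fun d hdA hdN => ?_⟩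
  have hc : IsCoprime (w ^ 4) (star δ) := by
    refine isCoprime_of_dvd_of_dvd_conj hXc hY (Dvd.intro_left δ hδ'.symm) ?_ hwY
    rw [← hAs]
    exact hstar (Dvd.intro _ hδ'.symm)
  have hN : (N : GaussianInt) = δ * star δ := by rw [← Zsqrtd.norm_eq_mul_conj, hδn]
  rw [hN] at hdN
  rw [hδ'] at hdA
  obtain ⟨s, t, hst⟩ := hc
  have : δ = s * (δ * w ^ 4) + t * (δ * star δ) := by linear_combination -δ * hst
  rw [this]
  exact dvd_add (hdA.mul_left s) (hdN.mul_left t)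

theorem isCoprime_of_norm_eq {X c N Y : ℤ} (hXc : IsCoprime X c)
    (h : X ^ 2 + c ^ 2 = N * Y ^ 4) : IsCoprime N c := by
  have h1 : IsCoprime (N * Y ^ 4) c := by
    rw [← h]
    have h2 : IsCoprime (X ^ 2) c := hXc.pow_left
    have := h2.add_mul_right_left c
    rwa [← sq] at this
  exact h1.of_mul_left_left

/-- If two elements `X + c i` of norm `N` times a fourth power have a quotient which is, up to
sign, a square, then this quotient is, up to sign, a fourth power. -/
theorem exists_mul_conj_eq_pow_four {X₁ X₂ c N Y₁ Y₂ : ℤ} (h1c : IsCoprime X₁ c)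
    (h2c : IsCoprime X₂ c) (hY₁ : Odd Y₁) (hY₂ : Odd Y₂) (hp₁ : 0 < Y₁) (hp₂ : 0 < Y₂)
    (h₁ : X₁ ^ 2 + c ^ 2 = N * Y₁ ^ 4) (h₂ : X₂ ^ 2 + c ^ 2 = N * Y₂ ^ 4)
    {z : GaussianInt} {e : ℤ} (he : e = 1 ∨ e = -1)
    (hz : (⟨X₁, c⟩ * ⟨X₂, -c⟩ : GaussianInt) = e * N * z ^ 2) :
    ∃ (x : GaussianInt) (s : ℤ), (s = 1 ∨ s = -1) ∧ x.norm = Y₁ * Y₂ ∧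
      (⟨X₁, c⟩ * ⟨X₂, -c⟩ : GaussianInt) = s * N * x ^ 4 := by
  have hNpos : N ≠ 0 := by
    rintro rfl
    have hc0 : c = 0 := by nlinarith [sq_nonneg X₁, sq_nonneg c]
    have hX0 : X₁ = 0 := by nlinarith [sq_nonneg X₁, sq_nonneg c]
    rw [hc0, hX0] at h1c
    exact not_isCoprime_zero_zero h1c
  have hNc := isCoprime_of_norm_eq h1c h₁
  have hdiv : N ∣ X₂ - X₁ := by
    have h3 : N ∣ (X₂ - X₁) * c := by
      have h4 := congrArg Zsqrtd.im hz
      simp [sq] at h4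
      refine ⟨e * (z.re * z.im + z.im * z.re), ?_⟩
      have h5 : (e * N : GaussianInt) = ((e * N : ℤ) : GaussianInt) := by push_cast; rfl
      linear_combination h4
    exact hNc.dvd_of_dvd_mul_right h3
  obtain ⟨δ₁, w₁, hA₁, hw₁, hδ₁, hmax₁⟩ := exists_eq_mul_pow_four h1c hY₁ hp₁ h₁
  obtain ⟨δ₂, w₂, hA₂, hw₂, hδ₂, hmax₂⟩ := exists_eq_mul_pow_four h2c hY₂ hp₂ h₂
  have hNA : (N : GaussianInt) ∣ ⟨X₂, c⟩ - ⟨X₁, c⟩ := by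
    have : ((X₂ - X₁ : ℤ) : GaussianInt) = ⟨X₂, c⟩ - ⟨X₁, c⟩ := by ext <;> simp
    rw [← this]
    exact map_dvd (Int.castRingHom GaussianInt) hdiv
  have hdN : ∀ {δ : GaussianInt}, δ.norm = N → δ ∣ (N : GaussianInt) := by
    intro δ hδ
    rw [← hδ, Zsqrtd.norm_eq_mul_conj]
    exact dvd_mul_right _ _
  have h12 : δ₁ ∣ δ₂ := by
    refine hmax₂ _ ?_ (hdN hδ₁)
    have := dvd_add ((hdN hδ₁).trans hNA) (Dvd.intro _ hA₁.symm : δ₁ ∣ ⟨X₁, c⟩)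
    simpa using this
  have h21 : δ₂ ∣ δ₁ := by
    refine hmax₁ _ ?_ (hdN hδ₂)
    have := dvd_sub (Dvd.intro _ hA₂.symm : δ₂ ∣ ⟨X₂, c⟩) ((hdN hδ₂).trans hNA)
    simpa using this
  obtain ⟨v, hv⟩ := associated_of_dvd_dvd h21 h12
  have hA₂s : (⟨X₂, -c⟩ : GaussianInt) = star δ₂ * star w₂ ^ 4 := by
    have := congrArg star hA₂
    rw [star_mul', star_pow] at this
    exact this
  have hN2 : (N : GaussianInt) = δ₂ * star δ₂ := by rw [← Zsqrtd.norm_eq_mul_conj, hδ₂]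
  have hN0 : (N : GaussianInt) ≠ 0 := by exact_mod_cast hNpos
  have hprod : (⟨X₁, c⟩ * ⟨X₂, -c⟩ : GaussianInt) = N * (v * (w₁ * star w₂) ^ 4) := by
    rw [hA₁, hA₂s, hN2, ← hv]
    ring
  have heq : (v : GaussianInt) * (w₁ * star w₂) ^ 4 = e * z ^ 2 := by
    apply mul_left_cancel₀ hN0
    rw [← hprod, hz]
    ring
  have heu : IsUnit (e : GaussianInt) := by
    rcases he with rfl | rfl <;> simp
  have hass : Associated (((w₁ * star w₂) ^ 2) ^ 2) (z ^ 2) := by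
    have h3 : Associated ((w₁ * star w₂) ^ 4) (v * (w₁ * star w₂) ^ 4) :=
      (associated_unit_mul_left _ _ v.isUnit).symm
    rw [heq] at h3
    have h4 := h3.trans (associated_unit_mul_left _ _ heu)
    rw [← pow_mul]
    exact h4
  have hass' : Associated ((w₁ * star w₂) ^ 2) z :=
    associated_of_dvd_dvd ((IsIntegrallyClosed.pow_dvd_pow_iff (by norm_num)).mp hass.dvd)
      ((IsIntegrallyClosed.pow_dvd_pow_iff (by norm_num)).mp hass.symm.dvd)
  obtain ⟨y, hy⟩ := hass'
  have hnorm : (w₁ * star w₂).norm = Y₁ * Y₂ := by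
    rw [Zsqrtd.norm_mul, Zsqrtd.norm_conj, hw₁, hw₂]
  rw [hz, ← hy]
  rcases sq_eq_of_isUnit y.isUnit with h5 | h5
  · refine ⟨w₁ * star w₂, e, he, hnorm, ?_⟩
    rw [mul_pow, h5]
    ring
  · refine ⟨w₁ * star w₂, -e, ?_, hnorm, ?_⟩
    · rcases he with rfl | rfl <;> simp
    · rw [mul_pow, h5]
      push_cast
      ring

end GaussianInt

/-- The elements `X₁ + c i` and `± X₂ + c i` of `ℤ[i]`, whose norms are `N Y₁ ^ 4` and
`N Y₂ ^ 4`, have, up to sign, a fourth power as their quotient. -/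
def FourthPowerLinked (N c X₁ Y₁ X₂ Y₂ : ℤ) : Prop :=
  ∃ (X : ℤ) (s : ℤ) (x : GaussianInt), (X = X₂ ∨ X = -X₂) ∧ (s = 1 ∨ s = -1) ∧
    x.norm = Y₁ * Y₂ ∧ (⟨X₁, c⟩ * ⟨X, -c⟩ : GaussianInt) = s * N * x ^ 4

theorem odd_of_sq_add_sq_eq {X c N Y : ℤ} (hX : IsCoprime X c)
    (h : X ^ 2 + c ^ 2 = N * Y ^ 4) : Odd Y := by
  rw [← Int.not_even_iff_odd]
  rintro ⟨k, rfl⟩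
  obtain ⟨m, n, hmn⟩ := hX
  have h4 : (X ^ 2 + c ^ 2) % 4 = 0 := by
    rw [h, show N * (k + k) ^ 4 = 4 * (4 * N * k ^ 4) by ring]
    simp
  rcases Int.even_or_odd' X with ⟨x, rfl | rfl⟩ <;> rcases Int.even_or_odd' c with ⟨d, rfl | rfl⟩
  · have : 2 * (m * x + n * d) = 1 := by linarith
    omega
  · have : (2 * x) ^ 2 + (2 * d + 1) ^ 2 = 4 * (x ^ 2 + d ^ 2 + d) + 1 := by ring
    omega
  · have : (2 * x + 1) ^ 2 + (2 * d) ^ 2 = 4 * (x ^ 2 + d ^ 2 + x) + 1 := by ring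
    omega
  · have : (2 * x + 1) ^ 2 + (2 * d + 1) ^ 2 = 4 * (x ^ 2 + d ^ 2 + x + d) + 2 := by ring
    omega

theorem fourthPowerLinked_of_sq_add_one {N x₁ y₁ x₂ y₂ : ℤ} (hx₁ : 0 < x₁) (hy₁ : 0 < y₁)
    (hy₂ : 0 < y₂) (h₁ : x₁ ^ 2 + 1 = N * y₁ ^ 4) (h₂ : x₂ ^ 2 + 1 = N * y₂ ^ 4) :
    FourthPowerLinked N 1 x₁ y₁ x₂ y₂ := by
  have hy4 : 0 < y₁ ^ 4 := by positivity
  have hN0 : 0 < N := by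
    by_contra hN
    have : N * y₁ ^ 4 ≤ 0 := mul_nonpos_of_nonpos_of_nonneg (by linarith) hy4.le
    nlinarith
  have hsq : ¬ IsSquare N := by
    rintro ⟨r, rfl⟩
    have h3 : (r * y₁ ^ 2) ^ 2 = x₁ ^ 2 + 1 := by rw [h₁]; ring
    have h4 : |x₁| < |r * y₁ ^ 2| := sq_lt_sq.mp (by linarith)
    have h5 : |x₁| + 1 ≤ |r * y₁ ^ 2| := h4
    have h6 := pow_le_pow_left₀ (by positivity) h5 2
    rw [add_sq, sq_abs, sq_abs, h3, abs_of_pos hx₁] at h6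
    linarith
  have hN1 : 1 < N := by
    rcases eq_or_lt_of_le (show 1 ≤ N from hN0) with h | h
    · exact absurd ⟨1, by rw [← h]; rfl⟩ hsq
    · exact h
  have hneg : x₁ ^ 2 - N * (y₁ ^ 2) ^ 2 = -1 := by linear_combination h₁
  have hone : (-x₁ * x₂ + N * y₁ ^ 2 * y₂ ^ 2) ^ 2 - N * (y₁ ^ 2 * x₂ - x₁ * y₂ ^ 2) ^ 2 = 1 := by
    linear_combination (x₂ ^ 2 - N * y₂ ^ 4) * h₁ - h₂
  obtain ⟨t, u, e, he, htu, hre, him⟩ := Pell.exists_sq_of_neg_solvable hN1 hsq hneg hone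
  have hx : x₂ = e * (x₁ * (t ^ 2 + N * u ^ 2) + 2 * N * y₁ ^ 2 * t * u) := by
    linear_combination x₁ * hre + N * y₁ ^ 2 * him + x₂ * h₁
  have hy : y₂ ^ 2 = e * (y₁ ^ 2 * (t ^ 2 + N * u ^ 2) + 2 * x₁ * t * u) := by
    linear_combination y₁ ^ 2 * hre + x₁ * him + y₂ ^ 2 * h₁
  have hee : e = 1 := by
    rcases he with rfl | rfl
    · rfl
    · exfalso
      have h3 : y₁ ^ 2 * y₂ ^ 2 + (y₁ ^ 2 * t + x₁ * u) ^ 2 + u ^ 2 = 0 := by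
        linear_combination y₁ ^ 2 * hy + u ^ 2 * h₁
      have : 0 < y₁ ^ 2 * y₂ ^ 2 := by positivity
      nlinarith [sq_nonneg (y₁ ^ 2 * t + x₁ * u), sq_nonneg u]
  subst hee
  have hcop : ∀ w : ℤ, IsCoprime w 1 := fun w => isCoprime_one_right
  have ho₁ := odd_of_sq_add_sq_eq (hcop x₁) (by rw [one_pow]; exact h₁)
  have ho₂ := odd_of_sq_add_sq_eq (hcop x₂) (by rw [one_pow]; exact h₂)
  have main : ∀ (X : ℤ) (e : ℤ) (z : GaussianInt), (X = x₂ ∨ X = -x₂) → (e = 1 ∨ e = -1) →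
      (⟨x₁, 1⟩ * ⟨X, -1⟩ : GaussianInt) = e * N * z ^ 2 → FourthPowerLinked N 1 x₁ y₁ x₂ y₂ := by
    intro X e z hX he hz
    have h₂' : X ^ 2 + 1 ^ 2 = N * y₂ ^ 4 := by rcases hX with rfl | rfl <;> linear_combination h₂
    obtain ⟨x, s, hs, hn, hx⟩ := GaussianInt.exists_mul_conj_eq_pow_four (hcop x₁) (hcop X) ho₁ ho₂
      hy₁ hy₂ (by linear_combination h₁) h₂' he hz
    exact ⟨X, s, x, hX, hs, hn, hx⟩
  rcases htu with htu | htu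
  · refine main x₂ 1 ⟨y₁ ^ 2 * t + x₁ * u, u⟩ (Or.inl rfl) (Or.inl rfl) ?_
    ext
    · simp [sq]
      linear_combination x₁ * hx - htu + t ^ 2 * h₁
    · simp [sq]
      linear_combination hx + x₁ * htu
  · refine main (-x₂) (-1) ⟨y₁ ^ 2 * t + x₁ * u, u⟩ (Or.inr rfl) (Or.inr rfl) ?_
    ext
    · simp [sq]
      linear_combination -x₁ * hx + htu - t ^ 2 * h₁
    · simp [sq]
      linear_combination -hx - x₁ * htu

theorem sq_dvd_sub_or_add {p m : ℕ} (hp : p.Prime) {a X Y : ℤ} (ha : ¬ (p : ℤ) ∣ a)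
    (hX : ¬ (p : ℤ) ∣ X) (hY : Odd Y)
    (h : X ^ 2 + ((p : ℤ) ^ m) ^ 2 = (a ^ 2 + ((p : ℤ) ^ m) ^ 2) * Y ^ 4) :
    ((p : ℤ) ^ m) ^ 2 ∣ X - a * Y ^ 2 ∨ ((p : ℤ) ^ m) ^ 2 ∣ X + a * Y ^ 2 := by
  have hpp : Prime (p : ℤ) := Nat.prime_iff_prime_int.mp hp
  have hprod : (X - a * Y ^ 2) * (X + a * Y ^ 2) = ((p : ℤ) ^ m) ^ 2 * (Y ^ 4 - 1) := by
    linear_combination h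
  rcases hp.eq_two_or_odd' with rfl | hodd
  · obtain ⟨k, rfl⟩ := hY
    have hXo : X % 2 = 1 := by push_cast at hX; omega
    have hao : a % 2 = 1 := by push_cast at ha; omega
    obtain ⟨x, rfl⟩ : ∃ x, X = 2 * x + 1 := ⟨X / 2, by omega⟩
    obtain ⟨b, rfl⟩ : ∃ b, a = 2 * b + 1 := ⟨a / 2, by omega⟩
    set q : ℤ := (2 * b + 1) * (2 * k ^ 2 + 2 * k) + b with hq
    have hq' : (2 * b + 1) * (2 * k + 1) ^ 2 = 2 * q + 1 := by rw [hq]; ring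
    rw [hq'] at hprod ⊢
    have hd : (((2 : ℕ) : ℤ) ^ m) ^ 2 ∣ (x - q) * (x + q + 1) := by
      refine ⟨4 * k ^ 4 + 8 * k ^ 3 + 6 * k ^ 2 + 2 * k, ?_⟩
      apply mul_left_cancel₀ (four_ne_zero (α := ℤ))
      linear_combination hprod
    rw [← pow_mul] at hd ⊢
    rcases Int.even_or_odd' (x - q) with ⟨j, hj | hj⟩
    · have hc : IsCoprime (((2 : ℕ) : ℤ) ^ (m * 2)) (x + q + 1) := by
        refine IsCoprime.pow_left ⟨-(j + q), 1, ?_⟩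
        push_cast
        linarith
      exact Or.inl ((hc.dvd_of_dvd_mul_right hd).trans ⟨2, by ring⟩)
    · have hc : IsCoprime (((2 : ℕ) : ℤ) ^ (m * 2)) (x - q) := by
        refine IsCoprime.pow_left ⟨-j, 1, ?_⟩
        push_cast
        linarith
      exact Or.inr ((hc.dvd_of_dvd_mul_left hd).trans ⟨2, by ring⟩)
  · have h2 : ¬ (p : ℤ) ∣ 2 := by
      intro h2
      have h3 : p ∣ 2 := by exact_mod_cast h2
      have := Nat.le_of_dvd (by norm_num) h3
      have := hp.two_le
      have : p = 2 := by omega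
      subst this
      exact absurd hodd (by decide)
    have hd : ((p : ℤ) ^ m) ^ 2 ∣ (X - a * Y ^ 2) * (X + a * Y ^ 2) := hprod ▸ dvd_mul_right _ _
    rw [← pow_mul] at hd ⊢
    by_cases h3 : (p : ℤ) ∣ X - a * Y ^ 2
    · have h4 : ¬ (p : ℤ) ∣ X + a * Y ^ 2 := by
        intro h4
        have h5 := dvd_add h3 h4
        rw [show X - a * Y ^ 2 + (X + a * Y ^ 2) = 2 * X by ring] at h5
        exact (hpp.dvd_or_dvd h5).elim h2 hX
      exact Or.inl (((hpp.coprime_iff_not_dvd.mpr h4).pow_left).dvd_of_dvd_mul_right hd)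
    · exact Or.inr (((hpp.coprime_iff_not_dvd.mpr h3).pow_left).dvd_of_dvd_mul_left hd)

theorem isCoprime_prime_pow {p : ℕ} (hp : p.Prime) {X : ℤ} (hX : ¬ (p : ℤ) ∣ X) (m : ℕ) :
    IsCoprime X ((p : ℤ) ^ m) :=
  (((Nat.prime_iff_prime_int.mp hp).coprime_iff_not_dvd.mpr hX).pow_left).symm

theorem exists_base_eq_pow_four {p m : ℕ} (hp : p.Prime) {a X Y : ℤ} (ha0 : a ≠ 0)
    (ha : ¬ (p : ℤ) ∣ a) (hX : ¬ (p : ℤ) ∣ X) (hYpos : 0 < Y)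
    (hsq : ¬ IsSquare (a ^ 2 + ((p : ℤ) ^ m) ^ 2))
    (hpell : ∃ x y : ℤ, x ^ 2 - (a ^ 2 + ((p : ℤ) ^ m) ^ 2) * y ^ 2 = -1)
    (h : X ^ 2 + ((p : ℤ) ^ m) ^ 2 = (a ^ 2 + ((p : ℤ) ^ m) ^ 2) * Y ^ 4) :
    ∃ (α s : ℤ) (x : GaussianInt), (α = a ∨ α = -a) ∧ (s = 1 ∨ s = -1) ∧ x.norm = Y ∧
      (⟨α, (p : ℤ) ^ m⟩ * ⟨X, -(p : ℤ) ^ m⟩ : GaussianInt) =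
        s * ((a ^ 2 + ((p : ℤ) ^ m) ^ 2 : ℤ) : GaussianInt) * x ^ 4 := by
  have hXc := isCoprime_prime_pow hp hX m
  have hac := isCoprime_prime_pow hp ha m
  have hYo := odd_of_sq_add_sq_eq hXc h
  obtain ⟨β, hβ, k, hk⟩ : ∃ β, (β = a ∨ β = -a) ∧ ((p : ℤ) ^ m) ^ 2 ∣ X - β * Y ^ 2 := by
    rcases sq_dvd_sub_or_add hp ha hX hYo h with h1 | h1
    · exact ⟨a, Or.inl rfl, h1⟩
    · exact ⟨-a, Or.inr rfl, by simpa using h1⟩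
  have hc0 : (p : ℤ) ^ m ≠ 0 := pow_ne_zero _ (by exact_mod_cast hp.ne_zero)
  set c : ℤ := (p : ℤ) ^ m with hc
  have hD : a ^ 2 + c ^ 2 = β ^ 2 + c ^ 2 := by rcases hβ with rfl | rfl <;> ring
  rw [hD] at hsq hpell h ⊢
  have hβc : IsCoprime β c := by
    rcases hβ with rfl | rfl
    · exact hac
    · exact hac.neg_left
  set D := β ^ 2 + c ^ 2 with hDdef
  have hc2 : 0 < c ^ 2 := by positivity
  have hD1 : 1 < D := by
    have : 0 < β ^ 2 := by rcases hβ with rfl | rfl <;> simpa using sq_pos_of_ne_zero ha0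
    rw [hDdef]
    linarith
  have hone : (Y ^ 2 - β * k) ^ 2 - D * k ^ 2 = 1 := by
    have h1 : c ^ 2 * ((Y ^ 2 - β * k) ^ 2 - D * k ^ 2 - 1) = 0 := by
      have hXe : X = β * Y ^ 2 + c ^ 2 * k := by linear_combination hk
      rw [hXe] at h
      linear_combination -h
    have := (mul_eq_zero.mp h1).resolve_left hc2.ne'
    linarith
  obtain ⟨x₀, y₀, h₀⟩ := hpell
  obtain ⟨t, u, e, he, htu, hre, him⟩ := Pell.exists_sq_of_neg_solvable hD1 hsq h₀ hone
  have hx : X = e * (β * (t ^ 2 + D * u ^ 2) + D * (2 * t * u)) := by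
    linear_combination hk + β * hre + D * him
  have hy : Y ^ 2 = e * (t ^ 2 + D * u ^ 2 + β * (2 * t * u)) := by
    linear_combination hre + β * him
  have hee : e = 1 := by
    rcases he with rfl | rfl
    · rfl
    · exfalso
      have h3 : Y ^ 2 + (t + β * u) ^ 2 + (c * u) ^ 2 = 0 := by
        linear_combination hy
      have : 0 < Y ^ 2 := by positivity
      nlinarith [sq_nonneg (t + β * u), sq_nonneg (c * u)]
  subst hee
  have main : ∀ (α e : ℤ) (z : GaussianInt), (α = β ∨ α = -β) → (e = 1 ∨ e = -1) →
      (⟨α, c⟩ * ⟨X, -c⟩ : GaussianInt) = e * D * z ^ 2 →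
      ∃ (α s : ℤ) (x : GaussianInt), (α = a ∨ α = -a) ∧ (s = 1 ∨ s = -1) ∧ x.norm = Y ∧
        (⟨α, c⟩ * ⟨X, -c⟩ : GaussianInt) = s * (D : GaussianInt) * x ^ 4 := by
    intro α e z hα he hz
    have hα' : α ^ 2 + c ^ 2 = D * 1 ^ 4 := by rcases hα with rfl | rfl <;> rw [hDdef] <;> ring
    have hαc : IsCoprime α c := by
      rcases hα with rfl | rfl
      · exact hβc
      · exact hβc.neg_left
    obtain ⟨x, s, hs, hn, hx⟩ := GaussianInt.exists_mul_conj_eq_pow_four hαc hXc odd_one hYo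
      one_pos hYpos hα' h he hz
    refine ⟨α, s, x, ?_, hs, by simpa using hn, hx⟩
    rcases hα with rfl | rfl <;> rcases hβ with rfl | rfl <;> simp
  rcases htu with htu | htu
  · refine main β 1 ⟨t + β * u, c * u⟩ (Or.inl rfl) (Or.inl rfl) ?_
    ext
    · simp [sq]
      linear_combination β * hx - c ^ 2 * htu + t ^ 2 * hDdef
    · simp [sq]
      linear_combination c * hx + c * β * htu
  · refine main (-β) (-1) ⟨t + β * u, -c * u⟩ (Or.inr rfl) (Or.inr rfl) ?_
    ext
    · simp [sq]
      linear_combination -β * hx + c ^ 2 * htu - t ^ 2 * hDdef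
    · simp [sq]
      linear_combination c * hx + c * β * htu

theorem fourthPowerLinked_of_not_dvd {p m : ℕ} (hp : p.Prime) {a X₁ Y₁ X₂ Y₂ : ℤ} (ha0 : a ≠ 0)
    (ha : ¬ (p : ℤ) ∣ a) (hX₁ : ¬ (p : ℤ) ∣ X₁) (hX₂ : ¬ (p : ℤ) ∣ X₂) (hY₁ : 0 < Y₁)
    (hY₂ : 0 < Y₂) (hsq : ¬ IsSquare (a ^ 2 + ((p : ℤ) ^ m) ^ 2))
    (hpell : ∃ x y : ℤ, x ^ 2 - (a ^ 2 + ((p : ℤ) ^ m) ^ 2) * y ^ 2 = -1)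
    (h₁ : X₁ ^ 2 + ((p : ℤ) ^ m) ^ 2 = (a ^ 2 + ((p : ℤ) ^ m) ^ 2) * Y₁ ^ 4)
    (h₂ : X₂ ^ 2 + ((p : ℤ) ^ m) ^ 2 = (a ^ 2 + ((p : ℤ) ^ m) ^ 2) * Y₂ ^ 4) :
    FourthPowerLinked (a ^ 2 + ((p : ℤ) ^ m) ^ 2) ((p : ℤ) ^ m) X₁ Y₁ X₂ Y₂ := by
  obtain ⟨α, s, x, hα, hs, hx, hαx⟩ := exists_base_eq_pow_four hp ha0 ha hX₁ hY₁ hsq hpell h₁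
  obtain ⟨β, t, y, hβ, ht, hy, hβy⟩ := exists_base_eq_pow_four hp ha0 ha hX₂ hY₂ hsq hpell h₂
  have hD0 : a ^ 2 + ((p : ℤ) ^ m) ^ 2 ≠ 0 := by positivity
  have hD : ∀ γ : ℤ, (γ = a ∨ γ = -a) → ((a ^ 2 + ((p : ℤ) ^ m) ^ 2 : ℤ) : GaussianInt) =
      ⟨γ, -(p : ℤ) ^ m⟩ * ⟨γ, (p : ℤ) ^ m⟩ := by
    intro γ hγ
    have h3 : a ^ 2 + ((p : ℤ) ^ m) ^ 2 = γ ^ 2 + ((p : ℤ) ^ m) ^ 2 := by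
      rcases hγ with rfl | rfl <;> ring
    rw [h3]
    ext
    · rw [Zsqrtd.re_intCast]
      simp
      ring
    · rw [Zsqrtd.im_intCast]
      simp
      ring
  have hDβ := hD β hβ
  generalize (p : ℤ) ^ m = c at *
  generalize a ^ 2 + c ^ 2 = D at *
  have hD0' : (D : GaussianInt) ≠ 0 := by exact_mod_cast hD0
  have conj : ∀ {γ X e : ℤ} {z : GaussianInt},
      (⟨γ, c⟩ * ⟨X, -c⟩ : GaussianInt) = e * D * z ^ 4 →
      (⟨γ, -c⟩ * ⟨X, c⟩ : GaussianInt) = e * D * star z ^ 4 := by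
    intro γ X e z h
    have h3 := congrArg star h
    rw [star_mul', star_mul', star_mul', star_pow] at h3
    have h4 : (star (⟨γ, c⟩ : GaussianInt)) = ⟨γ, -c⟩ := rfl
    have h5 : (star (⟨X, -c⟩ : GaussianInt)) = ⟨X, c⟩ := by ext <;> simp
    have h6 : ∀ n : ℤ, star (n : GaussianInt) = n := fun n => by ext <;> simp
    rw [h4, h5, h6, h6] at h3
    exact h3
  have hst : s * t = 1 ∨ s * t = -1 := by
    rcases hs with rfl | rfl <;> rcases ht with rfl | rfl <;> simp
  have hαβ : α = β ∨ α = -β := by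
    rcases hα with rfl | rfl <;> rcases hβ with rfl | rfl <;> simp
  rcases hαβ with rfl | rfl
  · refine ⟨X₂, s * t, star x * y, Or.inl rfl, hst, ?_, ?_⟩
    · rw [Zsqrtd.norm_mul, Zsqrtd.norm_conj, hx, hy]
    · apply mul_left_cancel₀ hD0'
      have h3 := conj hαx
      push_cast
      calc (D : GaussianInt) * (⟨X₁, c⟩ * ⟨X₂, -c⟩)
          = (⟨α, -c⟩ * ⟨X₁, c⟩) * (⟨α, c⟩ * ⟨X₂, -c⟩) := by rw [hDβ]; ring
        _ = _ := by rw [h3, hβy]; ring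
  · refine ⟨-X₂, s * t, star x * star y, Or.inr rfl, hst, ?_, ?_⟩
    · rw [Zsqrtd.norm_mul, Zsqrtd.norm_conj, Zsqrtd.norm_conj, hx, hy]
    · apply mul_left_cancel₀ hD0'
      have h3 := conj hαx
      have h4 := conj hβy
      have h5 : (⟨-X₂, -c⟩ : GaussianInt) = -⟨X₂, c⟩ := by ext <;> simp
      have h6 : (⟨-β, -c⟩ : GaussianInt) = -⟨β, c⟩ := by ext <;> simp
      rw [h6] at h3
      rw [h5]
      push_cast
      calc (D : GaussianInt) * (⟨X₁, c⟩ * -⟨X₂, c⟩)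
          = (-⟨β, c⟩ * ⟨X₁, c⟩) * (⟨β, -c⟩ * ⟨X₂, c⟩) := by rw [hDβ]; ring
        _ = _ := by rw [h3, h4]; ring

/-- The quartic form attached to a solution by `exists_base_eq_pow_four`. -/
theorem exists_quartic_form_eq {p m : ℕ} (hp : p.Prime) {a X Y : ℤ} (ha0 : a ≠ 0)
    (ha : ¬ (p : ℤ) ∣ a) (hX : ¬ (p : ℤ) ∣ X) (hYpos : 0 < Y)
    (hsq : ¬ IsSquare (a ^ 2 + ((p : ℤ) ^ m) ^ 2))
    (hpell : ∃ x y : ℤ, x ^ 2 - (a ^ 2 + ((p : ℤ) ^ m) ^ 2) * y ^ 2 = -1)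
    (h : X ^ 2 + ((p : ℤ) ^ m) ^ 2 = (a ^ 2 + ((p : ℤ) ^ m) ^ 2) * Y ^ 4) :
    ∃ r s e : ℤ, (e = 1 ∨ e = -1) ∧ r ^ 2 + s ^ 2 = Y ∧
      (p : ℤ) ^ m * (r ^ 4 - 6 * r ^ 2 * s ^ 2 + s ^ 4) - a * (4 * r * s * (r ^ 2 - s ^ 2)) =
        e * (p : ℤ) ^ m := by
  obtain ⟨α, e, x, hα, he, hx, hαx⟩ := exists_base_eq_pow_four hp ha0 ha hX hYpos hsq hpell h
  have hD0 : a ^ 2 + ((p : ℤ) ^ m) ^ 2 ≠ 0 := by positivity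
  have hD : a ^ 2 + ((p : ℤ) ^ m) ^ 2 = α ^ 2 + ((p : ℤ) ^ m) ^ 2 := by
    rcases hα with rfl | rfl <;> ring
  obtain ⟨r, s⟩ := x
  rw [GaussianInt.norm_mk] at hx
  generalize (p : ℤ) ^ m = c at *
  generalize a ^ 2 + c ^ 2 = D at *
  have hx4 : (⟨r, s⟩ : GaussianInt) ^ 4 =
      ⟨r ^ 4 - 6 * r ^ 2 * s ^ 2 + s ^ 4, 4 * r * s * (r ^ 2 - s ^ 2)⟩ := by
    rw [show 4 = 2 + 2 by norm_num, pow_add, sq]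
    ext <;> simp <;> ring
  rw [hx4] at hαx
  have hre := congrArg Zsqrtd.re hαx
  have him := congrArg Zsqrtd.im hαx
  simp at hre him
  have key : c * (r ^ 4 - 6 * r ^ 2 * s ^ 2 + s ^ 4) - α * (4 * r * s * (r ^ 2 - s ^ 2)) =
      e * c := by
    have hee : e * e = 1 := by rcases he with rfl | rfl <;> norm_num
    apply mul_left_cancel₀ hD0
    linear_combination -c * e * hre + α * e * him - c * e * hD + (D *
      (α * (4 * r * s * (r ^ 2 - s ^ 2)) - c * (r ^ 4 - 6 * r ^ 2 * s ^ 2 + s ^ 4))) * hee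
  rcases hα with rfl | rfl
  · exact ⟨r, s, e, he, hx, key⟩
  · exact ⟨r, -s, e, he, by rw [← hx]; ring, by rw [← key]; ring⟩

namespace QuarticPade

/-- The product `5 · 9 ⋯ (4 n + 1)`. -/
def prodFive (n : ℕ) : ℕ := ∏ i ∈ Finset.range n, (4 * i + 5)

theorem prodFive_succ (n : ℕ) : prodFive (n + 1) = prodFive n * (4 * n + 5) :=
  Finset.prod_range_succ _ _

theorem prodFive_pos (n : ℕ) : 0 < prodFive n := Finset.prod_pos fun i _ => by omega

/-- The coefficient of `y ^ k * A ^ d` in the Padé numerator of degree `k + d`. -/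
noncomputable def coeff (k d : ℕ) : ℝ :=
  (prodFive (k + d) * (k + 2 * d).factorial : ℝ) /
    (prodFive d * k.factorial * d.factorial * (k + d).factorial)

noncomputable def shiftRight (f : ℕ → ℕ → ℝ) : ℕ → ℕ → ℝ
  | _, 0 => 0
  | k, d + 1 => f k d

noncomputable def shiftLeft (f : ℕ → ℕ → ℝ) : ℕ → ℕ → ℝ
  | 0, _ => 0
  | k + 1, d => f k d

theorem coeff_recurrence (r k d : ℕ) (h : k + d = r + 2) :
    ((r : ℝ) + 2) * coeff k d =
      (2 * r + 3) * (2 * shiftRight coeff k d + 4 * shiftLeft coeff k d)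
        - (4 * r + 3) * (4 * r + 5) / (r + 1) * shiftLeft (shiftLeft coeff) k d := by
  have pf : ∀ n, (prodFive n : ℝ) ≠ 0 := fun n => by exact_mod_cast (prodFive_pos n).ne'
  have ff : ∀ n : ℕ, (n.factorial : ℝ) ≠ 0 := fun n => by exact_mod_cast n.factorial_ne_zero
  have ps : ∀ n, (prodFive (n + 1) : ℝ) = prodFive n * (4 * n + 5) := fun n => by
    rw [prodFive_succ]; push_cast; ring
  have fs : ∀ n : ℕ, ((n + 1).factorial : ℝ) = (n + 1) * n.factorial := fun n => by
    rw [Nat.factorial_succ]; push_cast; ring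
  match k, d with
  | 0, 0 => omega
  | 0, 1 => omega
  | 1, 0 => omega
  | 0, d + 2 =>
    obtain rfl : r = d := by omega
    have e1 : 2 * (r + 2) = 2 * r + 1 + 1 + 1 + 1 := by ring
    have e2 : 2 * (r + 1) = 2 * r + 1 + 1 := by ring
    simp only [shiftRight, shiftLeft, coeff, Nat.factorial_zero, zero_add, e1, e2, fs, ps,
      show r + 2 = r + 1 + 1 from rfl]
    have := pf r
    have := ff r
    have := ff (2 * r)
    have : (4 * (r : ℝ) + 5) ≠ 0 := by positivity
    have : (4 * ((r : ℝ) + 1) + 5) ≠ 0 := by positivity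
    push_cast
    field_simp
    ring
  | 1, d + 1 =>
    obtain rfl : r = d := by omega
    have e1 : 1 + 2 * (r + 1) = 2 * r + 1 + 1 + 1 := by ring
    have e2 : 1 + 2 * r = 2 * r + 1 := by ring
    have e3 : 0 + 2 * (r + 1) = 2 * r + 1 + 1 := by ring
    have e4 : 1 + (r + 1) = r + 1 + 1 := by ring
    have e5 : 1 + r = r + 1 := by ring
    simp only [shiftRight, shiftLeft, coeff, Nat.factorial_zero, zero_add, Nat.factorial_one, e1,
      e2, e3, e4, e5, fs, ps]
    have := pf r
    have := ff r
    have := ff (2 * r)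
    have : (4 * (r : ℝ) + 5) ≠ 0 := by positivity
    have : (4 * ((r : ℝ) + 1) + 5) ≠ 0 := by positivity
    push_cast
    field_simp
    ring
  | k + 2, 0 =>
    obtain rfl : r = k := by omega
    simp only [shiftRight, shiftLeft, coeff, Nat.factorial_zero, add_zero, mul_zero,
      show r + 2 = r + 1 + 1 from rfl, fs, ps]
    have := pf r
    have := pf 0
    have := ff r
    push_cast
    field_simp
    ring
  | k + 2, d + 1 =>
    obtain rfl : r = k + d + 1 := by omega
    have e1 : k + 2 + 2 * (d + 1) = k + 2 * d + 1 + 1 + 1 + 1 := by ring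
    have e2 : k + 2 + 2 * d = k + 2 * d + 1 + 1 := by ring
    have e3 : k + 1 + 2 * (d + 1) = k + 2 * d + 1 + 1 + 1 := by ring
    have e4 : k + 2 * (d + 1) = k + 2 * d + 1 + 1 := by ring
    have e5 : k + 2 + (d + 1) = k + d + 1 + 1 + 1 := by ring
    have e6 : k + 2 + d = k + d + 1 + 1 := by ring
    have e7 : k + 1 + (d + 1) = k + d + 1 + 1 := by ring
    have e8 : k + (d + 1) = k + d + 1 := by ring
    simp only [shiftRight, shiftLeft, coeff, e1, e2, e3, e4, e5, e6, e7, e8]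
    simp only [show k + 2 = k + 1 + 1 from rfl, fs, ps]
    have := pf (k + d)
    have := pf d
    have := ff k
    have := ff d
    have := ff (k + d)
    have := ff (k + 2 * d)
    have : (4 * (d : ℝ) + 5) ≠ 0 := by positivity
    push_cast
    field_simp
    ring

/-- The Padé numerator for the fourth root. -/
noncomputable def numer (A y : ℂ) (r : ℕ) : ℂ :=
  ∑ kd ∈ Finset.HasAntidiagonal.antidiagonal r, (coeff kd.1 kd.2 : ℂ) * y ^ kd.1 * A ^ kd.2

theorem sum_shiftRight (f : ℕ → ℕ → ℝ) (A y : ℂ) (r : ℕ) :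
    ∑ kd ∈ Finset.HasAntidiagonal.antidiagonal (r + 1), (shiftRight f kd.1 kd.2 : ℂ) * y ^ kd.1 * A ^ kd.2 =
      A * ∑ kd ∈ Finset.HasAntidiagonal.antidiagonal r, (f kd.1 kd.2 : ℂ) * y ^ kd.1 * A ^ kd.2 := by
  rw [Finset.Nat.sum_antidiagonal_succ', Finset.mul_sum]
  simp only [shiftRight, Complex.ofReal_zero, zero_mul, zero_add]
  refine Finset.sum_congr rfl fun kd _ => ?_
  ring

theorem sum_shiftLeft (f : ℕ → ℕ → ℝ) (A y : ℂ) (r : ℕ) :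
    ∑ kd ∈ Finset.HasAntidiagonal.antidiagonal (r + 1), (shiftLeft f kd.1 kd.2 : ℂ) * y ^ kd.1 * A ^ kd.2 =
      y * ∑ kd ∈ Finset.HasAntidiagonal.antidiagonal r, (f kd.1 kd.2 : ℂ) * y ^ kd.1 * A ^ kd.2 := by
  rw [Finset.Nat.sum_antidiagonal_succ, Finset.mul_sum]
  simp only [shiftLeft, Complex.ofReal_zero, zero_mul, zero_add]
  refine Finset.sum_congr rfl fun kd _ => ?_
  ring

theorem numer_recurrence (A y : ℂ) (r : ℕ) :
    ((r : ℂ) + 2) * numer A y (r + 2) =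
      (2 * r + 3) * (2 * A + 4 * y) * numer A y (r + 1)
        - (4 * r + 3) * (4 * r + 5) / (r + 1) * y ^ 2 * numer A y r := by
  have h1 := sum_shiftRight coeff A y (r + 1)
  have h2 := sum_shiftLeft coeff A y (r + 1)
  have h3 := sum_shiftLeft (shiftLeft coeff) A y (r + 1)
  rw [sum_shiftLeft coeff A y r] at h3
  have key : ((r : ℂ) + 2) * numer A y (r + 2) =
      (2 * r + 3) * (2 * ∑ kd ∈ Finset.HasAntidiagonal.antidiagonal (r + 1 + 1),
          (shiftRight coeff kd.1 kd.2 : ℂ) * y ^ kd.1 * A ^ kd.2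
        + 4 * ∑ kd ∈ Finset.HasAntidiagonal.antidiagonal (r + 1 + 1),
          (shiftLeft coeff kd.1 kd.2 : ℂ) * y ^ kd.1 * A ^ kd.2)
        - (4 * r + 3) * (4 * r + 5) / (r + 1) * ∑ kd ∈ Finset.HasAntidiagonal.antidiagonal (r + 1 + 1),
          (shiftLeft (shiftLeft coeff) kd.1 kd.2 : ℂ) * y ^ kd.1 * A ^ kd.2 := by
    simp only [numer, Finset.mul_sum, mul_add, ← Finset.sum_add_distrib, ← Finset.sum_sub_distrib]
    refine Finset.sum_congr rfl fun kd hkd => ?_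
    have h := congrArg (fun t : ℝ => (t : ℂ)) (coeff_recurrence r kd.1 kd.2
      (Finset.HasAntidiagonal.mem_antidiagonal.mp hkd))
    push_cast at h
    linear_combination (y ^ kd.1 * A ^ kd.2) * h
  rw [key, h1, h2, h3]
  simp only [numer]
  ring

theorem numer_zero (A y : ℂ) : numer A y 0 = 1 := by
  simp [numer, coeff, prodFive]

theorem numer_one (A y : ℂ) : numer A y 1 = 2 * A + 5 * y := by
  simp [numer, coeff, prodFive, Finset.Nat.antidiagonal_succ]

theorem factorial_dvd_two_pow_mul_prod (k d : ℕ) :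
    k.factorial ∣ 2 ^ k * ∏ i ∈ Finset.range k, (4 * (d + i) + 5) := by
  have h0 : k.factorial ≠ 0 := k.factorial_ne_zero
  have hodd : Nat.Coprime 2 (ordCompl[2] k.factorial) := Nat.coprime_ordCompl Nat.prime_two h0
  have hv : ordProj[2] k.factorial ∣ 2 ^ k := by
    refine pow_dvd_pow 2 ?_
    have := sub_one_mul_padicValNat_factorial (p := 2) k
    rw [← Nat.factorization_def _ Nat.prime_two] at this
    omega
  have hM : ordCompl[2] k.factorial ∣ ∏ i ∈ Finset.range k, (4 * (d + i) + 5) := by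
    set M := ordCompl[2] k.factorial with hMdef
    have h4 : Nat.Coprime 4 M := hodd.pow_left 2
    obtain ⟨b, hb⟩ : ∃ b : ZMod M, 4 * b = 1 := ⟨(4 : ZMod M)⁻¹, by
      exact_mod_cast ZMod.coe_mul_inv_eq_one 4 h4⟩
    have hM0 : NeZero M := ⟨(Nat.ordCompl_pos 2 h0).ne'⟩
    have hbv : ((b.val : ℕ) : ZMod M) = b := ZMod.natCast_zmod_val b
    have hasc : M ∣ ∏ i ∈ Finset.range k, (d + 5 * b.val + i) := by
      rw [← Nat.ascFactorial_eq_prod_range]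
      exact (Nat.ordCompl_dvd _ 2).trans (Nat.factorial_dvd_ascFactorial _ k)
    rw [← ZMod.natCast_eq_zero_iff] at hasc ⊢
    push_cast at hasc ⊢
    have : ∏ i ∈ Finset.range k, (4 * ((d : ZMod M) + i) + 5) =
        4 ^ k * ∏ i ∈ Finset.range k, ((d : ZMod M) + 5 * b + i) := by
      rw [← Finset.card_range k, ← Finset.prod_const, Finset.card_range, ← Finset.prod_mul_distrib]
      refine Finset.prod_congr rfl fun i _ => ?_
      linear_combination -5 * hb
    rw [this]
    simp only [hbv] at hasc
    rw [hasc, mul_zero]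
  conv_lhs => rw [← Nat.ordProj_mul_ordCompl_eq_self k.factorial 2]
  exact mul_dvd_mul hv hM

theorem prodFive_add (k d : ℕ) :
    prodFive (k + d) = prodFive d * ∏ i ∈ Finset.range k, (4 * (d + i) + 5) := by
  rw [prodFive, add_comm, Finset.prod_range_add, prodFive]

theorem coeff_eq (k d : ℕ) : coeff k d =
    (∏ i ∈ Finset.range k, (4 * (d + i) + 5) : ℕ) / k.factorial * (k + 2 * d).choose d := by
  have h := Nat.choose_mul_factorial_mul_factorial (show d ≤ k + 2 * d by omega)
  rw [show k + 2 * d - d = k + d by omega] at h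
  rw [coeff, ← h, prodFive_add]
  have pf : (prodFive d : ℝ) ≠ 0 := by exact_mod_cast (prodFive_pos d).ne'
  have ff : ∀ n : ℕ, (n.factorial : ℝ) ≠ 0 := fun n => by exact_mod_cast n.factorial_ne_zero
  have := ff k
  have := ff d
  have := ff (k + d)
  push_cast
  field_simp

theorem exists_two_pow_mul_coeff_eq (k d : ℕ) : ∃ n : ℕ, 2 ^ k * coeff k d = n := by
  obtain ⟨n, hn⟩ := factorial_dvd_two_pow_mul_prod k d
  refine ⟨n * (k + 2 * d).choose d, ?_⟩
  have ff : (k.factorial : ℝ) ≠ 0 := by exact_mod_cast k.factorial_ne_zero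
  rw [coeff_eq, ← mul_assoc, mul_div_assoc']
  have : (2 : ℝ) ^ k * (∏ i ∈ Finset.range k, (4 * (d + i) + 5) : ℕ) = k.factorial * n := by
    exact_mod_cast hn
  rw [this, mul_div_cancel_left₀ _ ff]
  push_cast
  ring

theorem exists_pow_mul_numer_eq {c l μ : ℤ} (h : l * c = 4 * μ) (X : ℤ) (r : ℕ) :
    ∃ G : GaussianInt, (GaussianInt.toComplex G) =
      (l : ℂ) ^ r * numer (X + c * Complex.I) (-(c / 2 * Complex.I)) r := by
  choose f hf using exists_two_pow_mul_coeff_eq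
  refine ⟨∑ kd ∈ Finset.HasAntidiagonal.antidiagonal r,
    (f kd.1 kd.2 : GaussianInt) * ⟨0, -μ⟩ ^ kd.1 * ⟨l * X, l * c⟩ ^ kd.2, ?_⟩
  rw [map_sum, numer, Finset.mul_sum]
  refine Finset.sum_congr rfl fun kd hkd => ?_
  have hr := Finset.HasAntidiagonal.mem_antidiagonal.mp hkd
  have h1 : GaussianInt.toComplex ⟨0, -μ⟩ = -(μ * Complex.I) := by
    simp [GaussianInt.toComplex_def']
  have h2 : GaussianInt.toComplex ⟨l * X, l * c⟩ = l * (X + c * Complex.I) := by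
    simp [GaussianInt.toComplex_def']
    ring
  have h3 : (l : ℂ) * c = 4 * μ := by exact_mod_cast h
  have h4 : (f kd.1 kd.2 : ℂ) = 2 ^ kd.1 * coeff kd.1 kd.2 := by
    rw [← Complex.ofReal_natCast, ← hf]
    push_cast
    ring
  have h5 : (l : ℂ) * (-(c / 2 * Complex.I)) = 2 * -(μ * Complex.I) := by
    linear_combination (-Complex.I / 2) * h3
  rw [map_mul, map_mul, map_pow, map_pow, map_natCast, h1, h2, h4, ← hr, pow_add, mul_pow]
  have h6 := congrArg (· ^ kd.1) h5
  simp only [mul_pow] at h6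
  linear_combination (-(coeff kd.1 kd.2 : ℂ) * (l : ℂ) ^ kd.2 * (X + c * Complex.I) ^ kd.2) * h6

end QuarticPade

namespace QuarticPade

theorem coeff_zero_left (d : ℕ) : coeff 0 d = d.centralBinom := by
  simp [coeff_eq, Nat.centralBinom]

theorem two_mul_coeff_one_left (d : ℕ) :
    2 * coeff 1 d = (4 * d + 5) * (d + 1).centralBinom := by
  have h : (d + 1).centralBinom = 2 * (1 + 2 * d).choose d := by
    rw [Nat.centralBinom, show 2 * (d + 1) = (2 * d + 1) + 1 by ring, Nat.choose_succ_succ,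
      Nat.choose_symm_half, add_comm 1]
    ring
  rw [h, coeff_eq]
  simp
  ring

theorem exists_pow_eq_add_mul (X c : ℤ) (n : ℕ) : ∃ H : GaussianInt,
    (⟨X, c⟩ : GaussianInt) ^ n = X ^ n + c * H := by
  induction n with
  | zero => exact ⟨0, by simp⟩
  | succ n ih =>
    obtain ⟨H, hH⟩ := ih
    have h : (⟨X, c⟩ : GaussianInt) = X + c * ⟨0, 1⟩ := by ext <;> simp
    refine ⟨H * X + (X ^ n + c * H) * ⟨0, 1⟩, ?_⟩
    rw [pow_succ, hH, h]
    ring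

theorem exists_pow_succ_eq_add_sq_mul (X c : ℤ) (n : ℕ) : ∃ H : GaussianInt,
    (⟨X, c⟩ : GaussianInt) ^ (n + 1) =
      X ^ (n + 1) + (n + 1) * X ^ n * c * ⟨0, 1⟩ + c ^ 2 * H := by
  have h : (⟨X, c⟩ : GaussianInt) = X + c * ⟨0, 1⟩ := by ext <;> simp
  induction n with
  | zero => exact ⟨0, by rw [zero_add, pow_one, h]; push_cast; ring⟩
  | succ n ih =>
    obtain ⟨H, hH⟩ := ih
    refine ⟨H * (X + c * ⟨0, 1⟩) + (n + 1) * X ^ n * ⟨0, 1⟩ ^ 2, ?_⟩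
    rw [pow_succ, hH, h]
    push_cast
    ring

theorem exists_pow_mul_numer_eq_add (c X : ℤ) (r : ℕ) :
    ∃ H : GaussianInt, (GaussianInt.toComplex
        (4 ^ r * (r + 1).centralBinom * ⟨4 * X ^ (r + 1), -c * X ^ r⟩ + c ^ 2 * H)) =
      4 ^ (r + 1) * numer (X + c * Complex.I) (-(c / 2 * Complex.I)) (r + 1) := by
  choose f hf using exists_two_pow_mul_coeff_eq
  have hf0 : f 0 (r + 1) = (r + 1).centralBinom := by
    have := hf 0 (r + 1)
    rw [coeff_zero_left, pow_zero, one_mul] at this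
    exact_mod_cast this.symm
  have hf1 : f 1 r = (4 * r + 5) * (r + 1).centralBinom := by
    have := hf 1 r
    rw [pow_one, two_mul_coeff_one_left] at this
    exact_mod_cast this.symm
  set g : ℕ × ℕ → GaussianInt :=
    fun kd => (f kd.1 kd.2 : GaussianInt) * ⟨0, -c⟩ ^ kd.1 * (4 * ⟨X, c⟩) ^ kd.2 with hg
  have hsum : GaussianInt.toComplex (∑ kd ∈ Finset.HasAntidiagonal.antidiagonal (r + 1), g kd) =
      4 ^ (r + 1) * numer (X + c * Complex.I) (-(c / 2 * Complex.I)) (r + 1) := by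
    rw [map_sum, numer, Finset.mul_sum]
    refine Finset.sum_congr rfl fun kd hkd => ?_
    have hr := Finset.HasAntidiagonal.mem_antidiagonal.mp hkd
    have h1 : GaussianInt.toComplex ⟨0, -c⟩ = -(c * Complex.I) := by
      simp [GaussianInt.toComplex_def']
    have h2 : GaussianInt.toComplex (4 * ⟨X, c⟩) = 4 * (X + c * Complex.I) := by
      rw [map_mul, map_ofNat]
      simp [GaussianInt.toComplex_def']
    have h4 : (f kd.1 kd.2 : ℂ) = 2 ^ kd.1 * coeff kd.1 kd.2 := by
      rw [← Complex.ofReal_natCast, ← hf]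
      push_cast
      ring
    have h5 : (4 : ℂ) * (-(c / 2 * Complex.I)) = 2 * -(c * Complex.I) := by ring
    rw [hg, map_mul, map_mul, map_pow, map_pow, map_natCast, h1, h2, h4, ← hr, pow_add, mul_pow]
    have h6 := congrArg (· ^ kd.1) h5
    simp only [mul_pow] at h6
    linear_combination (-(coeff kd.1 kd.2 : ℂ) * 4 ^ kd.2 * (X + c * Complex.I) ^ kd.2) * h6
  have htail : ∃ H, ∑ kd ∈ Finset.HasAntidiagonal.antidiagonal r, g (kd.1 + 1, kd.2) =
      g (1, r) + c ^ 2 * H := by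
    cases r with
    | zero => exact ⟨0, by simp⟩
    | succ r =>
      refine ⟨∑ kd ∈ Finset.HasAntidiagonal.antidiagonal r,
        (f (kd.1 + 2) kd.2 : GaussianInt) * (⟨0, -c⟩ ^ kd.1 * ⟨-1, 0⟩) * (4 * ⟨X, c⟩) ^ kd.2, ?_⟩
      rw [Finset.Nat.sum_antidiagonal_succ, Finset.mul_sum]
      simp only [zero_add]
      congr 1
      refine Finset.sum_congr rfl fun kd _ => ?_
      have h : (⟨0, -c⟩ : GaussianInt) ^ 2 = c ^ 2 * ⟨-1, 0⟩ := by ext <;> simp [sq]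
      simp only [hg]
      rw [show kd.1 + 1 + 1 = kd.1 + 2 from rfl, pow_add, h]
      ring
  obtain ⟨H₁, hH₁⟩ := htail
  obtain ⟨H₂, hH₂⟩ := exists_pow_succ_eq_add_sq_mul X c r
  obtain ⟨H₃, hH₃⟩ := exists_pow_eq_add_mul X c r
  refine ⟨H₁ + 4 ^ (r + 1) * (r + 1).centralBinom * H₂
    - 4 ^ r * ((4 * r + 5) * (r + 1).centralBinom) * ⟨0, 1⟩ * H₃, ?_⟩
  rw [← hsum, Finset.Nat.sum_antidiagonal_succ, hH₁]
  congr 1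
  have h1 : (⟨0, -c⟩ : GaussianInt) = -c * ⟨0, 1⟩ := by ext <;> simp
  have h2 : (⟨4 * X ^ (r + 1), -c * X ^ r⟩ : GaussianInt) =
      4 * X ^ (r + 1) - c * X ^ r * ⟨0, 1⟩ := by
    have h (u v : ℤ) : (⟨4 * u, -c * v⟩ : GaussianInt) = 4 * u - c * v * ⟨0, 1⟩ := by
      ext <;> simp
    rw [h]
    push_cast
    rfl
  simp only [hg, hf0, hf1, pow_zero, pow_one, mul_pow, hH₂, hH₃, h1, h2]
  push_cast
  ring

end QuarticPade

namespace QuarticPade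

section Integral

variable {B ψ : ℝ}

noncomputable def kernelFun (B ψ φ : ℝ) : ℝ := 2 * (B * Real.cos φ - B * Real.cos ψ)

noncomputable def moment (B ψ : ℝ) (r : ℕ) : ℝ :=
  ∫ φ in (0 : ℝ)..ψ, kernelFun B ψ φ ^ r * Real.cos (φ / 4)

theorem continuous_kernelFun : Continuous (kernelFun B ψ) := by
  unfold kernelFun
  fun_prop

theorem hasDerivAt_kernelFun (φ : ℝ) :
    HasDerivAt (kernelFun B ψ) (-(2 * B * Real.sin φ)) φ := by
  have := (((Real.hasDerivAt_cos φ).const_mul B).sub_const (B * Real.cos ψ)).const_mul 2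
  exact this.congr_deriv (by ring)

theorem intervalIntegrable_moment (r : ℕ) :
    IntervalIntegrable (fun φ => kernelFun B ψ φ ^ r * Real.cos (φ / 4))
      MeasureTheory.volume 0 ψ := by
  have := continuous_kernelFun (B := B) (ψ := ψ)
  exact Continuous.intervalIntegrable (by fun_prop) _ _

theorem moment_zero : moment B ψ 0 = 4 * Real.sin (ψ / 4) := by
  have h : ∀ φ ∈ Set.uIcc 0 ψ, HasDerivAt (fun φ => 4 * Real.sin (φ / 4))
      (kernelFun B ψ φ ^ 0 * Real.cos (φ / 4)) φ := fun φ _ => by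
    have := ((Real.hasDerivAt_sin (φ / 4)).comp φ ((hasDerivAt_id φ).div_const 4)).const_mul 4
    exact this.congr_deriv (by simp; ring)
  rw [moment, intervalIntegral.integral_eq_sub_of_hasDerivAt h (intervalIntegrable_moment 0)]
  simp

theorem hasDerivAt_cos_div (φ : ℝ) :
    HasDerivAt (fun φ => Real.cos (φ / 4)) (-Real.sin (φ / 4) / 4) φ := by
  have := (Real.hasDerivAt_cos (φ / 4)).comp φ ((hasDerivAt_id φ).div_const 4)
  exact this.congr_deriv (by ring)

theorem hasDerivAt_sin_div (φ : ℝ) :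
    HasDerivAt (fun φ => Real.sin (φ / 4)) (Real.cos (φ / 4) / 4) φ := by
  have := (Real.hasDerivAt_sin (φ / 4)).comp φ ((hasDerivAt_id φ).div_const 4)
  exact this.congr_deriv (by ring)

theorem hasDerivAt_primitive (r : ℕ) (φ : ℝ) :
    HasDerivAt (fun φ => kernelFun B ψ φ ^ (r + 1) * (-(2 * B * Real.sin φ)) * Real.cos (φ / 4)
        + kernelFun B ψ φ ^ (r + 2) * Real.sin (φ / 4) / (4 * (r + 2)))
      (4 * (B * Real.sin ψ) ^ 2 * (r + 1) * (kernelFun B ψ φ ^ r * Real.cos (φ / 4))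
        - (4 * r + 6) * (B * Real.cos ψ) * (kernelFun B ψ φ ^ (r + 1) * Real.cos (φ / 4))
        - ((r + 2) - 1 / (16 * (r + 2))) * (kernelFun B ψ φ ^ (r + 2) * Real.cos (φ / 4))) φ := by
  have hf := hasDerivAt_kernelFun (B := B) (ψ := ψ) φ
  have hs := ((Real.hasDerivAt_sin φ).const_mul (2 * B)).neg
  have h := (((hf.pow (r + 1)).mul hs).mul (hasDerivAt_cos_div φ)).add
    (((hf.pow (r + 2)).mul (hasDerivAt_sin_div φ)).div_const (4 * (r + 2)))
  refine h.congr_deriv ?_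
  have e1 := Real.sin_sq_add_cos_sq φ
  have e2 := Real.sin_sq_add_cos_sq ψ
  have hk : B * Real.cos φ = kernelFun B ψ φ / 2 + B * Real.cos ψ := by
    rw [kernelFun]; ring
  have hs2 : (2 * B * Real.sin φ) ^ 2 = 4 * (B * Real.sin ψ) ^ 2
      - 4 * (B * Real.cos ψ) * kernelFun B ψ φ - kernelFun B ψ φ ^ 2 := by
    rw [kernelFun]
    linear_combination 4 * B ^ 2 * (e1 - e2)
  simp only [Nat.add_sub_cancel, show r + 2 - 1 = r + 1 from rfl, Pi.pow_apply, Pi.neg_apply, Pi.mul_apply]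
  have hr : (r : ℝ) + 2 ≠ 0 := by positivity
  generalize kernelFun B ψ φ = f at *
  generalize B * Real.cos ψ = X at *
  generalize B * Real.sin ψ = c at *
  generalize Real.cos (φ / 4) = C
  generalize Real.sin (φ / 4) = S
  generalize Real.sin φ = s at *
  generalize Real.cos φ = t at *
  push_cast
  have hlin : (r + 1) * f ^ r * (-(2 * B * s)) * (-(2 * B * s)) = (r + 1) * f ^ r * (4 * c ^ 2 - 4 * X * f - f ^ 2) := by
    rw [← hs2]; ring
  have hk' : 2 * B * t = f + 2 * X := by linear_combination 2 * hk
  rw [hlin, show -(2 * B * t) = -(f + 2 * X) by rw [hk']]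
  field_simp
  ring

theorem moment_recurrence (r : ℕ) :
    4 * (B * Real.sin ψ) ^ 2 * (r + 1) * moment B ψ r
        - (4 * r + 6) * (B * Real.cos ψ) * moment B ψ (r + 1)
        - ((r + 2) - 1 / (16 * (r + 2))) * moment B ψ (r + 2) = 0 := by
  have i0 := intervalIntegrable_moment (B := B) (ψ := ψ) r
  have i1 := intervalIntegrable_moment (B := B) (ψ := ψ) (r + 1)
  have i2 := intervalIntegrable_moment (B := B) (ψ := ψ) (r + 2)
  have h := intervalIntegral.integral_eq_sub_of_hasDerivAt (a := 0) (b := ψ)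
    (fun φ _ => hasDerivAt_primitive (B := B) (ψ := ψ) r φ)
    (((i0.const_mul _).sub (i1.const_mul _)).sub (i2.const_mul _))
  rw [intervalIntegral.integral_sub ((i0.const_mul _).sub (i1.const_mul _)) (i2.const_mul _),
    intervalIntegral.integral_sub (i0.const_mul _) (i1.const_mul _),
    intervalIntegral.integral_const_mul, intervalIntegral.integral_const_mul,
    intervalIntegral.integral_const_mul] at h
  simp only [moment]
  rw [h]
  simp [kernelFun]

theorem moment_one :
    15 / 16 * moment B ψ 1 =
      2 * (B * Real.sin ψ) * Real.cos (ψ / 4) - 2 * (B * Real.cos ψ) * moment B ψ 0 := by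
  have i0 := intervalIntegrable_moment (B := B) (ψ := ψ) 0
  have i1 := intervalIntegrable_moment (B := B) (ψ := ψ) 1
  have hd (φ : ℝ) : HasDerivAt (fun φ => -(2 * B * Real.sin φ) * Real.cos (φ / 4)
        + kernelFun B ψ φ * Real.sin (φ / 4) / 4)
      (-(2 * (B * Real.cos ψ)) * (kernelFun B ψ φ ^ 0 * Real.cos (φ / 4))
        - 15 / 16 * (kernelFun B ψ φ ^ 1 * Real.cos (φ / 4))) φ := by
    have hs := ((Real.hasDerivAt_sin φ).const_mul (2 * B)).neg
    have h := (hs.mul (hasDerivAt_cos_div φ)).add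
      (((hasDerivAt_kernelFun (B := B) (ψ := ψ) φ).mul (hasDerivAt_sin_div φ)).div_const 4)
    refine h.congr_deriv ?_
    simp only [Pi.neg_apply, kernelFun]
    ring
  have h := intervalIntegral.integral_eq_sub_of_hasDerivAt (a := 0) (b := ψ)
    (fun φ _ => hd φ) ((i0.const_mul _).sub (i1.const_mul _))
  rw [intervalIntegral.integral_sub (i0.const_mul _) (i1.const_mul _),
    intervalIntegral.integral_const_mul, intervalIntegral.integral_const_mul] at h
  simp only [Real.sin_zero, zero_div, mul_zero, neg_zero, zero_mul, add_zero, sub_zero] at h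
  have hk : kernelFun B ψ ψ = 0 := by simp [kernelFun]
  rw [hk] at h
  simp only [moment]
  linear_combination -h

theorem abs_moment_le (hB : 0 ≤ B) (hψ : 0 ≤ ψ) (hψ' : ψ ≤ Real.pi) (r : ℕ) :
    |moment B ψ r| ≤ ψ * (2 * (B - B * Real.cos ψ)) ^ r := by
  have h := intervalIntegral.norm_integral_le_of_norm_le_const (a := 0) (b := ψ)
    (f := fun φ => kernelFun B ψ φ ^ r * Real.cos (φ / 4))
    (C := (2 * (B - B * Real.cos ψ)) ^ r) fun φ hφ => by
      rw [Set.uIoc_of_le hψ] at hφ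
      have h1 : Real.cos ψ ≤ Real.cos φ := Real.cos_le_cos_of_nonneg_of_le_pi hφ.1.le hψ' hφ.2
      have h2 := Real.cos_le_one φ
      have h3 : 0 ≤ kernelFun B ψ φ := by
        rw [kernelFun]
        nlinarith [mul_le_mul_of_nonneg_left h1 hB]
      have h4 : kernelFun B ψ φ ≤ 2 * (B - B * Real.cos ψ) := by
        rw [kernelFun]
        nlinarith [mul_le_mul_of_nonneg_left h2 hB]
      rw [norm_mul, Real.norm_eq_abs, Real.norm_eq_abs, abs_of_nonneg (pow_nonneg h3 r)]
      calc kernelFun B ψ φ ^ r * |Real.cos (φ / 4)| ≤ kernelFun B ψ φ ^ r * 1 :=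
            mul_le_mul_of_nonneg_left (Real.abs_cos_le_one _) (pow_nonneg h3 r)
        _ ≤ _ := by
            rw [mul_one]
            exact pow_le_pow_left₀ h3 h4 r
  rw [sub_zero, abs_of_nonneg hψ, Real.norm_eq_abs, mul_comm] at h
  exact h

/-- Any real solution of the numerator recurrence starting like
`Im (exp (i ψ / 4) * numer r)` is small. -/
theorem abs_le_of_recurrence (hB : 0 ≤ B) (hψ : 0 ≤ ψ) (hψ' : ψ ≤ Real.pi) {u : ℕ → ℝ}
    (h0 : u 0 = Real.sin (ψ / 4))
    (h1 : u 1 = 2 * (B * Real.cos ψ) * Real.sin (ψ / 4) - B * Real.sin ψ / 2 * Real.cos (ψ / 4))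
    (hrec : ∀ r : ℕ, (r + 2) * u (r + 2) = (4 * r + 6) * (B * Real.cos ψ) * u (r + 1)
      + (4 * r + 3) * (4 * r + 5) / (4 * (r + 1)) * (B * Real.sin ψ) ^ 2 * u r) (r : ℕ) :
    |u r| ≤ ψ / 4 * (2 * (B - B * Real.cos ψ)) ^ r := by
  obtain ⟨m, hm0, hm⟩ : ∃ m : ℕ → ℝ, m 0 = 4 ∧
      ∀ r, m (r + 1) = m r * ((r + 1) ^ 2 / ((r + 1) ^ 2 - 1 / 16)) :=
    ⟨fun r => 4 * ∏ i ∈ Finset.range r, (((i : ℝ) + 1) ^ 2 / ((i + 1) ^ 2 - 1 / 16)), by simp,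
      fun r => by
        beta_reduce
        rw [Finset.prod_range_succ, mul_assoc]⟩
  have hpos (r : ℕ) : 0 < ((r : ℝ) + 1) ^ 2 - 1 / 16 := by
    have : (0 : ℝ) ≤ r := r.cast_nonneg
    nlinarith
  have hm4 (r : ℕ) : 4 ≤ m r := by
    induction r with
    | zero => exact hm0.ge
    | succ r ih =>
      rw [hm]
      have : 1 ≤ ((r : ℝ) + 1) ^ 2 / ((r + 1) ^ 2 - 1 / 16) := by
        rw [le_div_iff₀ (hpos r)]
        linarith
      nlinarith
  have key (r : ℕ) : moment B ψ r = (-1) ^ r * m r * u r ∧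
      moment B ψ (r + 1) = (-1) ^ (r + 1) * m (r + 1) * u (r + 1) := by
    induction r with
    | zero =>
      have e0 := moment_zero (B := B) (ψ := ψ)
      refine ⟨by rw [e0, hm0, h0]; ring, ?_⟩
      have e1 := moment_one (B := B) (ψ := ψ)
      have := hm 0
      rw [hm0] at this
      norm_num at this
      rw [zero_add, this, h1]
      rw [e0] at e1
      linear_combination 16 / 15 * e1
    | succ r ih =>
      refine ⟨ih.2, ?_⟩
      have e := moment_recurrence (B := B) (ψ := ψ) r
      have hr := hrec r
      have p1 := hpos r
      have p2 := hpos (r + 1)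
      have m1 := hm r
      have m2 := hm (r + 1)
      rw [ih.1, ih.2] at e
      rw [show r + 1 + 1 = r + 2 from rfl] at m2 ⊢
      push_cast at p2 m2
      have q : (0 : ℝ) < r + 1 := by positivity
      have q' : (0 : ℝ) < r + 2 := by positivity
      have m1' : m r * (r + 1) ^ 2 = m (r + 1) * (((r : ℝ) + 1) ^ 2 - 1 / 16) := by
        rw [m1, mul_div_assoc', div_mul_cancel₀ _ p1.ne']
      rw [show (r : ℝ) + 1 + 1 = r + 2 by ring] at p2 m2
      rw [m2, mul_div_assoc', mul_div_assoc', div_mul_eq_mul_div, eq_div_iff p2.ne']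
      have e' : ((r : ℝ) + 2 - 1 / (16 * (r + 2))) = ((r + 2) ^ 2 - 1 / 16) / (r + 2) := by
        field_simp
        try ring
      have c' : (4 * (r : ℝ) + 3) * (4 * r + 5) / (4 * (r + 1)) =
          4 * (((r : ℝ) + 1) ^ 2 - 1 / 16) / (r + 1) := by
        field_simp
        ring
      have m1'' : m (r + 1) * (((r : ℝ) + 1) ^ 2 - 1 / 16) / (r + 1) = m r * (r + 1) := by
        rw [← m1']
        field_simp
      rw [e', sub_eq_zero, eq_comm, div_mul_eq_mul_div, div_eq_iff q'.ne'] at e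
      rw [c'] at hr
      generalize m (r + 1) = M at *
      generalize moment B ψ (r + 2) = J at *
      generalize B * Real.cos ψ = X at *
      generalize B * Real.sin ψ = c at *
      generalize u (r + 2) = u2 at *
      generalize u (r + 1) = u1 at *
      generalize u r = u0 at *
      linear_combination e - (-1) ^ r * M * (r + 2) * hr +
        (-1) ^ r * (r + 2) * 4 * c ^ 2 * u0 * (-m1'')
  have h := abs_moment_le hB hψ hψ' r
  rw [(key r).1, abs_mul, abs_mul, abs_pow, abs_neg, abs_one, one_pow, one_mul,
    abs_of_pos (by linarith [hm4 r])] at h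
  have := mul_le_mul_of_nonneg_right (hm4 r) (abs_nonneg (u r))
  linarith

end Integral

end QuarticPade

namespace QuarticPade

/-- The Padé numerator attached to the Gaussian number `X + c i`. -/
noncomputable def pade (X c : ℝ) (r : ℕ) : ℂ := numer (X + c * Complex.I) (-(c / 2 * Complex.I)) r

variable {X c : ℝ}

theorem pade_zero : pade X c 0 = 1 := numer_zero _ _

theorem pade_one : pade X c 1 = ⟨2 * X, -(c / 2)⟩ := by
  rw [pade, numer_one]
  apply Complex.ext <;> simp
  ring

theorem pade_recurrence (r : ℕ) :
    ((r : ℝ) + 2 : ℝ) * pade X c (r + 2) = ((4 * r + 6) * X : ℝ) * pade X c (r + 1)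
      + ((4 * r + 3) * (4 * r + 5) / (4 * (r + 1)) * c ^ 2 : ℝ) * pade X c r := by
  have h := numer_recurrence (X + c * Complex.I) (-(c / 2 * Complex.I)) r
  simp only [pade]
  have hr : (r : ℂ) + 1 ≠ 0 := by exact_mod_cast r.succ_ne_zero
  push_cast
  rw [h, neg_sq, mul_pow, Complex.I_sq]
  field_simp
  ring

theorem norm_pade_le {ρ : ℝ} (hX : 0 ≤ X) (hX' : 2 * X ≤ ρ) (h : ρ ^ 2 = 4 * X * ρ + 4 * c ^ 2)
    (r : ℕ) : ‖pade X c r‖ ≤ ρ ^ r := by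
  have hρ : 0 ≤ ρ := by linarith
  suffices ‖pade X c r‖ ≤ ρ ^ r ∧ ‖pade X c (r + 1)‖ ≤ ρ ^ (r + 1) from this.1
  induction r with
  | zero =>
    refine ⟨by simp [pade_zero], ?_⟩
    rw [zero_add, pade_one, pow_one]
    refine abs_le_of_sq_le_sq' ?_ hρ |>.2
    rw [Complex.sq_norm, Complex.normSq_mk, h]
    nlinarith [sq_nonneg c, mul_le_mul_of_nonneg_left hX' hX]
  | succ r ih =>
    refine ⟨ih.2, ?_⟩
    have hr : (0 : ℝ) ≤ r := r.cast_nonneg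
    have h1 := norm_add_le (((4 * r + 6) * X : ℝ) * pade X c (r + 1))
      (((4 * r + 3) * (4 * r + 5) / (4 * (r + 1)) * c ^ 2 : ℝ) * pade X c r)
    rw [← pade_recurrence, norm_mul, norm_mul, norm_mul, Complex.norm_real, Complex.norm_real,
      Complex.norm_real, Real.norm_of_nonneg (by positivity), Real.norm_of_nonneg (by positivity),
      Real.norm_of_nonneg (by positivity)] at h1
    have h2 : (4 * (r : ℝ) + 3) * (4 * r + 5) / (4 * (r + 1)) ≤ 4 * (r + 2) := by
      rw [div_le_iff₀ (by positivity)]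
      nlinarith
    have h3 : ((r : ℝ) + 2) * ‖pade X c (r + 2)‖ ≤ (r + 2) * ρ ^ (r + 2) := by
      calc ((r : ℝ) + 2) * ‖pade X c (r + 2)‖
          ≤ (4 * r + 6) * X * ‖pade X c (r + 1)‖
            + (4 * r + 3) * (4 * r + 5) / (4 * (r + 1)) * c ^ 2 * ‖pade X c r‖ := h1
        _ ≤ 4 * (r + 2) * X * ρ ^ (r + 1) + 4 * (r + 2) * c ^ 2 * ρ ^ r := by
          gcongr
          · linarith
          · exact ih.2
          · exact ih.1
        _ = (r + 2) * ρ ^ (r + 2) := by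
          rw [pow_add ρ r 2, h]
          ring
    exact le_of_mul_le_mul_left h3 (by positivity)

/-- The product of a Gaussian number of argument `(ψ₁ - ψ₂) / 4` with a Padé numerator has small
imaginary part. -/
theorem abs_im_mul_pade_le {B ψ₁ ψ₂ ρ g : ℝ} {x : ℂ} (hB : 0 ≤ B) (hψ : 0 ≤ ψ₁)
    (hψ' : ψ₁ ≤ Real.pi) (hX : X = B * Real.cos ψ₁) (hc : c = B * Real.sin ψ₁) (hX0 : 0 ≤ X)
    (hρ : ρ = 2 * (B + X)) (hg : g = 2 * (B - X))
    (hx : x = ‖x‖ * Complex.exp (((ψ₁ - ψ₂) / 4 : ℝ) * Complex.I)) (r : ℕ) :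
    |(x * pade X c r).im| ≤ ‖x‖ * (ψ₁ / 4 * g ^ r + |ψ₂| / 4 * ρ ^ r) := by
  set u : ℕ → ℝ := fun r => (Complex.exp ((ψ₁ / 4 : ℝ) * Complex.I) * pade X c r).im with hu
  have hexp : Complex.exp ((ψ₁ / 4 : ℝ) * Complex.I) =
      ⟨Real.cos (ψ₁ / 4), Real.sin (ψ₁ / 4)⟩ := by
    rw [Complex.exp_ofReal_mul_I]
    apply Complex.ext <;> simp [-Complex.ofReal_div, -Complex.ofReal_cos, -Complex.ofReal_sin]
  have hur : |u r| ≤ ψ₁ / 4 * g ^ r := by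
    rw [hg, hX]
    refine abs_le_of_recurrence hB hψ hψ' ?_ ?_ (fun r => ?_) r
    · simp only [hu, pade_zero, mul_one, hexp]
    · simp only [hu, pade_one, hexp, Complex.mul_im, ← hX, ← hc]
      ring
    · have h := congrArg (fun z => (Complex.exp ((ψ₁ / 4 : ℝ) * Complex.I) * z).im)
        (pade_recurrence (X := X) (c := c) r)
      rw [mul_add] at h
      simp only [mul_left_comm _ (Complex.ofReal _), Complex.add_im,
        Complex.im_ofReal_mul] at h
      rw [← hX, ← hc]
      exact h
  have hρ2 : ρ ^ 2 = 4 * X * ρ + 4 * c ^ 2 := by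
    have := Real.sin_sq_add_cos_sq ψ₁
    rw [hρ, hX, hc]
    linear_combination -4 * B ^ 2 * this
  have hnorm := norm_pade_le hX0 (by linarith) hρ2 r
  set w := Complex.exp ((ψ₁ / 4 : ℝ) * Complex.I) * pade X c r with hw
  have hwn : ‖w‖ ≤ ρ ^ r := by
    rw [hw, norm_mul, Complex.norm_exp_ofReal_mul_I, one_mul]
    exact hnorm
  have hK : (x * pade X c r).im =
      ‖x‖ * (Real.cos (ψ₂ / 4) * u r - Real.sin (ψ₂ / 4) * w.re) := by
    have e : x * pade X c r = (‖x‖ : ℝ) * (Complex.exp ((-(ψ₂ / 4) : ℝ) * Complex.I) * w) := by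
      rw [hw, ← mul_assoc (Complex.exp _), ← Complex.exp_add]
      conv_lhs => rw [hx]
      rw [mul_assoc]
      congr 3
      push_cast
      ring_nf
    have hexp2 : Complex.exp ((-(ψ₂ / 4) : ℝ) * Complex.I) =
        ⟨Real.cos (ψ₂ / 4), -Real.sin (ψ₂ / 4)⟩ := by
      rw [Complex.exp_ofReal_mul_I, Real.cos_neg, Real.sin_neg]
      apply Complex.ext <;> simp [-Complex.ofReal_div, -Complex.ofReal_cos, -Complex.ofReal_sin]
    rw [e, Complex.im_ofReal_mul, hexp2, Complex.mul_im]
    simp only [hu, hw]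
    ring
  rw [hK, abs_mul, abs_of_nonneg (norm_nonneg x)]
  refine mul_le_mul_of_nonneg_left ?_ (norm_nonneg x)
  calc |Real.cos (ψ₂ / 4) * u r - Real.sin (ψ₂ / 4) * w.re|
      ≤ |Real.cos (ψ₂ / 4) * u r| + |Real.sin (ψ₂ / 4) * w.re| := abs_sub _ _
    _ ≤ 1 * (ψ₁ / 4 * g ^ r) + |ψ₂| / 4 * ρ ^ r := by
      rw [abs_mul, abs_mul]
      gcongr
      · exact Real.abs_cos_le_one _
      · refine Real.abs_sin_le_abs.trans ?_
        rw [abs_div, abs_of_pos (four_pos : (0 : ℝ) < 4)]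
      · exact (Complex.abs_re_le_norm w).trans hwn
    _ = _ := by rw [one_mul]

end QuarticPade

theorem Complex.eq_or_eq_of_pow_four_eq {x y : ℂ} (h : x ^ 4 = y ^ 4) :
    x = y ∨ x = -y ∨ Complex.I * x = y ∨ -Complex.I * x = y := by
  have : (x - y) * ((x + y) * ((Complex.I * x - y) * (-Complex.I * x - y))) = 0 := by
    linear_combination h + (-x ^ 4 + x ^ 2 * y ^ 2) * Complex.I_sq
  rcases mul_eq_zero.mp this with h | h
  · exact Or.inl (sub_eq_zero.mp h)
  rcases mul_eq_zero.mp h with h | h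
  · exact Or.inr (Or.inl (eq_neg_of_add_eq_zero_left h))
  rcases mul_eq_zero.mp h with h | h
  · exact Or.inr (Or.inr (Or.inl (sub_eq_zero.mp h)))
  · exact Or.inr (Or.inr (Or.inr (sub_eq_zero.mp h)))

theorem Complex.arg_mem_Icc_of_pos {X c : ℝ} (hX : 0 < X) (hc : 0 < c) :
    0 < Complex.arg ⟨X, c⟩ ∧ Complex.arg ⟨X, c⟩ < Real.pi / 2 ∧ Complex.arg ⟨X, c⟩ ≤ c / X := by
  have h1 : Complex.arg ⟨X, c⟩ < Real.pi / 2 :=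
    (abs_lt.mp (Complex.abs_arg_lt_pi_div_two_iff.mpr (Or.inl hX))).2
  have h0 : 0 < Complex.arg ⟨X, c⟩ := by
    have h := Complex.arg_nonneg_iff (z := ⟨X, c⟩) |>.mpr hc.le
    refine h.lt_of_ne fun h0 => ?_
    have := Complex.arg_eq_zero_iff.mp h0.symm
    exact hc.ne' this.2
  refine ⟨h0, h1, ?_⟩
  have := Real.lt_tan h0 h1
  rw [Complex.tan_arg] at this
  exact this.le

/-- Multiplying by a power of `i` and possibly by `1 + i` we may control the argument of the
Gaussian integer linking two solutions. -/
theorem FourthPowerLinked.exists_normalized {N c X₁ Y₁ X₂ Y₂ : ℤ}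
    (h : FourthPowerLinked N c X₁ Y₁ X₂ Y₂) (hN : 0 < N) :
    ∃ (z : GaussianInt) (e σ : ℤ), (e = 1 ∨ e = 4) ∧ (σ = 1 ∨ σ = -1) ∧
      N * z ^ 4 = e * ⟨X₁, c⟩ * ⟨X₂, σ * c⟩ ∧ z.norm ^ 2 = e * (Y₁ * Y₂) ^ 2 ∧
      GaussianInt.toComplex z = ‖GaussianInt.toComplex z‖ *
        Complex.exp ((((Complex.arg ⟨X₁, c⟩ - (-σ) * Complex.arg ⟨X₂, c⟩) / 4 : ℝ)) * Complex.I) := by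
  obtain ⟨X, s, x, hX, hs, hnorm, hx⟩ := h
  obtain ⟨y, e, σ, he, hσ, hy, hny⟩ : ∃ (y : GaussianInt) (e σ : ℤ), (e = 1 ∨ e = 4) ∧
      (σ = 1 ∨ σ = -1) ∧ N * y ^ 4 = e * ⟨X₁, c⟩ * ⟨X₂, σ * c⟩ ∧
      y.norm ^ 2 = e * (Y₁ * Y₂) ^ 2 := by
    obtain ⟨σ, t, hσ, ht, hσt⟩ : ∃ σ t : ℤ, (σ = 1 ∨ σ = -1) ∧ (t = 1 ∨ t = -1) ∧
        (⟨X₁, c⟩ * ⟨X₂, σ * c⟩ : GaussianInt) = t * N * x ^ 4 := by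
      rcases hX with rfl | rfl
      · exact ⟨-1, s, Or.inr rfl, hs, by rw [← hx, neg_one_mul]⟩
      · refine ⟨1, -s, Or.inl rfl, by omega, ?_⟩
        have : (⟨X₂, 1 * c⟩ : GaussianInt) = -⟨-X₂, -c⟩ := by ext <;> simp
        rw [this]
        push_cast
        linear_combination -hx
    rcases ht with rfl | rfl
    · refine ⟨x, 1, σ, Or.inl rfl, hσ, ?_, by rw [hnorm, one_mul]⟩
      push_cast at hσt ⊢
      linear_combination -hσt
    · refine ⟨⟨1, 1⟩ * x, 4, σ, Or.inr rfl, hσ, ?_, ?_⟩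
      · have : (⟨1, 1⟩ : GaussianInt) ^ 4 = -4 := by decide
        push_cast at hσt ⊢
        rw [mul_pow, this]
        linear_combination -4 * hσt
      · rw [Zsqrtd.norm_mul, hnorm]
        simp [Zsqrtd.norm_def]
        ring
  set ψ₁ := Complex.arg ⟨X₁, c⟩ with hψ₁
  set ψ₂ := Complex.arg ⟨X₂, c⟩ with hψ₂
  have hpol₁ : GaussianInt.toComplex ⟨X₁, c⟩ =
      ‖(⟨X₁, c⟩ : ℂ)‖ * Complex.exp (ψ₁ * Complex.I) := by
    rw [Complex.norm_mul_exp_arg_mul_I]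
    apply Complex.ext <;> simp [GaussianInt.toComplex_def']
  have hpol₂ : GaussianInt.toComplex ⟨X₂, σ * c⟩ =
      ‖(⟨X₂, c⟩ : ℂ)‖ * Complex.exp ((σ * ψ₂ : ℝ) * Complex.I) := by
    have h := Complex.norm_mul_exp_arg_mul_I ⟨X₂, c⟩
    rw [← hψ₂] at h
    rcases hσ with rfl | rfl
    · rw [Int.cast_one, one_mul, one_mul, h]
      apply Complex.ext <;> simp [GaussianInt.toComplex_def']
    · have h' := congrArg (starRingEnd ℂ) h
      rw [map_mul, Complex.conj_ofReal, ← Complex.exp_conj, map_mul, Complex.conj_I,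
        Complex.conj_ofReal] at h'
      have : ((((-1 : ℤ) : ℝ) * ψ₂ : ℝ) : ℂ) * Complex.I = ψ₂ * -Complex.I := by
        push_cast
        ring
      rw [this, h']
      apply Complex.ext <;> simp [GaussianInt.toComplex_def']
  set θ : ℝ := (ψ₁ - (-σ) * ψ₂) / 4 with hθ
  set Y := GaussianInt.toComplex y with hY
  have hN' : (N : ℂ) ≠ 0 := by exact_mod_cast hN.ne'
  have hpow : Y ^ 4 = (‖Y‖ * Complex.exp (θ * Complex.I)) ^ 4 := by
    have h1 := congrArg GaussianInt.toComplex hy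
    rw [map_mul, map_mul, map_mul, map_pow, hpol₁, hpol₂, map_intCast, map_intCast] at h1
    have h2 : (N : ℂ) * Y ^ 4 = ((e * (‖(⟨X₁, c⟩ : ℂ)‖ * ‖(⟨X₂, c⟩ : ℂ)‖) : ℝ) : ℂ) *
        Complex.exp (θ * Complex.I) ^ 4 := by
      rw [h1, ← Complex.exp_nat_mul, hθ]
      have : ((4 : ℕ) : ℂ) * (((ψ₁ - (-σ) * ψ₂) / 4 : ℝ) * Complex.I) =
          ψ₁ * Complex.I + (σ * ψ₂ : ℝ) * Complex.I := by
        push_cast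
        ring
      rw [this, Complex.exp_add]
      push_cast
      ring
    have h3 := congrArg norm h2
    have he0 : (0 : ℝ) ≤ e := by rcases he with rfl | rfl <;> norm_num
    rw [norm_mul, norm_mul, norm_pow, norm_pow, Complex.norm_exp_ofReal_mul_I, one_pow, mul_one,
      Complex.norm_real, Real.norm_of_nonneg (by positivity), Complex.norm_intCast,
      abs_of_pos (by exact_mod_cast hN)] at h3
    rw [← h3] at h2
    have := mul_left_cancel₀ hN' (a := (N : ℂ)) (b := Y ^ 4)
      (c := (‖Y‖ : ℂ) ^ 4 * Complex.exp (θ * Complex.I) ^ 4) (by rw [h2]; push_cast; ring)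
    rw [this]
    ring
  have hfin : ∀ u : GaussianInt, u ^ 4 = 1 → u.norm = 1 →
      GaussianInt.toComplex u * Y = ‖Y‖ * Complex.exp (θ * Complex.I) →
      ∃ (z : GaussianInt) (e σ' : ℤ), (e = 1 ∨ e = 4) ∧ (σ' = 1 ∨ σ' = -1) ∧
      N * z ^ 4 = e * ⟨X₁, c⟩ * ⟨X₂, σ' * c⟩ ∧ z.norm ^ 2 = e * (Y₁ * Y₂) ^ 2 ∧
      GaussianInt.toComplex z = ‖GaussianInt.toComplex z‖ *
        Complex.exp (((ψ₁ - (-σ') * ψ₂) / 4 : ℝ) * Complex.I) := by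
    intro u hu hun huY
    refine ⟨u * y, e, σ, he, hσ, by rw [mul_pow, hu, one_mul, hy], by
      rw [Zsqrtd.norm_mul, hun, one_mul, hny], ?_⟩
    have : ‖GaussianInt.toComplex (u * y)‖ = ‖Y‖ := by
      rw [map_mul, huY, norm_mul, Complex.norm_exp_ofReal_mul_I, mul_one, Complex.norm_real,
        norm_norm]
    rw [this, map_mul, huY]
  rcases Complex.eq_or_eq_of_pow_four_eq hpow with h | h | h | h
  · exact hfin 1 (by decide) (by decide) (by rw [map_one, one_mul, ← h])
  · exact hfin (-1) (by decide) (by decide) (by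
      rw [map_neg, map_one, neg_one_mul, neg_eq_iff_eq_neg]; exact h)
  · refine hfin ⟨0, 1⟩ (by decide) (by decide) ?_
    rw [← h]; congr 1; simp [GaussianInt.toComplex_def']
  · refine hfin ⟨0, -1⟩ (by decide) (by decide) ?_
    rw [← h]; congr 1; simp [GaussianInt.toComplex_def']

namespace QuarticPade

/-- The integers `l ^ r * Im (z * pade X c r)`. -/
def IsPadeSequence (l X c : ℤ) (z : GaussianInt) (K : ℕ → ℤ) : Prop :=
  ∀ r, (K r : ℝ) = l ^ r * (GaussianInt.toComplex z * pade X c r).im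

theorem exists_isPadeSequence {l c μ : ℤ} (h : l * c = 4 * μ) (X : ℤ) (z : GaussianInt) :
    ∃ K, IsPadeSequence l X c z K := by
  choose G hG using fun r => exists_pow_mul_numer_eq h X r
  refine ⟨fun r => (z * G r).im, fun r => ?_⟩
  have h1 := congrArg Complex.im (congrArg (GaussianInt.toComplex z * ·) (hG r))
  simp only [← map_mul, ← GaussianInt.intCast_im] at h1
  rw [h1, mul_left_comm, ← Complex.im_ofReal_mul]
  simp [pade]

namespace IsPadeSequence

variable {l X c : ℤ} {z : GaussianInt} {K : ℕ → ℤ}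

theorem zero (h : IsPadeSequence l X c z K) : K 0 = z.im := by
  have := h 0
  rw [pade_zero, mul_one, ← GaussianInt.intCast_im, pow_zero, one_mul] at this
  exact_mod_cast this

theorem one (h : IsPadeSequence l X c z K) : 2 * K 1 = l * (4 * X * z.im - c * z.re) := by
  have := h 1
  rw [pade_one, pow_one, Complex.mul_im, ← GaussianInt.intCast_im, ← GaussianInt.intCast_re] at this
  have h2 : 2 * (K 1 : ℝ) = l * (4 * X * z.im - c * z.re) := by
    rw [this]
    ring
  exact_mod_cast h2

theorem im_eq_zero_of_eq_zero (h : IsPadeSequence l X c z K) (hl : l ≠ 0) (hc : c ≠ 0) {r : ℕ}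
    (h0 : K r = 0) (h1 : K (r + 1) = 0) : z.im = 0 := by
  have hl' (r : ℕ) : (l : ℝ) ^ r ≠ 0 := pow_ne_zero _ (by exact_mod_cast hl)
  induction r with
  | zero => rw [← h.zero, h0]
  | succ r ih =>
    refine ih ?_ h0
    have e0 := h r
    have e1 := h (r + 1)
    have e2 := h (r + 1 + 1)
    rw [h0, Int.cast_zero, eq_comm, mul_eq_zero, or_iff_right (hl' _)] at e1
    rw [h1, Int.cast_zero, eq_comm, mul_eq_zero, or_iff_right (hl' _)] at e2
    have hrec := congrArg (fun t => (GaussianInt.toComplex z * t).im)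
      (pade_recurrence (X := X) (c := c) r)
    rw [mul_add] at hrec
    simp only [mul_left_comm _ (Complex.ofReal _), Complex.add_im,
        Complex.im_ofReal_mul] at hrec
    rw [e1, e2, mul_zero, mul_zero, zero_add, eq_comm, mul_eq_zero] at hrec
    have hc' : (c : ℝ) ≠ 0 := by exact_mod_cast hc
    have : (4 * (r : ℝ) + 3) * (4 * r + 5) / (4 * (r + 1)) * (c : ℝ) ^ 2 ≠ 0 := by positivity
    have := hrec.resolve_left this
    rw [this, mul_zero] at e0
    exact_mod_cast e0

theorem exists_eq_add_sq_mul (h : IsPadeSequence 4 X c z K) (r : ℕ) : ∃ t : ℤ,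
    K (r + 1) = 4 ^ r * (r + 1).centralBinom * (X ^ r * (4 * X * z.im - c * z.re)) + c ^ 2 * t := by
  obtain ⟨H, hH⟩ := exists_pow_mul_numer_eq_add c X r
  refine ⟨(z * H).im, ?_⟩
  have h1 := congrArg Complex.im (congrArg (GaussianInt.toComplex z * ·) hH)
  simp only [← map_mul, ← GaussianInt.intCast_im] at h1
  have h2 := h (r + 1)
  have h3 : (K (r + 1) : ℝ) = (z * (4 ^ r * (r + 1).centralBinom * (⟨4 * X ^ (r + 1), -c * X ^ r⟩ : GaussianInt) +
      c ^ 2 * H)).im := by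
    rw [h1, h2, mul_left_comm, ← Complex.im_ofReal_mul]
    simp [pade]
  have h4 : K (r + 1) = (z * (4 ^ r * (r + 1).centralBinom * (⟨4 * X ^ (r + 1), -c * X ^ r⟩ : GaussianInt) +
      c ^ 2 * H)).im := by exact_mod_cast h3
  have h5 : z * (4 ^ r * (r + 1).centralBinom * (⟨4 * X ^ (r + 1), -c * X ^ r⟩ : GaussianInt) + c ^ 2 * H) =
      ((4 ^ r * (r + 1).centralBinom : ℤ) : GaussianInt) * (z * ⟨4 * X ^ (r + 1), -c * X ^ r⟩) +
        ((c ^ 2 : ℤ) : GaussianInt) * (z * H) := by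
    push_cast
    ring
  rw [h4, h5, Zsqrtd.im_add, Zsqrtd.im_mul (_ : GaussianInt) (z * _),
    Zsqrtd.im_mul (_ : GaussianInt) (z * H), Zsqrtd.re_intCast, Zsqrtd.im_intCast,
    Zsqrtd.re_intCast, Zsqrtd.im_intCast, Zsqrtd.im_mul]
  ring

end IsPadeSequence

end QuarticPade

namespace QuarticPade

/-- The squared main term of the bound for `Im (z * pade X₁ c r)`. -/
noncomputable def gapTerm (c X Y₁ Y₂ l g : ℝ) (r : ℕ) : ℝ :=
  Y₁ * Y₂ * c ^ 2 / (8 * X ^ 2) * (l * g) ^ (2 * r)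

theorem abs_lt_of_gapTerm_lt {X₁ X₂ c l Y₁ Y₂ ψ₁ ψ₂ B h K : ℝ} {x : ℂ} {r : ℕ}
    (hX₁ : 0 < X₁) (hX₂ : 0 < X₂) (hl : 0 ≤ l) (hB : X₁ ≤ B) (hh : 0 < h)
    (hψ₁ : 0 ≤ ψ₁) (hψ₁c : ψ₁ ≤ c / X₁) (hψ₂c : |ψ₂| ≤ c / X₂)
    (hx : ‖x‖ ^ 2 ≤ 2 * (Y₁ * Y₂))
    (hK : |K| ≤ l ^ r * (‖x‖ * (ψ₁ / 4 * (2 * (B - X₁)) ^ r + |ψ₂| / 4 * (2 * (B + X₁)) ^ r)))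
    (hT : gapTerm c X₁ Y₁ Y₂ l (2 * (B - X₁)) r < (3 * h / 4) ^ 2)
    (hS : gapTerm c X₂ Y₁ Y₂ l (2 * (B + X₁)) r < (h / 4) ^ 2) : |K| < h := by
  have hg : 0 ≤ 2 * (B - X₁) := by linarith
  have hρ : 0 ≤ 2 * (B + X₁) := by linarith
  have main {X g ψ t : ℝ} (hX : 0 < X) (hg : 0 ≤ g) (hψ : ψ ≤ c / X) (hψ0 : 0 ≤ ψ) (ht : 0 ≤ t)
      (h : gapTerm c X Y₁ Y₂ l g r < t ^ 2) : l ^ r * ‖x‖ * (ψ / 4 * g ^ r) < t := by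
    refine lt_of_pow_lt_pow_left₀ 2 ht (lt_of_le_of_lt ?_ h)
    calc (l ^ r * ‖x‖ * (ψ / 4 * g ^ r)) ^ 2
        = ‖x‖ ^ 2 * (ψ ^ 2 / 16) * (l * g) ^ (2 * r) := by
          rw [pow_mul' (l * g)]
          ring
      _ ≤ 2 * (Y₁ * Y₂) * ((c / X) ^ 2 / 16) * (l * g) ^ (2 * r) := by
          have := (sq_nonneg ‖x‖).trans hx
          gcongr
      _ = gapTerm c X Y₁ Y₂ l g r := by
          rw [gapTerm]
          field_simp
          ring
  have h1 := main hX₁ hg hψ₁c hψ₁ (by positivity) hT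
  have h2 := main hX₂ hρ hψ₂c (abs_nonneg _) (by positivity) hS
  calc |K| ≤ _ := hK
    _ = l ^ r * ‖x‖ * (ψ₁ / 4 * (2 * (B - X₁)) ^ r)
        + l ^ r * ‖x‖ * (|ψ₂| / 4 * (2 * (B + X₁)) ^ r) := by ring
    _ < h := by linarith

/-- The gap principle: the second error term is controlled by the first one. -/
theorem gapTerm_mul_gapTerm_pow_le {N c X₁ Y₁ X₂ Y₂ l g ρ : ℝ} (hc : 0 < c) (hl : 0 < l)
    (hX₁ : 32 * c ≤ X₁) (hX₂ : 32 * c ≤ X₂)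
    (h₁ : X₁ ^ 2 + c ^ 2 = N * Y₁ ^ 4) (h₂ : X₂ ^ 2 + c ^ 2 = N * Y₂ ^ 4)
    (hg : 0 ≤ g) (hgX : g * X₁ ≤ c ^ 2) (hρ : 0 ≤ ρ) (hρX : ρ ≤ 4 * X₁ * (4097 / 4096))
    (hgρ : g * ρ = 4 * c ^ 2) (q : ℕ) :
    16 * N ^ 2 * (gapTerm c X₂ Y₁ Y₂ l ρ (q + 2) * gapTerm c X₁ Y₁ Y₂ l g q ^ 3) ≤
      1.003 * (c ^ 8 * l ^ 4) * ((4 * l ^ 4 * c ^ 6 / X₁ ^ 2) ^ q) ^ 2 := by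
  have hX₁0 : 0 < X₁ := by linarith
  have hX₂0 : 0 < X₂ := by linarith
  have hg2 : g ≤ c ^ 2 / X₁ := by rwa [le_div_iff₀ hX₁0]
  have e1 : gapTerm c X₂ Y₁ Y₂ l ρ (q + 2) * gapTerm c X₁ Y₁ Y₂ l g q ^ 3 =
      Y₁ ^ 4 * Y₂ ^ 4 * c ^ 8 / (8 ^ 4 * X₂ ^ 2 * X₁ ^ 6) * (l ^ 4 * ρ ^ 4) *
        ((4 * l ^ 4 * c ^ 2 * g ^ 2) ^ q) ^ 2 := by
    have : (4 * l ^ 4 * c ^ 2 * g ^ 2) ^ 2 = (l * ρ) ^ 2 * ((l * g) ^ 2) ^ 3 := by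
      linear_combination (-l ^ 8 * g ^ 4 * (4 * c ^ 2 + g * ρ)) * hgρ
    rw [← pow_mul, mul_comm q 2, pow_mul, this, gapTerm, gapTerm]
    rw [pow_mul (l * ρ), pow_mul (l * g), mul_pow ((l * ρ) ^ 2) _ q, pow_add,
      ← pow_mul ((l * g) ^ 2) 3 q, mul_comm 3 q, pow_mul _ q 3]
    generalize ((l * ρ) ^ 2) ^ q = U
    generalize ((l * g) ^ 2) ^ q = V
    field_simp
  have e2 : ((4 * l ^ 4 * c ^ 2 * g ^ 2) ^ q) ^ 2 ≤ ((4 * l ^ 4 * c ^ 6 / X₁ ^ 2) ^ q) ^ 2 := by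
    have : 4 * l ^ 4 * c ^ 2 * g ^ 2 ≤ 4 * l ^ 4 * c ^ 6 / X₁ ^ 2 := by
      calc 4 * l ^ 4 * c ^ 2 * g ^ 2 ≤ 4 * l ^ 4 * c ^ 2 * (c ^ 2 / X₁) ^ 2 := by gcongr
        _ = _ := by field_simp
    gcongr
  have e3 : N ^ 2 * (Y₁ ^ 4 * Y₂ ^ 4) ≤ (1025 / 1024) ^ 2 * (X₁ ^ 2 * X₂ ^ 2) := by
    have f1 : X₁ ^ 2 + c ^ 2 ≤ 1025 / 1024 * X₁ ^ 2 := by nlinarith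
    have f2 : X₂ ^ 2 + c ^ 2 ≤ 1025 / 1024 * X₂ ^ 2 := by nlinarith
    calc N ^ 2 * (Y₁ ^ 4 * Y₂ ^ 4) = (X₁ ^ 2 + c ^ 2) * (X₂ ^ 2 + c ^ 2) := by rw [h₁, h₂]; ring
      _ ≤ 1025 / 1024 * X₁ ^ 2 * (1025 / 1024 * X₂ ^ 2) := by gcongr
      _ = _ := by ring
  have e4 : ρ ^ 4 ≤ (4 * X₁ * (4097 / 4096)) ^ 4 := by gcongr
  rw [e1]
  calc 16 * N ^ 2 * (Y₁ ^ 4 * Y₂ ^ 4 * c ^ 8 / (8 ^ 4 * X₂ ^ 2 * X₁ ^ 6) * (l ^ 4 * ρ ^ 4) *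
        ((4 * l ^ 4 * c ^ 2 * g ^ 2) ^ q) ^ 2)
      = (16 * c ^ 8 * l ^ 4 / (8 ^ 4 * X₂ ^ 2 * X₁ ^ 6)) * (N ^ 2 * (Y₁ ^ 4 * Y₂ ^ 4)) * ρ ^ 4 *
        ((4 * l ^ 4 * c ^ 2 * g ^ 2) ^ q) ^ 2 := by ring
    _ ≤ (16 * c ^ 8 * l ^ 4 / (8 ^ 4 * X₂ ^ 2 * X₁ ^ 6)) *
        ((1025 / 1024) ^ 2 * (X₁ ^ 2 * X₂ ^ 2)) * (4 * X₁ * (4097 / 4096)) ^ 4 *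
        ((4 * l ^ 4 * c ^ 6 / X₁ ^ 2) ^ q) ^ 2 := by gcongr
    _ = (1025 / 1024) ^ 2 * (4097 / 4096) ^ 4 * (c ^ 8 * l ^ 4) *
        ((4 * l ^ 4 * c ^ 6 / X₁ ^ 2) ^ q) ^ 2 := by
      generalize (4 * l ^ 4 * c ^ 6 / X₁ ^ 2) ^ q = Q
      field_simp
      ring
    _ ≤ _ := by
      gcongr
      norm_num

end QuarticPade

namespace QuarticPade

theorem gapTerm_succ (c X Y₁ Y₂ l g : ℝ) (r : ℕ) :
    gapTerm c X Y₁ Y₂ l g (r + 1) = gapTerm c X Y₁ Y₂ l g r * (l * g) ^ 2 := by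
  rw [gapTerm, gapTerm]
  ring

theorem gapTerm_nonneg {c X Y₁ Y₂ l g : ℝ} (hY₁ : 0 ≤ Y₁) (hY₂ : 0 ≤ Y₂) (r : ℕ) :
    0 ≤ gapTerm c X Y₁ Y₂ l g r := by
  rw [gapTerm, pow_mul]
  positivity

theorem exists_gapTerm_lt {N c l X₁ Y₁ X₂ Y₂ h g ρ : ℝ} (hc1 : 1 ≤ c) (hl1 : 1 ≤ l)
    (hh1 : 1 ≤ h) (hN' : c ^ 2 < N) (h₁' : X₁ ^ 2 + c ^ 2 = N * Y₁ ^ 4)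
    (h₂' : X₂ ^ 2 + c ^ 2 = N * Y₂ ^ 4) (hX₁c : 32 * c ≤ X₁) (hX' : X₁ < X₂)
    (hY₁' : 0 < Y₁) (hY' : Y₁ < Y₂) (hY₂2 : 2 ≤ Y₂) (hR' : 4 * l ^ 4 * c ^ 6 ≤ X₁ ^ 2)
    (hg0 : 0 ≤ g) (hρ4 : 4 * X₁ ≤ ρ) (hgρ : g * ρ = 4 * c ^ 2) (hgX : g * X₁ ≤ c ^ 2)
    (hρX : ρ ≤ 4 * X₁ * (4097 / 4096)) :
    ∃ r, gapTerm c X₁ Y₁ Y₂ l g r < (3 * h / 4) ^ 2 ∧ gapTerm c X₂ Y₁ Y₂ l ρ r < (h / 4) ^ 2 ∧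
      ∀ q, r = q + 1 → gapTerm c X₁ Y₁ Y₂ l g (q + 2) < (3 * h / 4) ^ 2 ∧
        (19 * c ^ 4 * l ^ 2 * (4 * l ^ 4 * c ^ 6) ^ q ≤ 8 * N * (X₁ ^ 2) ^ q * h ^ 4 →
          gapTerm c X₂ Y₁ Y₂ l ρ (q + 2) < (h / 4) ^ 2) := by
  have hc' : 0 < c := by linarith
  have hl' : 0 < l := by linarith
  have hh' : 0 < h := by linarith
  have hX₁' : 0 < X₁ := by linarith
  have hX₂' : 0 < X₂ := by linarith
  have hN0 : 0 < N := lt_of_le_of_lt (sq_nonneg _) hN'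
  have hlg : (l * g) ^ 2 ≤ 1 / 4 := by
    have h2 : 2 * l ^ 2 * c ^ 3 ≤ X₁ := by
      refine abs_le_of_sq_le_sq' ?_ hX₁'.le |>.2
      calc (2 * l ^ 2 * c ^ 3) ^ 2 = 4 * l ^ 4 * c ^ 6 := by ring
        _ ≤ _ := hR'
    have h3 : l * g ≤ 1 / 2 := by
      have h4 : 2 * l ^ 2 * c ^ 3 * g ≤ c ^ 2 := by
        have := mul_le_mul_of_nonneg_left h2 hg0
        linarith
      have h5 : (l * c * c ^ 2 : ℝ) * (2 * (l * g)) ≤ 1 * c ^ 2 := by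
        calc _ = 2 * l ^ 2 * c ^ 3 * g := by ring
          _ ≤ _ := by rw [one_mul]; exact h4
      have h6 : (1 : ℝ) ≤ l * c := one_le_mul_of_one_le_of_one_le hl1 hc1
      have h7 : 1 * c ^ 2 * (2 * (l * g)) ≤ (l * c * c ^ 2 : ℝ) * (2 * (l * g)) := by gcongr
      have h8 : c ^ 2 * (2 * (l * g)) ≤ c ^ 2 * 1 := by linarith
      have := le_of_mul_le_mul_left h8 (by positivity)
      linarith
    calc (l * g) ^ 2 ≤ (1 / 2) ^ 2 := by gcongr
      _ = 1 / 4 := by norm_num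
  set T := gapTerm c X₁ Y₁ Y₂ l g with hT
  set S := gapTerm c X₂ Y₁ Y₂ l ρ with hS
  have hT0 : ∀ r, 0 ≤ T r := gapTerm_nonneg hY₁'.le (by linarith)
  have hS0 : ∀ r, 0 ≤ S r := gapTerm_nonneg hY₁'.le (by linarith)
  have hex : ∃ r, T r < (3 * h / 4) ^ 2 := by
    have hlg1 : (l * g) ^ 2 < 1 := by linarith
    have hA : 0 < (Y₁ : ℝ) * Y₂ * c ^ 2 / (8 * X₁ ^ 2) := by positivity
    obtain ⟨r, hr⟩ := exists_pow_lt_of_lt_one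
      (show (0 : ℝ) < (3 * h / 4) ^ 2 / (Y₁ * Y₂ * c ^ 2 / (8 * X₁ ^ 2)) by positivity) hlg1
    refine ⟨r, ?_⟩
    rw [lt_div_iff₀' hA, ← pow_mul] at hr
    exact hr
  classical
  have hmin := fun r => Nat.find_min hex (m := r)
  have hr := Nat.find_spec hex
  generalize Nat.find hex = r at hmin hr
  rcases r with _ | q
  · refine ⟨0, hr, ?_, fun q hq => (q.succ_ne_zero hq.symm).elim⟩
    have h3 : (N : ℝ) * Y₂ ^ 4 ≤ 1025 / 1024 * X₂ ^ 2 := by nlinarith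
    have h4 : (Y₁ : ℝ) * Y₂ * c ^ 2 ≤ 1025 / 4096 * X₂ ^ 2 := by
      calc (Y₁ : ℝ) * Y₂ * c ^ 2 ≤ Y₂ * Y₂ * N := by gcongr
        _ ≤ N * Y₂ ^ 4 / 4 := by
          have : 4 ≤ (Y₂ : ℝ) ^ 2 := by nlinarith
          have := mul_le_mul_of_nonneg_left this (show 0 ≤ (N : ℝ) * Y₂ ^ 2 by positivity)
          linarith
        _ ≤ _ := by linarith
    have h5 : S 0 ≤ 1025 / 32768 := by
      rw [hS, gapTerm, mul_zero, pow_zero, mul_one, div_le_iff₀ (by positivity)]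
      linarith
    nlinarith
  · have hTq : (3 * h / 4 : ℝ) ^ 2 ≤ T q := not_lt.mp (hmin q q.lt_succ_self)
    have key := gapTerm_mul_gapTerm_pow_le hc' hl' hX₁c (by linarith) h₁' h₂' hg0 hgX
      (by linarith) hρX hgρ q
    rw [← hT, ← hS] at key
    have hTq3 : ((3 * h / 4 : ℝ) ^ 2) ^ 3 ≤ T q ^ 3 := by gcongr
    set Q : ℝ := (4 * l ^ 4 * c ^ 6 / X₁ ^ 2) ^ q with hQ
    have hQ0 : 0 ≤ Q := by positivity
    have hQ1 : Q ≤ 1 := pow_le_one₀ (by positivity) (by rw [div_le_one (by positivity)]; exact hR')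
    have key' : 16 * (N : ℝ) ^ 2 * (S (q + 2) * ((3 * h / 4 : ℝ) ^ 2) ^ 3) ≤
        1.003 * (c ^ 8 * l ^ 4) * Q ^ 2 := by
      refine le_trans ?_ key
      have := hS0 (q + 2)
      gcongr
    have hSq : S (q + 1) < (h / 4) ^ 2 := by
      have h1 : S (q + 2) = S (q + 1) * (l * ρ) ^ 2 := gapTerm_succ _ _ _ _ _ _ _
      have h2 : 64 * l ^ 6 * c ^ 6 ≤ (l * ρ) ^ 2 := by
        calc 64 * l ^ 6 * c ^ 6 = 16 * l ^ 2 * (4 * l ^ 4 * c ^ 6) := by ring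
          _ ≤ 16 * l ^ 2 * X₁ ^ 2 := by gcongr
          _ = (l * (4 * X₁)) ^ 2 := by ring
          _ ≤ (l * ρ) ^ 2 := by gcongr
      have h3 : 16 * (c ^ 2 : ℝ) ^ 2 * (S (q + 1) * (64 * l ^ 6 * c ^ 6)
          * ((3 * h / 4 : ℝ) ^ 2) ^ 3) ≤ 1.003 * (c ^ 8 * l ^ 4) * 1 ^ 2 := by
        refine le_trans ?_ (key'.trans (by gcongr))
        rw [h1]
        have := hS0 (q + 1)
        gcongr
      have h4 : (c ^ 8 * l ^ 4 : ℝ) * (182.25 * (S (q + 1) * (c ^ 2 * l ^ 2 * h ^ 6))) ≤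
          (c ^ 8 * l ^ 4 : ℝ) * 1.003 := by
        refine le_trans (le_of_eq ?_) (h3.trans (le_of_eq ?_)) <;> ring
      have h5 := le_of_mul_le_mul_left h4 (by positivity)
      have h6 : (1 : ℝ) ≤ c ^ 2 * l ^ 2 * h ^ 6 :=
        one_le_mul_of_one_le_of_one_le (one_le_mul_of_one_le_of_one_le (one_le_pow₀ hc1)
          (one_le_pow₀ hl1)) (one_le_pow₀ hh1)
      have h7 := mul_le_mul_of_nonneg_left h6 (hS0 (q + 1))
      nlinarith
    refine ⟨q + 1, hr, hSq, fun q' hq' => ?_⟩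
    obtain rfl : q = q' := by omega
    refine ⟨?_, ?_⟩
    · have : T (q + 2) = T (q + 1) * (l * g) ^ 2 := gapTerm_succ _ _ _ _ _ _ _
      rw [this]
      refine lt_of_le_of_lt ?_ hr
      exact mul_le_of_le_one_right (hT0 _) (by linarith)
    · intro hgq
      have h1 : 19 * c ^ 4 * l ^ 2 * Q ≤ 8 * N * h ^ 4 := by
        rw [hQ, div_pow, mul_div_assoc', div_le_iff₀ (by positivity)]
        linarith
      have h2 : (19 * c ^ 4 * l ^ 2 * Q) ^ 2 ≤ (8 * N * h ^ 4) ^ 2 := by gcongr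
      have h3 : (N ^ 2 * h ^ 6 : ℝ) * (16 * 729 / 4096 * S (q + 2)) ≤
          (N ^ 2 * h ^ 6 : ℝ) * (1.003 * 64 / 361 * h ^ 2) := by
        linarith
      have h4 := le_of_mul_le_mul_left h3 (by positivity)
      have h5 : 0 < h ^ 2 := by positivity
      rw [div_pow]
      linarith

theorem IsPadeSequence.false_of_gap {N c l X₁ Y₁ X₂ Y₂ e σ h : ℤ} {z : GaussianInt} {K : ℕ → ℤ}
    (hc : 0 < c) (hl : 0 < l) (hN : c ^ 2 < N)
    (h₁ : X₁ ^ 2 + c ^ 2 = N * Y₁ ^ 4) (h₂ : X₂ ^ 2 + c ^ 2 = N * Y₂ ^ 4)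
    (hX₁ : 32 * c ≤ X₁) (hX : X₁ < X₂) (hY₁ : 0 < Y₁) (hY : Y₁ < Y₂)
    (hR : 4 * l ^ 4 * c ^ 6 ≤ X₁ ^ 2) (he : e = 1 ∨ e = 4) (hσ : σ = 1 ∨ σ = -1)
    (hz : z.norm ^ 2 = e * (Y₁ * Y₂) ^ 2) (hz0 : z.im ≠ 0)
    (harg : GaussianInt.toComplex z = ‖GaussianInt.toComplex z‖ * Complex.exp
      ((((Complex.arg ⟨X₁, c⟩ - (-σ) * Complex.arg ⟨X₂, c⟩) / 4 : ℝ)) * Complex.I))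
    (hK : IsPadeSequence l X₁ c z K) (hh : 0 < h) (hdvd : ∀ r, h ∣ K r)
    (hgap : ∀ q, K (q + 1) ≠ 0 ∨
      19 * c ^ 4 * l ^ 2 * (4 * l ^ 4 * c ^ 6) ^ q ≤ 8 * N * (X₁ ^ 2) ^ q * h ^ 4) : False := by
  have hc' : (0 : ℝ) < c := by exact_mod_cast hc
  have hc1 : (1 : ℝ) ≤ c := by exact_mod_cast hc
  have hl' : (0 : ℝ) < l := by exact_mod_cast hl
  have hl1 : (1 : ℝ) ≤ l := by exact_mod_cast hl
  have hh1 : (1 : ℝ) ≤ h := by exact_mod_cast hh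
  have hh' : (0 : ℝ) < h := by linarith
  have hX₁c : 32 * (c : ℝ) ≤ X₁ := by exact_mod_cast hX₁
  have hX₁' : (0 : ℝ) < X₁ := by linarith
  have hX' : (X₁ : ℝ) < X₂ := by exact_mod_cast hX
  have hX₂' : (0 : ℝ) < X₂ := by linarith
  have hY₁' : (0 : ℝ) < Y₁ := by exact_mod_cast hY₁
  have hY' : (Y₁ : ℝ) < Y₂ := by exact_mod_cast hY
  have hY₂ : 0 < Y₂ := hY₁.trans hY
  have hY₂2 : (2 : ℝ) ≤ Y₂ := by exact_mod_cast (by omega : 2 ≤ Y₂)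
  have hN' : (c : ℝ) ^ 2 < N := by exact_mod_cast hN
  have h₁' : (X₁ : ℝ) ^ 2 + c ^ 2 = N * Y₁ ^ 4 := by exact_mod_cast h₁
  have h₂' : (X₂ : ℝ) ^ 2 + c ^ 2 = N * Y₂ ^ 4 := by exact_mod_cast h₂
  have hR' : 4 * (l : ℝ) ^ 4 * c ^ 6 ≤ X₁ ^ 2 := by exact_mod_cast hR
  set B : ℝ := ‖(⟨X₁, c⟩ : ℂ)‖ with hB
  have hB2 : B ^ 2 = X₁ ^ 2 + c ^ 2 := by
    rw [hB, Complex.sq_norm, Complex.normSq_mk]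
    ring
  have hB0 : 0 ≤ B := norm_nonneg _
  have hBX : (X₁ : ℝ) ≤ B := by nlinarith
  set g : ℝ := 2 * (B - X₁) with hg
  set ρ : ℝ := 2 * (B + X₁) with hρ
  have hg0 : 0 ≤ g := by rw [hg]; linarith
  have hρ4 : 4 * (X₁ : ℝ) ≤ ρ := by rw [hρ]; linarith
  have hgρ : g * ρ = 4 * c ^ 2 := by
    rw [hg, hρ]
    linear_combination 4 * hB2
  have hgX : g * X₁ ≤ c ^ 2 := by
    have := mul_le_mul_of_nonneg_left hρ4 hg0
    linarith
  have hρX : ρ ≤ 4 * X₁ * (4097 / 4096) := by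
    have : B ≤ X₁ * (2049 / 2048) := by
      refine abs_le_of_sq_le_sq' ?_ (by positivity) |>.2
      rw [hB2]
      nlinarith
    rw [hρ]
    linarith
  obtain ⟨ha1, ha2, ha3⟩ := Complex.arg_mem_Icc_of_pos hX₁' hc'
  obtain ⟨hb1, -, hb3⟩ := Complex.arg_mem_Icc_of_pos hX₂' hc'
  have hnorm : ‖GaussianInt.toComplex z‖ ^ 2 ≤ 2 * (Y₁ * Y₂) := by
    have h1 : ‖GaussianInt.toComplex z‖ ^ 2 = z.norm := by
      rw [Complex.sq_norm, GaussianInt.intCast_real_norm]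
    have h2 : z.norm ≤ 2 * (Y₁ * Y₂) := by
      refine abs_le_of_sq_le_sq' ?_ (by positivity) |>.2
      rw [hz, mul_pow]
      have : 0 ≤ (Y₁ * Y₂) ^ 2 := sq_nonneg _
      rcases he with rfl | rfl <;> linarith
    rw [h1]
    exact_mod_cast h2
  obtain ⟨r, hTr, hSr, hnext⟩ := exists_gapTerm_lt hc1 hl1 hh1 hN' h₁' h₂' hX₁c hX' hY₁' hY' hY₂2
    hR' hg0 hρ4 hgρ hgX hρX
  have hzero (r : ℕ) (hTr : gapTerm c X₁ Y₁ Y₂ l g r < (3 * h / 4) ^ 2) (hSr : gapTerm c X₂ Y₁ Y₂ l ρ r < (h / 4) ^ 2) : K r = 0 := by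
    have hψ₂ : |(-σ) * Complex.arg ⟨X₂, c⟩| ≤ c / X₂ := by
      have : |(-σ : ℝ)| = 1 := by rcases hσ with rfl | rfl <;> simp
      rw [abs_mul, this, one_mul, abs_of_pos hb1]
      exact hb3
    have hψ₁ : Complex.arg ⟨X₁, c⟩ ≤ Real.pi := Complex.arg_le_pi _
    have hcos : (X₁ : ℝ) = B * Real.cos (Complex.arg ⟨X₁, c⟩) :=
      (Complex.norm_mul_cos_arg ⟨X₁, c⟩).symm
    have hsin : (c : ℝ) = B * Real.sin (Complex.arg ⟨X₁, c⟩) :=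
      (Complex.norm_mul_sin_arg ⟨X₁, c⟩).symm
    have hb := abs_im_mul_pade_le (X := X₁) (c := c) hB0 ha1.le hψ₁ hcos hsin hX₁'.le hρ hg harg r
    have hKr : |(K r : ℝ)| < h := by
      refine abs_lt_of_gapTerm_lt (r := r) hX₁' hX₂' hl'.le hBX hh' ha1.le ha3 hψ₂ hnorm ?_
        (by rw [← hg]; exact hTr) (by rw [← hρ]; exact hSr)
      rw [hK r, abs_mul, abs_of_nonneg (by positivity : (0 : ℝ) ≤ (l : ℝ) ^ r), ← hg, ← hρ]
      gcongr
    have hKr' : |K r| < h := by exact_mod_cast hKr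
    exact Int.eq_zero_of_abs_lt_dvd (hdvd r) hKr'
  have hKr := hzero r hTr hSr
  rcases r with _ | q
  · exact hz0 (hK.zero ▸ hKr)
  · obtain ⟨hT, hS⟩ := hnext q rfl
    refine hz0 (hK.im_eq_zero_of_eq_zero hl.ne' hc.ne' hKr (hzero _ hT (hS ?_)))
    exact_mod_cast (hgap q).resolve_left (not_not.mpr hKr)

end QuarticPade

namespace QuarticPade

theorem im_ne_zero_of_mul_pow_four_eq {N c X₁ X₂ e σ : ℤ} {z : GaussianInt} (hc : c ≠ 0)
    (hX₁ : 0 < X₁) (hX : X₁ < X₂) (he : e ≠ 0) (hσ : σ = 1 ∨ σ = -1)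
    (hz : (N * z ^ 4 : GaussianInt) = e * ⟨X₁, c⟩ * ⟨X₂, σ * c⟩) : z.im ≠ 0 := by
  intro h0
  have him := congrArg Zsqrtd.im hz
  simp only [pow_succ, pow_zero, one_mul, Zsqrtd.im_mul, Zsqrtd.re_mul, Zsqrtd.re_intCast,
    Zsqrtd.im_intCast, h0] at him
  have : e * c * (X₂ + σ * X₁) = 0 := by linear_combination -him
  rcases mul_eq_zero.mp this with h | h
  · exact mul_ne_zero he hc h
  · rcases hσ with rfl | rfl <;> omega

theorem IsPadeSequence.one_ne_zero {N c l X₁ X₂ e σ : ℤ} {z : GaussianInt} {K : ℕ → ℤ}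
    (hK : IsPadeSequence l X₁ c z K) (hl : l ≠ 0) (hc : 0 < c) (hN : c ^ 2 < N) (hX₁ : c ≤ X₁)
    (hz0 : z.im ≠ 0) (he : e = 1 ∨ e = 4) (hσ : σ = 1 ∨ σ = -1)
    (hz : (N * z ^ 4 : GaussianInt) = e * ⟨X₁, c⟩ * ⟨X₂, σ * c⟩) : K 1 ≠ 0 := by
  intro h0
  have h1 : 4 * X₁ * z.im = c * z.re := by
    have := hK.one
    rw [h0, mul_zero, eq_comm, mul_eq_zero, or_iff_right hl] at this
    linarith
  have hre := congrArg Zsqrtd.re hz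
  have him := congrArg Zsqrtd.im hz
  simp only [pow_succ, pow_zero, one_mul, Zsqrtd.im_mul, Zsqrtd.re_mul, Zsqrtd.re_intCast,
    Zsqrtd.im_intCast] at him hre
  generalize z.re = s at *
  generalize z.im = n at *
  have h2 : c ^ 3 * (N * n ^ 4 * (80 * X₁ ^ 2 - c ^ 2)) =
      c ^ 3 * (e * σ * c ^ 2 * (X₁ ^ 2 + c ^ 2)) := by
    have e1 : c ^ 4 * (N * (X₁ * (4 * (s * n * (s ^ 2 - n ^ 2)))
        - c * (s ^ 4 - 6 * s ^ 2 * n ^ 2 + n ^ 4))) = c ^ 4 * (e * σ * c * (X₁ ^ 2 + c ^ 2)) := by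
      linear_combination c ^ 4 * X₁ * him - c ^ 5 * hre
    have e2 : c ^ 4 * (X₁ * (4 * (s * n * (s ^ 2 - n ^ 2)))
        - c * (s ^ 4 - 6 * s ^ 2 * n ^ 2 + n ^ 4)) =
        4 * X₁ * n * (c * s) * c * ((c * s) ^ 2 - c ^ 2 * n ^ 2)
        - c * ((c * s) ^ 4 - 6 * (c * s) ^ 2 * c ^ 2 * n ^ 2 + c ^ 4 * n ^ 4) := by ring
    rw [← h1] at e2
    linear_combination e1 - N * e2
  have h3 := mul_left_cancel₀ (pow_ne_zero 3 hc.ne') h2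
  have h4 : 0 < n ^ 4 := by positivity
  have h5 : c ^ 2 ≤ X₁ ^ 2 := by gcongr
  have h6 : 0 < c ^ 2 := by positivity
  have h7 : c ^ 2 * (80 * X₁ ^ 2 - c ^ 2) ≤ N * n ^ 4 * (80 * X₁ ^ 2 - c ^ 2) := by
    have : 0 ≤ 80 * X₁ ^ 2 - c ^ 2 := by linarith
    gcongr
    calc c ^ 2 ≤ N * 1 := by linarith
      _ ≤ N * n ^ 4 := by
        have : 0 ≤ N := by linarith
        gcongr
        linarith
  have h8 : e * σ ≤ 4 := by rcases he with rfl | rfl <;> rcases hσ with rfl | rfl <;> norm_num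
  have h9 : e * σ * c ^ 2 * (X₁ ^ 2 + c ^ 2) ≤ 4 * c ^ 2 * (X₁ ^ 2 + c ^ 2) := by gcongr
  have h10 : c ^ 2 * (80 * X₁ ^ 2 - c ^ 2) ≤ c ^ 2 * (4 * (X₁ ^ 2 + c ^ 2)) := by linarith
  have h11 := le_of_mul_le_mul_left h10 h6
  linarith

end QuarticPade

open QuarticPade

theorem lt_of_sq_add_sq_eq {N c X₁ Y₁ X₂ Y₂ : ℤ} (hN : 0 < N) (hX₁ : 0 ≤ X₁) (hX : X₁ < X₂)
    (hY₂ : 0 ≤ Y₂) (h₁ : X₁ ^ 2 + c ^ 2 = N * Y₁ ^ 4) (h₂ : X₂ ^ 2 + c ^ 2 = N * Y₂ ^ 4) :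
    Y₁ < Y₂ := by
  have h : X₁ ^ 2 < X₂ ^ 2 := by gcongr
  have : N * Y₁ ^ 4 < N * Y₂ ^ 4 := by linarith
  exact lt_of_pow_lt_pow_left₀ 4 hY₂ (lt_of_mul_lt_mul_left this hN.le)

theorem FourthPowerLinked.false_of_forall_isPadeSequence {N c l μ X₁ Y₁ X₂ Y₂ : ℤ}
    (hlink : FourthPowerLinked N c X₁ Y₁ X₂ Y₂) (hlc : l * c = 4 * μ)
    (hc : 0 < c) (hl : 0 < l) (hN : c ^ 2 < N)
    (h₁ : X₁ ^ 2 + c ^ 2 = N * Y₁ ^ 4) (h₂ : X₂ ^ 2 + c ^ 2 = N * Y₂ ^ 4)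
    (hX₁ : 32 * c ≤ X₁) (hX : X₁ < X₂) (hY₁ : 0 < Y₁) (hY₂ : 0 < Y₂)
    (hR : 4 * l ^ 4 * c ^ 6 ≤ X₁ ^ 2)
    (hgap : ∀ (z : GaussianInt) (e σ : ℤ) (K : ℕ → ℤ), (e = 1 ∨ e = 4) →
      (N * z ^ 4 : GaussianInt) = e * ⟨X₁, c⟩ * ⟨X₂, σ * c⟩ → z.norm ^ 2 = e * (Y₁ * Y₂) ^ 2 →
      IsPadeSequence l X₁ c z K → ∃ h : ℤ, 0 < h ∧ (∀ r, h ∣ K r) ∧ ∀ q, 0 < q → K (q + 1) ≠ 0 ∨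
        19 * c ^ 4 * l ^ 2 * (4 * l ^ 4 * c ^ 6) ^ q ≤ 8 * N * (X₁ ^ 2) ^ q * h ^ 4) : False := by
  have hN0 : 0 < N := (sq_nonneg c).trans_lt hN
  obtain ⟨z, e, σ, he, hσ, hz, hnorm, harg⟩ := hlink.exists_normalized hN0
  obtain ⟨K, hK⟩ := exists_isPadeSequence hlc X₁ z
  obtain ⟨h, hh, hdvd, hgap⟩ := hgap z e σ K he hz hnorm hK
  have he0 : e ≠ 0 := by rcases he with rfl | rfl <;> norm_num
  have hz0 := im_ne_zero_of_mul_pow_four_eq hc.ne' (by linarith) hX he0 hσ hz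
  refine hK.false_of_gap hc hl hN h₁ h₂ hX₁ hX hY₁
    (lt_of_sq_add_sq_eq hN0 (by linarith) hX hY₂.le h₁ h₂) hR he hσ hnorm hz0 harg hh hdvd
    fun q => ?_
  rcases q.eq_zero_or_pos with rfl | hq
  · exact Or.inl (hK.one_ne_zero hl.ne' hc hN (by linarith) hz0 he hσ hz)
  · exact hgap q hq

theorem FourthPowerLinked.false_of_le {N c l μ X₁ Y₁ X₂ Y₂ : ℤ}
    (hlink : FourthPowerLinked N c X₁ Y₁ X₂ Y₂) (hlc : l * c = 4 * μ)
    (hc : 0 < c) (hl : 0 < l) (hN : c ^ 2 < N)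
    (h₁ : X₁ ^ 2 + c ^ 2 = N * Y₁ ^ 4) (h₂ : X₂ ^ 2 + c ^ 2 = N * Y₂ ^ 4)
    (hX₁ : 32 * c ≤ X₁) (hX : X₁ < X₂) (hY₁ : 0 < Y₁) (hY₂ : 0 < Y₂)
    (hR : 4 * l ^ 4 * c ^ 6 ≤ X₁ ^ 2)
    (hgap : 19 * c ^ 4 * l ^ 2 * (4 * l ^ 4 * c ^ 6) ≤ 8 * N * X₁ ^ 2) : False := by
  refine hlink.false_of_forall_isPadeSequence hlc hc hl hN h₁ h₂ hX₁ hX hY₁ hY₂ hR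
    fun z e σ K he hz hnorm hK => ⟨1, one_pos, fun r => one_dvd _, fun q hq => Or.inr ?_⟩
  obtain ⟨k, rfl⟩ := Nat.exists_eq_add_of_lt hq
  have hN0 : 0 < N := (sq_nonneg c).trans_lt hN
  calc 19 * c ^ 4 * l ^ 2 * (4 * l ^ 4 * c ^ 6) ^ (0 + k + 1)
      = 19 * c ^ 4 * l ^ 2 * (4 * l ^ 4 * c ^ 6) * (4 * l ^ 4 * c ^ 6) ^ k := by ring
    _ ≤ 8 * N * X₁ ^ 2 * (X₁ ^ 2) ^ k :=
      mul_le_mul hgap (pow_le_pow_left₀ (by positivity) hR k) (by positivity) (by positivity)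
    _ = _ := by ring

open QuarticPade

theorem Int.prime_pow_two_mul_le_of_dvd_centralBinom {p : ℕ} (hp : p.Prime) {k r : ℕ} (hr : r ≠ 0)
    (h : ((p : ℤ) ^ k) ∣ r.centralBinom) : (p : ℤ) ^ k ≤ 2 * r := by
  have h' : p ^ k ∣ Nat.choose (2 * r) r := by exact_mod_cast h
  have h0 : Nat.choose (2 * r) r ≠ 0 := (Nat.choose_pos (by omega)).ne'
  have h1 := (hp.pow_dvd_iff_le_factorization h0).mp h'
  have h2 := Nat.pow_le_of_le_log (by omega) (h1.trans Nat.factorization_choose_le_log)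
  exact_mod_cast h2

theorem QuarticPade.IsPadeSequence.sq_le_of_eq_zero {p m : ℕ} (hp : p.Prime) (hp2 : p ≠ 2)
    {X : ℤ} (hX : ¬(p : ℤ) ∣ X) {z : GaussianInt} (hz : ¬(p : ℤ) ∣ z.im) {K : ℕ → ℤ}
    (hm : m ≠ 0) (hK : IsPadeSequence 4 X ((p : ℤ) ^ m) z K) {r : ℕ} (h0 : K (r + 1) = 0) :
    ((p : ℤ) ^ m) ^ 2 ≤ 2 * (r + 1) := by
  obtain ⟨t, ht⟩ := hK.exists_eq_add_sq_mul r
  have hp' : Prime (p : ℤ) := Nat.prime_iff_prime_int.mp hp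
  have h4 : ¬(p : ℤ) ∣ 4 := fun h => by
    have : (p : ℤ) ∣ 2 ^ 2 := by norm_num; exact h
    have := hp'.dvd_of_dvd_pow this
    exact hp2 ((Nat.prime_dvd_prime_iff_eq hp Nat.prime_two).mp (by exact_mod_cast this))
  have hcop {x : ℤ} (hx : ¬(p : ℤ) ∣ x) : IsCoprime ((p : ℤ) ^ (m * 2)) x :=
    (hp'.coprime_iff_not_dvd.mpr hx).pow_left
  have h1 : ¬(p : ℤ) ∣ 4 * X * z.im - (p : ℤ) ^ m * z.re := fun h => by
    have h' : (p : ℤ) ∣ 4 * X * z.im := by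
      have := dvd_add h ((dvd_pow_self (p : ℤ) hm).mul_right z.re)
      rwa [sub_add_cancel] at this
    rcases hp'.dvd_or_dvd h' with h' | h'
    · rcases hp'.dvd_or_dvd h' with h' | h'
      exacts [h4 h', hX h']
    · exact hz h'
  have h2 : (p : ℤ) ^ (m * 2) ∣ (r + 1).centralBinom := by
    have : (p : ℤ) ^ (m * 2) ∣ (r + 1).centralBinom * (4 ^ r * (X ^ r *
        (4 * X * z.im - (p : ℤ) ^ m * z.re))) := ⟨-t, by
      rw [h0] at ht
      linear_combination -ht⟩
    exact (((hcop h4).pow_right).mul_right (((hcop hX).pow_right).mul_right (hcop h1))).dvd_of_dvd_mul_right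
      this
  have h3 := Int.prime_pow_two_mul_le_of_dvd_centralBinom hp r.succ_ne_zero h2
  rw [← pow_mul]
  exact_mod_cast h3

theorem QuarticPade.IsPadeSequence.dvd {X c : ℤ} {z : GaussianInt} {K : ℕ → ℤ}
    (hK : IsPadeSequence 4 X c z K) (h : c ∣ z.im) : ∀ r, c ∣ K r
  | 0 => hK.zero ▸ h
  | r + 1 => by
    obtain ⟨t, ht⟩ := hK.exists_eq_add_sq_mul r
    rw [ht]
    refine dvd_add (((dvd_sub (h.mul_left _) (dvd_mul_right _ _)).mul_left _).mul_left _) ?_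
    exact (dvd_pow_self c two_ne_zero).mul_right _

theorem pow_dvd_im_of_dvd_im {p m : ℕ} (hp : p.Prime) (hp2 : p ≠ 2) {N X₁ Y₁ X₂ Y₂ e σ : ℤ}
    {z : GaussianInt} (hN : ¬(p : ℤ) ∣ N) (hY₁ : ¬(p : ℤ) ∣ Y₁) (hY₂ : ¬(p : ℤ) ∣ Y₂)
    (he : e = 1 ∨ e = 4)
    (hz : (N * z ^ 4 : GaussianInt) = e * ⟨X₁, (p : ℤ) ^ m⟩ * ⟨X₂, σ * (p : ℤ) ^ m⟩)
    (hnorm : z.norm ^ 2 = e * (Y₁ * Y₂) ^ 2) (h : (p : ℤ) ∣ z.im) : (p : ℤ) ^ m ∣ z.im := by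
  have hp' : Prime (p : ℤ) := Nat.prime_iff_prime_int.mp hp
  have h4 : ¬(p : ℤ) ∣ 4 := fun h => by
    have : (p : ℤ) ∣ 2 ^ 2 := by norm_num; exact h
    have := hp'.dvd_of_dvd_pow this
    exact hp2 ((Nat.prime_dvd_prime_iff_eq hp Nat.prime_two).mp (by exact_mod_cast this))
  have he' : ¬(p : ℤ) ∣ e := by
    rcases he with rfl | rfl
    · exact hp'.not_dvd_one
    · exact h4
  have hre : ¬(p : ℤ) ∣ z.re := fun h' => by
    have h1 : (p : ℤ) ∣ e * (Y₁ * Y₂) ^ 2 := by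
      rw [← hnorm]
      refine dvd_pow ?_ two_ne_zero
      rw [Zsqrtd.norm_def]
      exact dvd_sub (h'.mul_right _) (h.mul_left _)
    rcases hp'.dvd_or_dvd h1 with h1 | h1
    · exact he' h1
    · rcases hp'.dvd_or_dvd (hp'.dvd_of_dvd_pow h1) with h1 | h1
      exacts [hY₁ h1, hY₂ h1]
  have hsub : ¬(p : ℤ) ∣ z.re ^ 2 - z.im ^ 2 := fun h' => by
    have := dvd_add h' (dvd_pow h two_ne_zero)
    rw [sub_add_cancel] at this
    exact hre (hp'.dvd_of_dvd_pow this)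
  have him := congrArg Zsqrtd.im hz
  simp only [pow_succ, pow_zero, one_mul, Zsqrtd.im_mul, Zsqrtd.re_mul, Zsqrtd.re_intCast,
    Zsqrtd.im_intCast] at him
  have hdvd : (p : ℤ) ^ m ∣ z.im * (N * (4 * (z.re * (z.re ^ 2 - z.im ^ 2)))) :=
    ⟨e * (X₂ + σ * X₁), by linear_combination him⟩
  have hcop {x : ℤ} (hx : ¬(p : ℤ) ∣ x) : IsCoprime ((p : ℤ) ^ m) x :=
    (hp'.coprime_iff_not_dvd.mpr hx).pow_left
  exact ((hcop hN).mul_right ((hcop h4).mul_right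
    ((hcop hre).mul_right (hcop hsub)))).dvd_of_dvd_mul_right hdvd

theorem FourthPowerLinked.false_of_odd_prime_pow {p m : ℕ} (hp : p.Prime) (hp2 : p ≠ 2) (hm : m ≠ 0)
    (hc : 5 ≤ p ^ m) {N X₁ Y₁ X₂ Y₂ : ℤ} (hlink : FourthPowerLinked N ((p : ℤ) ^ m) X₁ Y₁ X₂ Y₂)
    (hpN : ¬(p : ℤ) ∣ N) (hpX₁ : ¬(p : ℤ) ∣ X₁) (hpY₁ : ¬(p : ℤ) ∣ Y₁) (hpY₂ : ¬(p : ℤ) ∣ Y₂)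
    (hN : ((p : ℤ) ^ m) ^ 2 < N) (h₁ : X₁ ^ 2 + ((p : ℤ) ^ m) ^ 2 = N * Y₁ ^ 4)
    (h₂ : X₂ ^ 2 + ((p : ℤ) ^ m) ^ 2 = N * Y₂ ^ 4) (hX₁ : 0 < X₁) (hX : X₁ < X₂)
    (hY₁ : 0 < Y₁) (hY₂ : 0 < Y₂) (hR : 2048 * ((p : ℤ) ^ m) ^ 6 ≤ X₁ ^ 2) : False := by
  have hc' : 5 ≤ (p : ℤ) ^ m := by exact_mod_cast hc
  have hX₁c : 32 * (p : ℤ) ^ m ≤ X₁ := by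
    refine abs_le_of_sq_le_sq' ?_ hX₁.le |>.2
    refine le_trans ?_ hR
    generalize (p : ℤ) ^ m = c at hc'
    have : c ^ 2 * 1 ≤ c ^ 2 * c ^ 4 := by
      gcongr
      exact one_le_pow₀ (by linarith)
    linarith [sq_nonneg c]
  refine hlink.false_of_forall_isPadeSequence (l := 4) rfl (by linarith) (by norm_num) hN h₁ h₂ hX₁c
    hX hY₁ hY₂ ?_ fun z e σ K he hz hnorm hK => ?_
  · have : 0 ≤ ((p : ℤ) ^ m) ^ 6 := by positivity
    linarith
  have hpow (q : ℕ) : 2 ^ q * (4 * 4 ^ 4 * ((p : ℤ) ^ m) ^ 6) ^ q ≤ (X₁ ^ 2) ^ q := by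
    rw [← mul_pow]
    refine pow_le_pow_left₀ (by positivity) ?_ q
    linarith
  by_cases hdvd : (p : ℤ) ∣ z.im
  · refine ⟨(p : ℤ) ^ m, by linarith,
      hK.dvd (pow_dvd_im_of_dvd_im hp hp2 hpN hpY₁ hpY₂ he hz hnorm hdvd), fun q hq => Or.inr ?_⟩
    have h2 : (2 : ℤ) ≤ 2 ^ q := le_self_pow₀ (by norm_num) hq.ne'
    have hpq := hpow q
    generalize (p : ℤ) ^ m = c at *
    have h26 : 26 ≤ N := by nlinarith
    have h3 : 0 ≤ (4 * 4 ^ 4 * c ^ 6) ^ q := by positivity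
    calc 19 * c ^ 4 * 4 ^ 2 * (4 * 4 ^ 4 * c ^ 6) ^ q
        = 8 * 19 * (2 * (4 * 4 ^ 4 * c ^ 6) ^ q) * c ^ 4 := by ring
      _ ≤ 8 * N * (2 ^ q * (4 * 4 ^ 4 * c ^ 6) ^ q) * c ^ 4 := by gcongr; linarith
      _ ≤ _ := by gcongr
  · refine ⟨1, one_pos, fun r => one_dvd _, fun q hq => or_iff_not_imp_left.mpr fun h0 => ?_⟩
    have h1 := hK.sq_le_of_eq_zero hp hp2 hpX₁ hdvd hm (not_not.mp h0)
    have hpq := hpow q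
    generalize (p : ℤ) ^ m = c at *
    have hq12 : 12 ≤ q := by
      have : 25 ≤ c ^ 2 := by nlinarith
      omega
    have h2 : 38 * (2 * ((q : ℤ) + 1)) ≤ 2 ^ q := by
      clear * - hq12
      induction q, hq12 using Nat.le_induction with
      | base => norm_num
      | succ q hq ih =>
        rw [pow_succ]
        push_cast
        have : (12 : ℤ) ≤ q := by exact_mod_cast hq
        linarith
    have h3 : 0 ≤ (4 * 4 ^ 4 * c ^ 6) ^ q := by positivity
    have hN0 : 0 ≤ N := by linarith [sq_nonneg c]
    calc 19 * c ^ 4 * 4 ^ 2 * (4 * 4 ^ 4 * c ^ 6) ^ q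
        = 8 * c ^ 2 * (38 * c ^ 2 * (4 * 4 ^ 4 * c ^ 6) ^ q) := by ring
      _ ≤ 8 * N * (2 ^ q * (4 * 4 ^ 4 * c ^ 6) ^ q) := by
        gcongr
        linarith
      _ ≤ 8 * N * (X₁ ^ 2) ^ q * 1 ^ 4 := by
        rw [one_pow, mul_one]
        gcongr

open QuarticPade

theorem FourthPowerLinked.two_mul_sq_le {N c X₁ Y₁ X₂ Y₂ : ℤ}
    (hlink : FourthPowerLinked N c X₁ Y₁ X₂ Y₂) (hN : 0 < N) (hc : 0 < c) (hX₁ : 0 < X₁)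
    (hX : X₁ < X₂) (hY₁ : 0 < Y₁) (hY₂ : 0 < Y₂) : 2 * X₁ ^ 2 ≤ c ^ 2 * (Y₁ * Y₂) := by
  obtain ⟨z, e, σ, he, hσ, hz, hnorm, harg⟩ := hlink.exists_normalized hN
  have he0 : e ≠ 0 := by rcases he with rfl | rfl <;> norm_num
  have hz0 := im_ne_zero_of_mul_pow_four_eq hc.ne' hX₁ hX he0 hσ hz
  have hc' : (0 : ℝ) < c := by exact_mod_cast hc
  have hX₁' : (0 : ℝ) < X₁ := by exact_mod_cast hX₁
  have hX' : (X₁ : ℝ) < X₂ := by exact_mod_cast hX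
  obtain ⟨ha1, -, ha3⟩ := Complex.arg_mem_Icc_of_pos hX₁' hc'
  obtain ⟨hb1, -, hb3⟩ := Complex.arg_mem_Icc_of_pos (hX₁'.trans hX') hc'
  have hb4 : (c : ℝ) / X₂ ≤ c / X₁ := by gcongr
  have hnorm' : z.norm ≤ 2 * (Y₁ * Y₂) := by
    refine abs_le_of_sq_le_sq' ?_ (by positivity) |>.2
    rw [hnorm, mul_pow]
    have : 0 ≤ (Y₁ * Y₂) ^ 2 := sq_nonneg _
    rcases he with rfl | rfl <;> linarith
  have hnorm2 : ‖GaussianInt.toComplex z‖ ^ 2 ≤ 2 * (Y₁ * Y₂) := by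
    rw [Complex.sq_norm, ← GaussianInt.intCast_real_norm]
    exact_mod_cast hnorm'
  set θ : ℝ := (Complex.arg ⟨X₁, c⟩ - (-σ) * Complex.arg ⟨X₂, c⟩) / 4 with hθ
  have hθ' : |θ| ≤ c / X₁ / 2 := by
    rw [abs_le]
    rcases hσ with rfl | rfl <;> push_cast at hθ <;> constructor <;> linarith
  have him : (z.im : ℝ) = ‖GaussianInt.toComplex z‖ * Real.sin θ := by
    rw [GaussianInt.intCast_im]
    conv_lhs => rw [harg]
    rw [Complex.im_ofReal_mul, Complex.exp_ofReal_mul_I_im]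
  have h1 : (1 : ℝ) ≤ (z.im : ℝ) ^ 2 := by
    exact_mod_cast (by positivity : 0 < z.im ^ 2)
  have h2 : Real.sin θ ^ 2 ≤ (c / X₁ / 2) ^ 2 := by
    rw [sq_le_sq]
    exact (Real.abs_sin_le_abs.trans hθ').trans (le_abs_self _)
  have h3 : (1 : ℝ) ≤ 2 * (Y₁ * Y₂) * (c / X₁ / 2) ^ 2 := by
    rw [him, mul_pow] at h1
    exact h1.trans (mul_le_mul hnorm2 h2 (sq_nonneg _) ((sq_nonneg _).trans hnorm2))
  have h4 : 2 * (Y₁ * Y₂ : ℝ) * (c / X₁ / 2) ^ 2 = c ^ 2 * (Y₁ * Y₂) / (2 * X₁ ^ 2) := by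
    field_simp
  rw [h4, le_div_iff₀ (by positivity), one_mul] at h3
  exact_mod_cast h3

theorem FourthPowerLinked.false_of_lt_of_lt {N c X₁ Y₁ X₂ Y₂ X₃ Y₃ : ℤ}
    (h₁₂ : FourthPowerLinked N c X₁ Y₁ X₂ Y₂) (h₂₃ : FourthPowerLinked N c X₂ Y₂ X₃ Y₃)
    (hc : 0 < c) (hN : c ^ 2 < N)
    (h₁ : X₁ ^ 2 + c ^ 2 = N * Y₁ ^ 4) (h₂ : X₂ ^ 2 + c ^ 2 = N * Y₂ ^ 4)
    (h₃ : X₃ ^ 2 + c ^ 2 = N * Y₃ ^ 4) (hX₁ : 0 < X₁) (hX₂ : X₁ < X₂) (hX₃ : X₂ < X₃)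
    (hY₁ : 5 ≤ Y₁) (hY₂ : 0 < Y₂) (hY₃ : 0 < Y₃) (hcY : c ^ 2 ≤ 2 * Y₁) : False := by
  have hsq {X Y : ℤ} (hY : c ^ 2 ≤ 2 * Y) (hY5 : 5 ≤ Y) (h : X ^ 2 + c ^ 2 = N * Y ^ 4) :
      c ^ 2 * Y ^ 4 ≤ X ^ 2 := by
    have h1 : 2 * Y ≤ Y ^ 4 := by
      have : 125 ≤ Y ^ 3 := by
        calc (125 : ℤ) = 5 ^ 3 := by norm_num
          _ ≤ Y ^ 3 := by gcongr
      nlinarith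
    have h2 : (c ^ 2 + 1) * Y ^ 4 ≤ N * Y ^ 4 := by gcongr; linarith
    linarith
  have hgap := h₁₂.two_mul_sq_le (by nlinarith) hc hX₁ hX₂ (by linarith) hY₂
  have hc2 : 0 < c ^ 2 := by positivity
  have h4 : 2 * Y₁ ^ 3 ≤ Y₂ := by
    have : c ^ 2 * Y₁ * (2 * Y₁ ^ 3) ≤ c ^ 2 * Y₁ * Y₂ := by
      linarith [hsq hcY hY₁ h₁]
    exact le_of_mul_le_mul_left this (by positivity)
  have hp3 : 125 ≤ Y₁ ^ 3 := by
    calc (125 : ℤ) = 5 ^ 3 := by norm_num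
      _ ≤ Y₁ ^ 3 := by gcongr
  have hY₁₂ : Y₁ ≤ Y₂ := by
    have : Y₁ ^ 1 ≤ Y₁ ^ 3 := pow_le_pow_right₀ (by linarith) (by norm_num)
    linarith
  have h5 : 16 * c ^ 2 * Y₁ ^ 12 ≤ X₂ ^ 2 := by
    calc 16 * c ^ 2 * Y₁ ^ 12 = c ^ 2 * (2 * Y₁ ^ 3) ^ 4 := by ring
      _ ≤ c ^ 2 * Y₂ ^ 4 := by gcongr
      _ ≤ _ := hsq (by linarith) (by linarith) h₂
  have h6 : c ^ 4 ≤ 4 * Y₁ ^ 2 := by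
    calc c ^ 4 = (c ^ 2) ^ 2 := by ring
      _ ≤ (2 * Y₁) ^ 2 := by gcongr
      _ = _ := by ring
  have h7 : c ^ 6 ≤ 8 * Y₁ ^ 3 := by
    calc c ^ 6 = (c ^ 2) ^ 3 := by ring
      _ ≤ (2 * Y₁) ^ 3 := by gcongr
      _ = _ := by ring
  have h8 : 9765625 * Y₁ ^ 2 ≤ Y₁ ^ 12 := by
    calc 9765625 * Y₁ ^ 2 = 5 ^ 10 * Y₁ ^ 2 := by norm_num
      _ ≤ Y₁ ^ 10 * Y₁ ^ 2 := by gcongr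
      _ = _ := by ring
  have h9 : 1953125 * Y₁ ^ 3 ≤ Y₁ ^ 12 := by
    calc 1953125 * Y₁ ^ 3 = 5 ^ 9 * Y₁ ^ 3 := by norm_num
      _ ≤ Y₁ ^ 9 * Y₁ ^ 3 := by gcongr
      _ = _ := by ring
  refine h₂₃.false_of_le (l := 4) rfl hc (by norm_num) hN h₂ h₃ ?_ hX₃ hY₂ hY₃ ?_ ?_
  · refine abs_le_of_sq_le_sq' ?_ (by linarith) |>.2
    refine le_trans ?_ h5
    calc (32 * c) ^ 2 = 16 * c ^ 2 * 64 := by ring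
      _ ≤ _ := by gcongr; linarith
  · refine le_trans ?_ h5
    calc 4 * 4 ^ 4 * c ^ 6 = 16 * c ^ 2 * (64 * c ^ 4) := by ring
      _ ≤ _ := by gcongr; nlinarith
  · calc 19 * c ^ 4 * 4 ^ 2 * (4 * 4 ^ 4 * c ^ 6) = 8 * c ^ 2 * (16 * c ^ 2 * (2432 * c ^ 6)) := by
          ring
      _ ≤ 8 * c ^ 2 * (16 * c ^ 2 * Y₁ ^ 12) := by gcongr; linarith
      _ ≤ 8 * N * X₂ ^ 2 := by
        have : 0 ≤ N := by linarith
        gcongr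

theorem eq_of_sq_add_one_eq_mul_pow_four {x₁ x y : ℤ}
    (hx₁ : x₁ = 4 ∨ x₁ = 8 ∨ x₁ = 9 ∨ x₁ = 12 ∨ x₁ = 21 ∨ x₁ = 25)
    (hx : 0 < x) (hy : 0 < y) (h : x ^ 2 + 1 = (x₁ ^ 2 + 1) * y ^ 4) : x = x₁ := by
  have hx0 : 0 < x₁ := by omega
  obtain ⟨X, s, w, -, hs, hw, hlink⟩ := fourthPowerLinked_of_sq_add_one (N := x₁ ^ 2 + 1) hx0
    one_pos hy (by ring) h
  have hre := congrArg Zsqrtd.re hlink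
  have him := congrArg Zsqrtd.im hlink
  rw [Zsqrtd.norm_def] at hw
  simp only [pow_succ, pow_zero, one_mul, Zsqrtd.im_mul, Zsqrtd.re_mul, Zsqrtd.re_intCast,
    Zsqrtd.im_intCast] at him hre
  generalize w.re = r at *
  generalize w.im = t at *
  have hss : s * s = 1 := by rcases hs with rfl | rfl <;> norm_num
  have hF : simplestQuartic (4 * x₁) r t = s := by
    have hN : x₁ ^ 2 + 1 ≠ 0 := by positivity
    refine mul_left_cancel₀ hN ?_
    rw [simplestQuartic]
    linear_combination -s * hre + s * x₁ * him - (x₁ ^ 2 + 1) *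
      (r ^ 4 - 4 * x₁ * r ^ 3 * t - 6 * r ^ 2 * t ^ 2 + 4 * x₁ * r * t ^ 3 + t ^ 4) * hss
  have hF' : simplestQuartic (4 * x₁) r t = 1 ∨ simplestQuartic (4 * x₁) r t = -1 := by
    rwa [hF]
  have hrt : r = 0 ∨ t = 0 := by
    rcases hx₁ with rfl | rfl | rfl | rfl | rfl | rfl
    · exact simplestQuartic_sixteen_eq_one hF'
    · exact simplestQuartic_thirtyTwo_eq_one hF'
    · exact simplestQuartic_thirtySix_eq_one hF'
    · exact simplestQuartic_fortyEight_eq_one hF'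
    · exact simplestQuartic_eightyFour_eq_one hF'
    · exact simplestQuartic_hundred_eq_one hF'
  have hy1 : y ^ 2 = 1 := by
    rw [simplestQuartic] at hF
    have : y ^ 2 = s := by
      rcases hrt with rfl | rfl
      · linear_combination hF - (y + t ^ 2) * hw
      · linear_combination hF - (y + r ^ 2) * hw
    rcases hs with rfl | rfl
    · exact this
    · nlinarith
  have : x ^ 2 = x₁ ^ 2 := by
    linear_combination h + (x₁ ^ 2 + 1) * (y ^ 2 + 1) * hy1
  exact (pow_left_inj₀ hx.le hx0.le two_ne_zero).mp this

theorem quartic_ne_zero_of_eq {a c e r s : ℤ} (hc : c ≠ 0) (he : e = 1 ∨ e = -1)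
    (h : c * (r ^ 4 - 6 * r ^ 2 * s ^ 2 + s ^ 4) - a * (4 * r * s * (r ^ 2 - s ^ 2)) = e * c)
    (hrs : r ^ 2 + s ^ 2 ≠ 1) : 4 * r * s * (r ^ 2 - s ^ 2) ≠ 0 := by
  intro h0
  have h1 : r ^ 4 - 6 * r ^ 2 * s ^ 2 + s ^ 4 = e := by
    refine mul_left_cancel₀ hc ?_
    linear_combination h + a * h0
  have key {x : ℤ} (hx : x ^ 4 = e) : x ^ 2 = 1 := by
    have h2 : (x ^ 2) ^ 2 = e := by linear_combination hx
    rcases he with rfl | rfl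
    · nlinarith
    · nlinarith
  have h2 : r * (s * (r ^ 2 - s ^ 2)) = 0 := by linarith
  rcases mul_eq_zero.mp h2 with h3 | h3
  · subst h3
    exact hrs (by linarith [key (x := s) (by linarith)])
  rcases mul_eq_zero.mp h3 with h3 | h3
  · subst h3
    exact hrs (by linarith [key (x := r) (by linarith)])
  · have : -4 * r ^ 4 = e := by linear_combination h1 - (6 * r ^ 2 - r ^ 2 - s ^ 2) * h3
    omega

theorem five_le_sq_add_sq {r s : ℤ} (hodd : Odd (r ^ 2 + s ^ 2)) (h : r ^ 2 + s ^ 2 ≠ 1) :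
    5 ≤ r ^ 2 + s ^ 2 := by
  have hr := sq_nonneg r
  have hs := sq_nonneg s
  obtain ⟨k, hk⟩ := hodd
  rcases Int.even_or_odd' r with ⟨u, rfl | rfl⟩ <;> rcases Int.even_or_odd' s with ⟨v, rfl | rfl⟩ <;>
    ring_nf at * <;> omega

theorem Prime.sq_add_one_le_of_pow_dvd {p r s : ℤ} (hp : Prime p) {m : ℕ} (hp2 : ¬p ∣ 2)
    (hrs : ¬p ∣ r ^ 2 + s ^ 2) (h0 : 4 * r * s * (r ^ 2 - s ^ 2) ≠ 0)
    (h : p ^ m ∣ 4 * r * s * (r ^ 2 - s ^ 2)) : (p ^ m) ^ 2 + 1 ≤ 2 * (r ^ 2 + s ^ 2) := by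
  have hcop {x : ℤ} (hx : ¬p ∣ x) : IsCoprime (p ^ m) x := (hp.coprime_iff_not_dvd.mpr hx).pow_left
  have hsq {x : ℤ} (hx0 : x ≠ 0) (hx : p ^ m ∣ x) : (p ^ m) ^ 2 ≤ x ^ 2 :=
    sq_le_sq.mpr (Int.natAbs_le_of_dvd_ne_zero hx hx0 |> fun h => by
      rw [Int.abs_eq_natAbs, Int.abs_eq_natAbs]
      exact_mod_cast h)
  have hpos {x : ℤ} (hx0 : x ≠ 0) : 1 ≤ x ^ 2 := by
    have : 0 < x ^ 2 := by positivity
    linarith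
  have hr0 : r ≠ 0 := by rintro rfl; simp at h0
  have hs0 : s ≠ 0 := by rintro rfl; simp at h0
  have hadd0 : r + s ≠ 0 := fun h => h0 (by linear_combination 4 * r * s * (r - s) * h)
  have hsub0 : r - s ≠ 0 := fun h => h0 (by linear_combination 4 * r * s * (r + s) * h)
  have hrsd : p ∣ r → ¬p ∣ s := fun h1 h2 =>
    hrs (dvd_add (dvd_pow h1 two_ne_zero) (dvd_pow h2 two_ne_zero))
  by_cases hr : p ∣ r
  · have hs := hrsd hr
    have h1 : p ^ m ∣ r * (2 * (2 * (s * ((r + s) * (r - s))))) := by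
      convert h using 1
      ring
    have h2 := ((hcop hp2).mul_right ((hcop hp2).mul_right ((hcop hs).mul_right
      ((hcop fun h => hs ((dvd_add_right hr).mp h)).mul_right
        (hcop fun h => hs ((dvd_sub_right hr).mp h)))))).dvd_of_dvd_mul_right h1
    linarith [hsq hr0 h2, hpos hs0, hpos hr0]
  by_cases hs : p ∣ s
  · have h1 : p ^ m ∣ s * (2 * (2 * (r * ((r + s) * (r - s))))) := by
      convert h using 1
      ring
    have h2 := ((hcop hp2).mul_right ((hcop hp2).mul_right ((hcop hr).mul_right
      ((hcop fun h => hr ((dvd_add_left hs).mp h)).mul_right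
        (hcop fun h => hr ((dvd_sub_left hs).mp h)))))).dvd_of_dvd_mul_right h1
    linarith [hsq hs0 h2, hpos hs0, hpos hr0]
  by_cases hadd : p ∣ r + s
  · have hsub : ¬p ∣ r - s := fun h' => by
      have h3 := dvd_add hadd h'
      rw [show r + s + (r - s) = 2 * r by ring] at h3
      exact (hp.dvd_or_dvd h3).elim hp2 hr
    have h1 : p ^ m ∣ (r + s) * (2 * (2 * (r * (s * (r - s))))) := by
      convert h using 1
      ring
    have h2 := ((hcop hp2).mul_right ((hcop hp2).mul_right ((hcop hr).mul_right
      ((hcop hs).mul_right (hcop hsub))))).dvd_of_dvd_mul_right h1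
    linarith [hsq hadd0 h2, hpos hsub0]
  · have h1 : p ^ m ∣ (r - s) * (2 * (2 * (r * (s * (r + s))))) := by
      convert h using 1
      ring
    have h2 := ((hcop hp2).mul_right ((hcop hp2).mul_right ((hcop hr).mul_right
      ((hcop hs).mul_right (hcop hadd))))).dvd_of_dvd_mul_right h1
    linarith [hsq hsub0 h2, hpos hadd0]

theorem abs_le_of_sq_add_sq_lt {r s k n : ℤ} (hk : 0 ≤ k) (h : r ^ 2 + s ^ 2 < n)
    (hn : n ≤ (k + 1) ^ 2) : r ∈ Finset.Icc (-k) k ∧ s ∈ Finset.Icc (-k) k := by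
  have key {x : ℤ} (hx : x ^ 2 < (k + 1) ^ 2) : x ∈ Finset.Icc (-k) k := by
    rw [Finset.mem_Icc]
    obtain ⟨h1, h2⟩ := abs_lt_of_sq_lt_sq' hx (by linarith)
    constructor <;> linarith
  exact ⟨key (by linarith [sq_nonneg s]), key (by linarith [sq_nonneg r])⟩

/-- For `|r|, |s| ≤ k`, each positive `a` prime to `p` that solves the quartic form equation
`c * (r ^ 4 - 6 * r ^ 2 * s ^ 2 + s ^ 4) - a * (4 * r * s * (r ^ 2 - s ^ 2)) = ±c` makes
`(a ^ 2 + c ^ 2) * (r ^ 2 + s ^ 2) ^ 4` at least `2048 * c ^ 6 + c ^ 2`. -/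
def SmallCase (c p k : ℤ) : Prop :=
  ∀ r ∈ Finset.Icc (-k) k, ∀ s ∈ Finset.Icc (-k) k, ∀ e ∈ ({1, -1} : Finset ℤ),
    4 * r * s * (r ^ 2 - s ^ 2) ≠ 0 →
    c * (r ^ 4 - 6 * r ^ 2 * s ^ 2 + s ^ 4 - e) % (4 * r * s * (r ^ 2 - s ^ 2)) = 0 →
    0 < c * (r ^ 4 - 6 * r ^ 2 * s ^ 2 + s ^ 4 - e) / (4 * r * s * (r ^ 2 - s ^ 2)) →
    c * (r ^ 4 - 6 * r ^ 2 * s ^ 2 + s ^ 4 - e) / (4 * r * s * (r ^ 2 - s ^ 2)) % p ≠ 0 →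
    2048 * c ^ 6 + c ^ 2 ≤ ((c * (r ^ 4 - 6 * r ^ 2 * s ^ 2 + s ^ 4 - e) /
      (4 * r * s * (r ^ 2 - s ^ 2))) ^ 2 + c ^ 2) * (r ^ 2 + s ^ 2) ^ 4

theorem smallCase_five : SmallCase 5 5 5 := by
  unfold SmallCase
  decide +kernel

theorem smallCase_nine : SmallCase 9 3 7 := by
  unfold SmallCase
  decide +kernel

theorem smallCase_thirteen : SmallCase 13 13 9 := by
  unfold SmallCase
  decide +kernel

theorem SmallCase.le {a c p k e r s X Y : ℤ} (hS : SmallCase c p k) (ha : 0 < a) (hpa : ¬p ∣ a)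
    (hk : 0 ≤ k) (hck : 7 * c ≤ (k + 1) ^ 2)
    (he : e = 1 ∨ e = -1) (h0 : 4 * r * s * (r ^ 2 - s ^ 2) ≠ 0)
    (h : c * (r ^ 4 - 6 * r ^ 2 * s ^ 2 + s ^ 4) - a * (4 * r * s * (r ^ 2 - s ^ 2)) = e * c)
    (hY : r ^ 2 + s ^ 2 = Y) (hX : X ^ 2 + c ^ 2 = (a ^ 2 + c ^ 2) * Y ^ 4) (hYc : Y < 7 * c) :
    2048 * c ^ 6 ≤ X ^ 2 := by
  obtain ⟨hr, hs⟩ := abs_le_of_sq_add_sq_lt hk (hY ▸ hYc) hck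
  have h1 : c * (r ^ 4 - 6 * r ^ 2 * s ^ 2 + s ^ 4 - e) = a * (4 * r * s * (r ^ 2 - s ^ 2)) := by
    linear_combination h
  have h2 := hS r hr s hs e (by simpa using he) h0
  rw [h1, Int.mul_emod_left, Int.mul_ediv_cancel _ h0] at h2
  have h3 := h2 rfl ha fun h => hpa (Int.dvd_of_emod_eq_zero h)
  rw [hY] at h3
  linarith

/-! ### Solutions with second coordinate divisible by the prime -/

theorem false_of_sq_add_one_eq_of_lt {N x₁ y₁ x₂ y₂ : ℤ} (hN : 38 ≤ N) (hx : 32 ≤ x₁) (hlt : x₁ < x₂)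
    (hy₁ : 0 < y₁) (hy₂ : 0 < y₂) (h₁ : x₁ ^ 2 + 1 = N * y₁ ^ 4) (h₂ : x₂ ^ 2 + 1 = N * y₂ ^ 4) :
    False := by
  have hsq : (32 : ℤ) ^ 2 ≤ x₁ ^ 2 := pow_le_pow_left₀ (by norm_num) hx 2
  have hmul : 38 * 32 ^ 2 ≤ N * x₁ ^ 2 := mul_le_mul hN hsq (by norm_num) (by linarith)
  exact (fourthPowerLinked_of_sq_add_one (by linarith) hy₁ hy₂ h₁ h₂).false_of_le (l := 4) (μ := 1)
    (by norm_num) one_pos (by norm_num) (by linarith) (by linarith) (by linarith) (by linarith) hlt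
    hy₁ hy₂ (by linarith) (by linarith)

theorem not_sq_add_one_lt_of_sq_add_prime_pow_four {a p : ℕ} (hp : p.Prime) (ha : 0 < a)
    (hpa : ¬p ∣ a) {x₁ y₁ x₂ y₂ : ℤ} (hx₁ : 0 < x₁) (hlt : x₁ < x₂) (hy₁ : 0 < y₁) (hy₂ : 0 < y₂)
    (h₁ : x₁ ^ 2 + 1 = ((a : ℤ) ^ 2 + (p : ℤ) ^ 4) * y₁ ^ 4)
    (h₂ : x₂ ^ 2 + 1 = ((a : ℤ) ^ 2 + (p : ℤ) ^ 4) * y₂ ^ 4) : False := by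
  have hp2 : (2 : ℤ) ≤ p := by exact_mod_cast hp.two_le
  have ha1 : (1 : ℤ) ≤ a := by exact_mod_cast ha
  have ha2 : (1 : ℤ) ^ 2 ≤ (a : ℤ) ^ 2 := pow_le_pow_left₀ (by norm_num) ha1 2
  have hp4 : (2 : ℤ) ^ 4 ≤ (p : ℤ) ^ 4 := pow_le_pow_left₀ (by norm_num) hp2 4
  have hsmall {x : ℤ} (hx : x = 4 ∨ x = 8 ∨ x = 9 ∨ x = 12 ∨ x = 21 ∨ x = 25)
      (h : x ^ 2 + 1 = (a : ℤ) ^ 2 + (p : ℤ) ^ 4) : False := by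
    rw [← h] at h₁ h₂
    have e₁ := eq_of_sq_add_one_eq_mul_pow_four hx hx₁ hy₁ h₁
    have e₂ := eq_of_sq_add_one_eq_mul_pow_four hx (hx₁.trans hlt) hy₂ h₂
    linarith
  by_cases hx : x₁ < 32
  · have hx2 : x₁ ^ 2 ≤ 31 ^ 2 := pow_le_pow_left₀ hx₁.le (by linarith) 2
    have hy : y₁ = 1 := by
      by_contra hne
      have h2 : 2 ≤ y₁ := by omega
      rcases h2.eq_or_lt with rfl | h3
      · have : x₁ ^ 2 % 4 = 0 ∨ x₁ ^ 2 % 4 = 1 := by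
          rcases Int.even_or_odd' x₁ with ⟨u, rfl | rfl⟩ <;> ring_nf <;> omega
        omega
      · have h4 : (3 : ℤ) ^ 4 ≤ y₁ ^ 4 := pow_le_pow_left₀ (by norm_num) (by linarith) 4
        have h5 : (17 : ℤ) * 3 ^ 4 ≤ ((a : ℤ) ^ 2 + (p : ℤ) ^ 4) * y₁ ^ 4 :=
          mul_le_mul (by linarith) h4 (by norm_num) (by linarith)
        linarith
    subst hy
    have h₁' : x₁ ^ 2 + 1 = (a : ℤ) ^ 2 + (p : ℤ) ^ 4 := by linarith
    refine hsmall ?_ h₁'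
    have hp5 : p < 6 := by
      by_contra h6
      have h7 : (6 : ℤ) ^ 4 ≤ (p : ℤ) ^ 4 := pow_le_pow_left₀ (by norm_num) (by omega) 4
      linarith
    have ha32 : (a : ℤ) < x₁ := by
      refine lt_of_pow_lt_pow_left₀ 2 hx₁.le ?_
      linarith
    have ha32' : a < 32 := by omega
    clear h₁ h₂ hsmall hlt hy₂ hpa
    have hp4' : p ≠ 4 := by rintro rfl; revert hp; decide
    interval_cases p
    · omega
    · omega
    · interval_cases x₁ <;> first | omega | (exfalso; interval_cases a <;> omega)
    · interval_cases x₁ <;> first | omega | (exfalso; interval_cases a <;> omega)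
    · omega
    · interval_cases x₁ <;> first | omega | (exfalso; interval_cases a <;> omega)
  · by_cases hN : 38 ≤ (a : ℤ) ^ 2 + (p : ℤ) ^ 4
    · exact false_of_sq_add_one_eq_of_lt hN (by linarith) hlt hy₁ hy₂ h₁ h₂
    · have hp3 : p < 3 := by
        by_contra h3
        have h7 : (3 : ℤ) ^ 4 ≤ (p : ℤ) ^ 4 := pow_le_pow_left₀ (by norm_num) (by omega) 4
        linarith
      have hp2' : p = 2 := by omega
      subst hp2'
      have ha5 : a < 5 := by
        by_contra h5
        have h7 : (5 : ℤ) ^ 2 ≤ (a : ℤ) ^ 2 := pow_le_pow_left₀ (by norm_num) (by omega) 2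
        push_cast at *
        linarith
      have ha13 : a = 1 ∨ a = 3 := by omega
      rcases ha13 with rfl | rfl
      · exact hsmall (x := 4) (by norm_num) (by norm_num)
      · have h6 : (5 * y₁ ^ 2 - x₁) * (5 * y₁ ^ 2 + x₁) = 1 := by
          push_cast at h₁
          linear_combination -h₁
        have h7 := Int.eq_one_or_neg_one_of_mul_eq_one' h6
        rcases h7 with h7 | h7 <;> omega

theorem not_sq_add_one_lt_of_sq_mul {a p : ℕ} (hp : p.Prime) (ha : 0 < a) {x₁ y₁ x₂ y₂ : ℤ}
    (hx₁ : 0 < x₁) (hlt : x₁ < x₂) (hy₁ : 0 < y₁) (hy₂ : 0 < y₂)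
    (hp5 : 5 ≤ p)
    (h₁ : x₁ ^ 2 + 1 = (((a : ℤ) ^ 2 + (p : ℤ) ^ 2) * (p : ℤ) ^ 2) * y₁ ^ 4)
    (h₂ : x₂ ^ 2 + 1 = (((a : ℤ) ^ 2 + (p : ℤ) ^ 2) * (p : ℤ) ^ 2) * y₂ ^ 4) : False := by
  have ha2 : (1 : ℤ) ^ 2 ≤ (a : ℤ) ^ 2 := pow_le_pow_left₀ (by norm_num) (by omega) 2
  have hp2 : (5 : ℤ) ^ 2 ≤ (p : ℤ) ^ 2 := pow_le_pow_left₀ (by norm_num) (by omega) 2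
  have hN : (26 : ℤ) * 5 ^ 2 ≤ ((a : ℤ) ^ 2 + (p : ℤ) ^ 2) * (p : ℤ) ^ 2 :=
    mul_le_mul (by linarith) hp2 (by norm_num) (by positivity)
  by_cases hx : x₁ < 32
  · have hx2 : x₁ ^ 2 ≤ 31 ^ 2 := pow_le_pow_left₀ hx₁.le (by linarith) 2
    have hy : y₁ = 1 := by
      by_contra hne
      have h4 : (2 : ℤ) ^ 4 ≤ y₁ ^ 4 := pow_le_pow_left₀ (by norm_num) (by omega) 4
      have h5 := mul_le_mul hN h4 (by norm_num) (by positivity)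
      linarith
    subst hy
    have hp7 : p < 6 := by
      by_contra h6
      have h7 : (6 : ℤ) ^ 2 ≤ (p : ℤ) ^ 2 := pow_le_pow_left₀ (by norm_num) (by omega) 2
      have h8 : (37 : ℤ) * 6 ^ 2 ≤ ((a : ℤ) ^ 2 + (p : ℤ) ^ 2) * (p : ℤ) ^ 2 :=
        mul_le_mul (by linarith) h7 (by norm_num) (by positivity)
      linarith
    have hp' : p = 5 := by omega
    subst hp'
    push_cast at h₁
    have ha4 : a < 4 := by
      by_contra h6
      have h7 : (4 : ℤ) ^ 2 ≤ (a : ℤ) ^ 2 := pow_le_pow_left₀ (by norm_num) (by omega) 2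
      linarith
    have hx26 : 25 ≤ x₁ := by
      by_contra h6
      have h7 : x₁ ^ 2 ≤ 24 ^ 2 := pow_le_pow_left₀ hx₁.le (by omega) 2
      linarith
    clear h₂ hN ha2 hp2 hp hx2
    interval_cases a <;> interval_cases x₁ <;> omega
  · exact false_of_sq_add_one_eq_of_lt (by linarith) (by linarith) hlt hy₁ hy₂ h₁ h₂

theorem prime_mod_four_eq_one_of_sq_dvd {p : ℕ} (hp : p.Prime) {x : ℤ}
    (h : (p : ℤ) ^ 2 ∣ x ^ 2 + 1) : p % 4 = 1 := by
  have hp2 : p ≠ 2 := by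
    rintro rfl
    have h4 : (4 : ℤ) ∣ x ^ 2 + 1 := by simpa using h
    rcases Int.even_or_odd' x with ⟨u, rfl | rfl⟩ <;> ring_nf at h4 <;> omega
  have : Fact p.Prime := ⟨hp⟩
  have h1 : ((x ^ 2 + 1 : ℤ) : ZMod p) = 0 :=
    (ZMod.intCast_zmod_eq_zero_iff_dvd _ p).mpr ((dvd_pow_self _ two_ne_zero).trans h)
  have h3 := ZMod.mod_four_ne_three_of_sq_eq_neg_one (p := p) (y := (x : ZMod p)) (by
    push_cast at h1
    linear_combination h1)
  have := hp.eq_two_or_odd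
  omega

/-! ### Solutions prime to `p` -/

/-- Positive solutions of `X² + c² = (a² + c²)Y⁴`, where `c = p ^ m`, with `Y` prime to `p` and
`Y ≠ 1`. -/
structure PrimitiveSolution (a : ℤ) (p m : ℕ) (X Y : ℤ) : Prop where
  X_pos : 0 < X
  Y_pos : 0 < Y
  eq : X ^ 2 + ((p : ℤ) ^ m) ^ 2 = (a ^ 2 + ((p : ℤ) ^ m) ^ 2) * Y ^ 4
  not_dvd : ¬(p : ℤ) ∣ Y
  ne_one : Y ≠ 1

namespace PrimitiveSolution

variable {a : ℤ} {p m : ℕ} {X Y X₁ Y₁ X₂ Y₂ X₃ Y₃ : ℤ}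

theorem not_dvd_coeff (hp : p.Prime) (hm : m ≠ 0) (ha : ¬(p : ℤ) ∣ a) :
    ¬(p : ℤ) ∣ a ^ 2 + ((p : ℤ) ^ m) ^ 2 := by
  rw [dvd_add_left (dvd_pow (dvd_pow_self _ hm) two_ne_zero)]
  exact fun h => ha ((Nat.prime_iff_prime_int.mp hp).dvd_of_dvd_pow h)

theorem not_dvd_X (h : PrimitiveSolution a p m X Y) (hp : p.Prime) (hm : m ≠ 0)
    (ha : ¬(p : ℤ) ∣ a) : ¬(p : ℤ) ∣ X := by
  intro hX
  have hp' := Nat.prime_iff_prime_int.mp hp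
  have h1 : (p : ℤ) ∣ (a ^ 2 + ((p : ℤ) ^ m) ^ 2) * Y ^ 4 :=
    h.eq ▸ dvd_add (dvd_pow hX two_ne_zero) (dvd_pow (dvd_pow_self _ hm) two_ne_zero)
  exact (hp'.dvd_or_dvd h1).elim (not_dvd_coeff hp hm ha)
    fun h2 => h.not_dvd (hp'.dvd_of_dvd_pow h2)

theorem linked (h₁ : PrimitiveSolution a p m X₁ Y₁) (h₂ : PrimitiveSolution a p m X₂ Y₂)
    (hp : p.Prime) (hm : m ≠ 0) (ha0 : 0 < a) (ha : ¬(p : ℤ) ∣ a)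
    (hsq : ¬IsSquare (a ^ 2 + ((p : ℤ) ^ m) ^ 2))
    (hpell : ∃ x y : ℤ, x ^ 2 - (a ^ 2 + ((p : ℤ) ^ m) ^ 2) * y ^ 2 = -1) :
    FourthPowerLinked (a ^ 2 + ((p : ℤ) ^ m) ^ 2) ((p : ℤ) ^ m) X₁ Y₁ X₂ Y₂ :=
  fourthPowerLinked_of_not_dvd hp ha0.ne' ha (h₁.not_dvd_X hp hm ha) (h₂.not_dvd_X hp hm ha)
    h₁.Y_pos h₂.Y_pos hsq hpell h₁.eq h₂.eq

theorem exists_quartic_form (h : PrimitiveSolution a p m X Y)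
    (hp : p.Prime) (hm : m ≠ 0) (ha0 : 0 < a) (ha : ¬(p : ℤ) ∣ a)
    (hsq : ¬IsSquare (a ^ 2 + ((p : ℤ) ^ m) ^ 2))
    (hpell : ∃ x y : ℤ, x ^ 2 - (a ^ 2 + ((p : ℤ) ^ m) ^ 2) * y ^ 2 = -1) :
    5 ≤ Y ∧ Odd Y ∧ (p ≠ 2 → ((p : ℤ) ^ m) ^ 2 + 1 ≤ 2 * Y) ∧
    ∃ r s e : ℤ, (e = 1 ∨ e = -1) ∧ r ^ 2 + s ^ 2 = Y ∧ 4 * r * s * (r ^ 2 - s ^ 2) ≠ 0 ∧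
      (p : ℤ) ^ m * (r ^ 4 - 6 * r ^ 2 * s ^ 2 + s ^ 4) - a * (4 * r * s * (r ^ 2 - s ^ 2)) =
        e * (p : ℤ) ^ m := by
  have hp' := Nat.prime_iff_prime_int.mp hp
  have hX := h.not_dvd_X hp hm ha
  have hodd : Odd Y := odd_of_sq_add_sq_eq (isCoprime_prime_pow hp hX m) h.eq
  obtain ⟨r, s, e, he, hrs, hf⟩ := exists_quartic_form_eq hp ha0.ne' ha hX h.Y_pos hsq hpell h.eq
  have hc : (p : ℤ) ^ m ≠ 0 := pow_ne_zero _ hp'.ne_zero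
  have h0 := quartic_ne_zero_of_eq hc he hf (hrs ▸ h.ne_one)
  refine ⟨hrs ▸ five_le_sq_add_sq (hrs ▸ hodd) (hrs ▸ h.ne_one), hodd, fun hp2 => ?_,
    r, s, e, he, hrs, h0, hf⟩
  rw [← hrs]
  refine hp'.sq_add_one_le_of_pow_dvd (fun h2 => hp2 ?_) (hrs ▸ h.not_dvd) h0 ?_
  · exact (Nat.prime_dvd_prime_iff_eq hp Nat.prime_two).mp (by exact_mod_cast h2)
  · refine (isCoprime_prime_pow hp ha m).symm.dvd_of_dvd_mul_left
      ⟨r ^ 4 - 6 * r ^ 2 * s ^ 2 + s ^ 4 - e, ?_⟩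
    linear_combination -hf

theorem sq_lt_coeff (ha0 : 0 < a) : ((p : ℤ) ^ m) ^ 2 < a ^ 2 + ((p : ℤ) ^ m) ^ 2 := by
  have : 0 < a ^ 2 := by positivity
  linarith

theorem le_sq_X (h : PrimitiveSolution a p m X Y) (ha0 : 0 < a) {n : ℤ} (hn : 0 ≤ n)
    (hY : n ≤ Y) : ((p : ℤ) ^ m) ^ 2 * n ^ 4 + n ^ 4 - ((p : ℤ) ^ m) ^ 2 ≤ X ^ 2 := by
  have h1 : n ^ 4 ≤ Y ^ 4 := pow_le_pow_left₀ hn hY 4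
  have h2 : (((p : ℤ) ^ m) ^ 2 + 1) * n ^ 4 ≤ (a ^ 2 + ((p : ℤ) ^ m) ^ 2) * Y ^ 4 :=
    mul_le_mul (by linarith [sq_lt_coeff (p := p) (m := m) ha0]) h1 (by positivity) (by positivity)
  linarith [h.eq]

theorem mul_pow_six_le (h : PrimitiveSolution a p m X Y)
    (hp : p.Prime) (hp2 : p ≠ 2) (hm : m ≠ 0) (ha0 : 0 < a) (ha : ¬(p : ℤ) ∣ a)
    (hsq : ¬IsSquare (a ^ 2 + ((p : ℤ) ^ m) ^ 2))
    (hpell : ∃ x y : ℤ, x ^ 2 - (a ^ 2 + ((p : ℤ) ^ m) ^ 2) * y ^ 2 = -1)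
    (hc : (p : ℤ) ^ m = 5 ∧ p = 5 ∨ (p : ℤ) ^ m = 9 ∧ p = 3 ∨ (p : ℤ) ^ m = 13 ∧ p = 13 ∨
      14 ≤ (p : ℤ) ^ m) :
    2048 * ((p : ℤ) ^ m) ^ 6 ≤ X ^ 2 := by
  obtain ⟨-, -, hcY, r, s, e, he, hrs, h0, hf⟩ := h.exists_quartic_form hp hm ha0 ha hsq hpell
  by_cases hY : 7 * (p : ℤ) ^ m ≤ Y
  · have hpos : 0 < (p : ℤ) ^ m := pow_pos (by exact_mod_cast hp.pos) m
    have h1 := h.le_sq_X ha0 (by linarith) hY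
    generalize (p : ℤ) ^ m = c at h1 hpos
    have h2 : c ^ 2 * 1 ≤ c ^ 2 * c ^ 2 := by
      gcongr
      exact one_le_pow₀ (by linarith)
    have h3 : 0 ≤ c ^ 6 := by positivity
    linarith [sq_nonneg c]
  · rw [not_le] at hY
    have hXY := h.eq
    rcases hc with ⟨hc, rfl⟩ | ⟨hc, rfl⟩ | ⟨hc, rfl⟩ | hc
    · rw [hc] at hf hY hXY ⊢
      exact smallCase_five.le ha0 ha (by norm_num) (by norm_num) he h0 hf hrs hXY hY
    · rw [hc] at hf hY hXY ⊢
      exact smallCase_nine.le ha0 ha (by norm_num) (by norm_num) he h0 hf hrs hXY hY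
    · rw [hc] at hf hY hXY ⊢
      exact smallCase_thirteen.le ha0 ha (by norm_num) (by norm_num) he h0 hf hrs hXY hY
    · have h1 := hcY hp2
      have h2 : 14 * (p : ℤ) ^ m ≤ ((p : ℤ) ^ m) ^ 2 := by
        rw [sq]
        exact mul_le_mul_of_nonneg_right hc (by linarith)
      linarith

theorem not_lt_of_odd_prime (h₁ : PrimitiveSolution a p m X₁ Y₁)
    (h₂ : PrimitiveSolution a p m X₂ Y₂) (hp : p.Prime) (hp2 : p ≠ 2) (hm : m ≠ 0) (ha0 : 0 < a)
    (ha : ¬(p : ℤ) ∣ a) (hsq : ¬IsSquare (a ^ 2 + ((p : ℤ) ^ m) ^ 2))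
    (hpell : ∃ x y : ℤ, x ^ 2 - (a ^ 2 + ((p : ℤ) ^ m) ^ 2) * y ^ 2 = -1)
    (hc : (p : ℤ) ^ m = 5 ∧ p = 5 ∨ (p : ℤ) ^ m = 9 ∧ p = 3 ∨ (p : ℤ) ^ m = 13 ∧ p = 13 ∨
      14 ≤ (p : ℤ) ^ m) : ¬X₁ < X₂ := fun hX => by
  have hc5 : 5 ≤ p ^ m := by
    have : (5 : ℤ) ≤ (p : ℤ) ^ m := by omega
    exact_mod_cast this
  exact (h₁.linked h₂ hp hm ha0 ha hsq hpell).false_of_odd_prime_pow hp hp2 hm hc5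
    (not_dvd_coeff hp hm ha) (h₁.not_dvd_X hp hm ha) h₁.not_dvd h₂.not_dvd (sq_lt_coeff ha0)
    h₁.eq h₂.eq h₁.X_pos hX h₁.Y_pos h₂.Y_pos (h₁.mul_pow_six_le hp hp2 hm ha0 ha hsq hpell hc)

theorem Y_eq_five_of_one (h : PrimitiveSolution 1 2 2 X Y) (hp : (2 : ℕ).Prime)
    (hsq : ¬IsSquare ((1 : ℤ) ^ 2 + (((2 : ℕ) : ℤ) ^ 2) ^ 2))
    (hpell : ∃ x y : ℤ, x ^ 2 - ((1 : ℤ) ^ 2 + (((2 : ℕ) : ℤ) ^ 2) ^ 2) * y ^ 2 = -1) : Y = 5 := by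
  obtain ⟨-, -, -, r, s, e, he, hrs, h0, hf⟩ :=
    h.exists_quartic_form hp two_ne_zero one_pos (by norm_num) hsq hpell
  have hF : simplestQuartic 1 r s = e := by
    simp only [simplestQuartic]
    push_cast at hf
    linarith
  rcases simplestQuartic_one_eq_one (hF ▸ he) with rfl | rfl | h5
  · simp at h0
  · simp at h0
  · linarith

theorem thirteen_le_Y (h : PrimitiveSolution a 2 2 X Y) (hp : (2 : ℕ).Prime) (ha0 : 0 < a)
    (ha1 : a ≠ 1) (ha : ¬((2 : ℕ) : ℤ) ∣ a)
    (hsq : ¬IsSquare (a ^ 2 + (((2 : ℕ) : ℤ) ^ 2) ^ 2))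
    (hpell : ∃ x y : ℤ, x ^ 2 - (a ^ 2 + (((2 : ℕ) : ℤ) ^ 2) ^ 2) * y ^ 2 = -1) : 13 ≤ Y := by
  obtain ⟨-, -, -, r, s, e, he, hrs, h0, hf⟩ := h.exists_quartic_form hp two_ne_zero ha0 ha hsq hpell
  by_contra hlt
  obtain ⟨hr, hs⟩ := abs_le_of_sq_add_sq_lt (r := r) (s := s) (k := 3) (n := 13) (by norm_num)
    (by linarith) (by norm_num)
  have hodd : Odd Y := odd_of_sq_add_sq_eq (isCoprime_prime_pow hp (h.not_dvd_X hp two_ne_zero ha) 2)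
    h.eq
  rw [← hrs] at hodd hlt
  push_cast at hf ha
  clear hrs h hsq hpell
  rw [Finset.mem_Icc] at hr hs
  obtain ⟨hr1, hr2⟩ := hr
  obtain ⟨hs1, hs2⟩ := hs
  obtain ⟨k, hk⟩ := hodd
  interval_cases r <;> interval_cases s <;> omega

theorem not_lt_of_two (h₁ : PrimitiveSolution a 2 2 X₁ Y₁) (h₂ : PrimitiveSolution a 2 2 X₂ Y₂)
    (hp : (2 : ℕ).Prime) (ha0 : 0 < a) (ha : ¬((2 : ℕ) : ℤ) ∣ a)
    (hsq : ¬IsSquare (a ^ 2 + (((2 : ℕ) : ℤ) ^ 2) ^ 2))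
    (hpell : ∃ x y : ℤ, x ^ 2 - (a ^ 2 + (((2 : ℕ) : ℤ) ^ 2) ^ 2) * y ^ 2 = -1) : ¬X₁ < X₂ := by
  intro hX
  by_cases ha1 : a = 1
  · subst ha1
    have e₁ := h₁.Y_eq_five_of_one hp hsq hpell
    have e₂ := h₂.Y_eq_five_of_one hp hsq hpell
    have := lt_of_sq_add_sq_eq (by positivity) h₁.X_pos.le hX h₂.Y_pos.le h₁.eq h₂.eq
    linarith
  · have hY := h₁.thirteen_le_Y hp ha0 ha1 ha hsq hpell
    have hX₁ := h₁.le_sq_X ha0 (by norm_num) hY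
    have hlink := h₁.linked h₂ hp two_ne_zero ha0 ha hsq hpell
    have hN : (5 : ℤ) ^ 2 ≤ a ^ 2 := by
      refine pow_le_pow_left₀ (by norm_num) ?_ 2
      have ha3 : a ≠ 3 := by
        rintro rfl
        exact hsq ⟨5, by norm_num⟩
      push_cast at ha
      omega
    have hE₁ := h₁.eq
    have hE₂ := h₂.eq
    norm_num at hX₁ hlink hE₁ hE₂
    have hmul : 41 * 485521 ≤ (a ^ 2 + 16) * X₁ ^ 2 :=
      mul_le_mul (by linarith) (by linarith) (by norm_num) (by positivity)
    have h128 : 32 * 4 ≤ X₁ := by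
      refine abs_le_of_sq_le_sq' ?_ h₁.X_pos.le |>.2
      linarith
    exact hlink.false_of_le (l := 1) (μ := 1) (by norm_num) (by norm_num) (by norm_num)
      (by linarith) (by linarith) (by linarith) h128 hX h₁.Y_pos h₂.Y_pos (by linarith)
      (by linarith)

theorem false_of_lt_of_lt (h₁ : PrimitiveSolution a p 1 X₁ Y₁) (h₂ : PrimitiveSolution a p 1 X₂ Y₂)
    (h₃ : PrimitiveSolution a p 1 X₃ Y₃) (hp : p.Prime) (ha0 : 0 < a) (ha : ¬(p : ℤ) ∣ a)
    (hsq : ¬IsSquare (a ^ 2 + ((p : ℤ) ^ 1) ^ 2))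
    (hpell : ∃ x y : ℤ, x ^ 2 - (a ^ 2 + ((p : ℤ) ^ 1) ^ 2) * y ^ 2 = -1)
    (h₁₂ : X₁ < X₂) (h₂₃ : X₂ < X₃) : False := by
  obtain ⟨h5, -, hcY, -⟩ := h₁.exists_quartic_form hp one_ne_zero ha0 ha hsq hpell
  refine (h₁.linked h₂ hp one_ne_zero ha0 ha hsq hpell).false_of_lt_of_lt
    (h₂.linked h₃ hp one_ne_zero ha0 ha hsq hpell) (pow_pos (by exact_mod_cast hp.pos) 1)
    (sq_lt_coeff ha0) h₁.eq h₂.eq h₃.eq h₁.X_pos h₁₂ h₂₃ h5 h₂.Y_pos h₃.Y_pos ?_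
  by_cases hp2 : p = 2
  · subst hp2
    push_cast
    linarith
  · linarith [hcY hp2]

end PrimitiveSolution

/-! ### Counting -/

theorem encard_le_one_of_not_fst_lt {s : Set (ℤ × ℤ)} (hinj : Set.InjOn Prod.fst s)
    (h : ∀ x ∈ s, ∀ y ∈ s, ¬x.1 < y.1) : s.encard ≤ 1 := by
  rw [Set.encard_le_one_iff]
  intro x y hx hy
  exact hinj hx hy (le_antisymm (not_lt.mp (h y hy x hx)) (not_lt.mp (h x hx y hy)))

theorem encard_le_two_of_not_fst_lt {s : Set (ℤ × ℤ)} (hinj : Set.InjOn Prod.fst s)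
    (h : ∀ x ∈ s, ∀ y ∈ s, ∀ z ∈ s, x.1 < y.1 → ¬y.1 < z.1) : s.encard ≤ 2 := by
  by_contra hlt
  have h3 : 3 ≤ s.encard := by
    rw [not_le] at hlt
    exact Order.add_one_le_of_lt hlt
  obtain ⟨t, hts, ht⟩ := Set.exists_subset_encard_eq h3
  obtain ⟨x, y, z, hxy, hxz, hyz, rfl⟩ := Set.encard_eq_three.mp ht
  have hx : x ∈ s := hts (by simp)
  have hy : y ∈ s := hts (by simp)
  have hz : z ∈ s := hts (by simp)
  rcases lt_or_gt_of_ne (hinj.ne hx hy hxy) with h1 | h1 <;>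
    rcases lt_or_gt_of_ne (hinj.ne hx hz hxz) with h2 | h2 <;>
      rcases lt_or_gt_of_ne (hinj.ne hy hz hyz) with h4 | h4
  · exact h x hx y hy z hz h1 h4
  · exact h x hx z hz y hy h2 h4
  · exact h x hx y hy z hz h1 h4
  · exact h z hz x hx y hy h2 h1
  · exact h y hy x hx z hz h1 h2
  · exact h y hy x hx z hz h1 h2
  · exact h y hy z hz x hx h4 h2
  · exact h z hz y hy x hx h4 h1

theorem exists_sq_add_one_eq_of_eq_mul {D c q X Y : ℤ} (hc : 0 < c) (hX : 0 < X)
    (h : X ^ 2 + c ^ 2 = D * Y ^ 4) (hq : D * Y ^ 4 = c ^ 2 * q) :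
    ∃ x, 0 < x ∧ X = c * x ∧ x ^ 2 + 1 = q := by
  have h1 : c ^ 2 ∣ X ^ 2 := ⟨q - 1, by linear_combination h + hq⟩
  obtain ⟨x, rfl⟩ := (Int.pow_dvd_pow_iff two_ne_zero).mp h1
  refine ⟨x, pos_of_mul_pos_right hX hc.le, rfl, ?_⟩
  refine mul_left_cancel₀ (pow_ne_zero 2 hc.ne') ?_
  linear_combination h + hq

theorem exists_sq_add_one_eq_of_prime_dvd {a p m : ℕ} (hp : p.Prime) (hm : m = 1 ∨ m = 2) {X Y : ℤ}
    (hX : 0 < X) (hY : 0 < Y)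
    (h : X ^ 2 + ((p : ℤ) ^ m) ^ 2 = ((a : ℤ) ^ 2 + ((p : ℤ) ^ m) ^ 2) * Y ^ 4)
    (hpY : (p : ℤ) ∣ Y) :
    ∃ x y, 0 < x ∧ 0 < y ∧ X = (p : ℤ) ^ m * x ∧
      x ^ 2 + 1 = (((a : ℤ) ^ 2 + ((p : ℤ) ^ m) ^ 2) * (p : ℤ) ^ (4 - 2 * m)) * y ^ 4 := by
  have hp0 : (0 : ℤ) < p := by exact_mod_cast hp.pos
  obtain ⟨y, rfl⟩ := hpY
  obtain ⟨x, hx, hXx, hxy⟩ := exists_sq_add_one_eq_of_eq_mul (pow_pos hp0 m) hX h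
    (q := (((a : ℤ) ^ 2 + ((p : ℤ) ^ m) ^ 2) * (p : ℤ) ^ (4 - 2 * m)) * y ^ 4) (by
      rcases hm with rfl | rfl <;> ring)
  exact ⟨x, y, hx, pos_of_mul_pos_right hY hp0.le, hXx, hxy⟩

theorem not_lt_of_dvd {a p m : ℕ} (hp : p.Prime) (hm : m = 1 ∨ m = 2) (ha : 0 < a)
    (hpa : ¬p ∣ a) {X₁ Y₁ X₂ Y₂ : ℤ} (hX₁ : 0 < X₁) (hY₁ : 0 < Y₁) (hX₂ : 0 < X₂) (hY₂ : 0 < Y₂)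
    (h₁ : X₁ ^ 2 + ((p : ℤ) ^ m) ^ 2 = ((a : ℤ) ^ 2 + ((p : ℤ) ^ m) ^ 2) * Y₁ ^ 4)
    (h₂ : X₂ ^ 2 + ((p : ℤ) ^ m) ^ 2 = ((a : ℤ) ^ 2 + ((p : ℤ) ^ m) ^ 2) * Y₂ ^ 4)
    (hpY₁ : (p : ℤ) ∣ Y₁) (hpY₂ : (p : ℤ) ∣ Y₂) : ¬X₁ < X₂ := by
  intro hlt
  have hp0 : (0 : ℤ) < p := by exact_mod_cast hp.pos
  obtain ⟨x₁, y₁, hx₁, hy₁, rfl, e₁⟩ := exists_sq_add_one_eq_of_prime_dvd hp hm hX₁ hY₁ h₁ hpY₁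
  obtain ⟨x₂, y₂, hx₂, hy₂, rfl, e₂⟩ := exists_sq_add_one_eq_of_prime_dvd hp hm hX₂ hY₂ h₂ hpY₂
  have hlt' : x₁ < x₂ := lt_of_mul_lt_mul_left hlt (by positivity)
  rcases hm with rfl | rfl
  · norm_num only at e₁ e₂
    rw [pow_one] at e₁ e₂
    have hp4 : p % 4 = 1 := prime_mod_four_eq_one_of_sq_dvd hp
      ((dvd_mul_left _ _).trans (Dvd.intro _ e₁.symm))
    have := hp.one_lt
    exact not_sq_add_one_lt_of_sq_mul hp ha hx₁ hlt' hy₁ hy₂ (by omega) e₁ e₂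
  · refine not_sq_add_one_lt_of_sq_add_prime_pow_four hp ha hpa hx₁ hlt' hy₁ hy₂ ?_ ?_
    · linear_combination e₁
    · linear_combination e₂

theorem prime_mod_four_eq_one_of_dvd {a p : ℕ} (hp : p.Prime) {X Y : ℤ} (hX : 0 < X) (hY : 0 < Y)
    (h : X ^ 2 + ((p : ℤ) ^ 1) ^ 2 = ((a : ℤ) ^ 2 + ((p : ℤ) ^ 1) ^ 2) * Y ^ 4)
    (hpY : (p : ℤ) ∣ Y) : p % 4 = 1 := by
  obtain ⟨x, y, -, -, -, e⟩ := exists_sq_add_one_eq_of_prime_dvd hp (.inl rfl) hX hY h hpY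
  exact prime_mod_four_eq_one_of_sq_dvd hp ((dvd_mul_left _ _).trans (Dvd.intro _ e.symm))

theorem prime_pow_cases {p m : ℕ} (hp : p.Prime) (hp2 : p ≠ 2)
    (hm : m = 2 ∨ m = 1 ∧ p % 4 = 1) :
    (p : ℤ) ^ m = 5 ∧ p = 5 ∨ (p : ℤ) ^ m = 9 ∧ p = 3 ∨ (p : ℤ) ^ m = 13 ∧ p = 13 ∨
      14 ≤ (p : ℤ) ^ m := by
  have h2 := hp.two_le
  rcases hm with rfl | ⟨rfl, h4⟩
  · by_cases h3 : p = 3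
    · subst h3
      norm_num
    · have : (4 : ℤ) ^ 2 ≤ (p : ℤ) ^ 2 := pow_le_pow_left₀ (by norm_num) (by omega) 2
      omega
  · rw [pow_one]
    have h9 : p ≠ 9 := by
      rintro rfl
      revert hp
      decide
    omega

/-- Corollary 1.1: Let `a` and `m` be positive integers with `m = 1` or `m = 2`, and `p` a
prime with `gcd(a, p) = 1` and `a² + p^(2m)` not a perfect square. Suppose the negative Pell
equation `x² − (a² + p^(2m))·y² = −1` has an integer solution. Then the equation
`X² − (a² + p^(2m))·Y⁴ = −p^(2m)` has at most three solutions in positive integers. -/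
theorem at_most_three_solutions
    (a m p : ℕ) (ha : 0 < a) (hm : m = 1 ∨ m = 2) (hp : p.Prime)
    (hgcd : Nat.gcd a p = 1)
    (hnotsq : ¬ IsSquare ((a : ℤ) ^ 2 + (p : ℤ) ^ (2 * m)))
    (hpell : ∃ x y : ℤ, x ^ 2 - ((a : ℤ) ^ 2 + (p : ℤ) ^ (2 * m)) * y ^ 2 = -1) :
    {XY : ℤ × ℤ | 0 < XY.1 ∧ 0 < XY.2 ∧
      XY.1 ^ 2 - ((a : ℤ) ^ 2 + (p : ℤ) ^ (2 * m)) * XY.2 ^ 4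
        = -((p : ℤ) ^ (2 * m))}.encard ≤ 3 := by
  rw [mul_comm 2 m] at *
  simp only [pow_mul] at *
  have hm0 : m ≠ 0 := by omega
  have ha0 : (0 : ℤ) < a := by exact_mod_cast ha
  have hpa : ¬p ∣ a := fun h => hp.one_lt.ne' (Nat.dvd_one.mp (hgcd ▸ Nat.dvd_gcd h dvd_rfl))
  have hpa' : ¬(p : ℤ) ∣ a := by exact_mod_cast hpa
  set S := {XY : ℤ × ℤ | 0 < XY.1 ∧ 0 < XY.2 ∧
    XY.1 ^ 2 - ((a : ℤ) ^ 2 + ((p : ℤ) ^ m) ^ 2) * XY.2 ^ 4 = -((p : ℤ) ^ m) ^ 2} with hS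
  have hSeq {XY : ℤ × ℤ} (h : XY ∈ S) :
      XY.1 ^ 2 + ((p : ℤ) ^ m) ^ 2 = ((a : ℤ) ^ 2 + ((p : ℤ) ^ m) ^ 2) * XY.2 ^ 4 := by
    linear_combination h.2.2
  have hD : 0 < (a : ℤ) ^ 2 + ((p : ℤ) ^ m) ^ 2 := by positivity
  have hinj : Set.InjOn Prod.fst S := by
    intro x hx y hy hxy
    refine Prod.ext hxy ?_
    have h1 : x.2 ^ 4 = y.2 ^ 4 := by
      refine mul_left_cancel₀ hD.ne' ?_
      rw [← hSeq hx, ← hSeq hy, hxy]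
    exact (pow_left_inj₀ hx.2.1.le hy.2.1.le four_ne_zero).mp h1
  set T := {XY ∈ S | PrimitiveSolution a p m XY.1 XY.2}
  set U := {XY ∈ S | (p : ℤ) ∣ XY.2}
  have hsub : S ⊆ {((a : ℤ), 1)} ∪ (T ∪ U) := by
    intro x hx
    by_cases h1 : x.2 = 1
    · left
      have h2 := hSeq hx
      rw [h1] at h2
      refine Prod.ext ?_ h1
      exact (pow_left_inj₀ hx.1.le ha0.le two_ne_zero).mp (by linarith)
    · right
      by_cases h2 : (p : ℤ) ∣ x.2
      · exact .inr ⟨hx, h2⟩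
      · exact .inl ⟨hx, hx.1, hx.2.1, hSeq hx, h2, h1⟩
  have hU : U.encard ≤ 1 := encard_le_one_of_not_fst_lt (hinj.mono fun x hx => hx.1)
    fun x hx y hy => not_lt_of_dvd hp hm ha hpa hx.1.1 hx.1.2.1 hy.1.1 hy.1.2.1 (hSeq hx.1)
      (hSeq hy.1) hx.2 hy.2
  have hTinj : Set.InjOn Prod.fst T := hinj.mono fun x hx => hx.1
  have hTU : (T ∪ U).encard ≤ 2 := by
    have hT : (m = 2 ∨ m = 1 ∧ p % 4 = 1) → T.encard ≤ 1 := by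
      intro h
      refine encard_le_one_of_not_fst_lt hTinj fun x hx y hy => ?_
      by_cases hp2 : p = 2
      · have hm2 : m = 2 := by omega
        subst hp2 hm2
        exact hx.2.not_lt_of_two hy.2 hp ha0 hpa' hnotsq hpell
      · exact hx.2.not_lt_of_odd_prime hy.2 hp hp2 hm0 ha0 hpa' hnotsq hpell
          (prime_pow_cases hp hp2 h)
    by_cases h : m = 2 ∨ m = 1 ∧ p % 4 = 1
    · calc (T ∪ U).encard ≤ T.encard + U.encard := Set.encard_union_le _ _
        _ ≤ 1 + 1 := add_le_add (hT h) hU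
        _ = 2 := one_add_one_eq_two
    · have hm1 : m = 1 := by omega
      subst hm1
      have hU0 : U = ∅ := Set.eq_empty_of_forall_notMem fun x hx =>
        h (.inr ⟨rfl, prime_mod_four_eq_one_of_dvd hp hx.1.1 hx.1.2.1 (hSeq hx.1) hx.2⟩)
      rw [hU0, Set.union_empty]
      exact encard_le_two_of_not_fst_lt hTinj fun x hx y hy z hz h₁ h₂ =>
        hx.2.false_of_lt_of_lt hy.2 hz.2 hp ha0 hpa' hnotsq hpell h₁ h₂
  calc S.encard ≤ ({((a : ℤ), 1)} ∪ (T ∪ U)).encard := Set.encard_le_encard hsub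
    _ ≤ ({((a : ℤ), 1)} : Set (ℤ × ℤ)).encard + (T ∪ U).encard := Set.encard_union_le _ _
    _ ≤ 1 + 2 := add_le_add (Set.encard_singleton _).le hTU
    _ = 3 := by norm_num
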